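/- arXiv:2312.03949 — 2 statements merged into one kernel-verified Lean document; each statement's English description precedes it below -/
import Mathlib

section
/- Let p, q, r, s be distinct primes, none congruent to 3 modulo 4, such that the four symbols (p/q), (q/r), (r/s), (s/p) are all equal, and such that (pr/q)₄ (pr/s)₄ (qs/p)₄ (qs/r)₄ = −1 (these quartic symbols are defined since (pr/q) = (pr/s) = (qs/p) = (qs/r) = 1 under the stated hypotheses). Then the negative Pell equation x² − pqrs·y² = −1 has no solution in integers x, y (equivalently, the fundamental unit of ℚ(√(pqrs)) has norm +1). -/
open scoped Classical in
noncomputable def legSym (a : ℤ) (p : ℕ) : ℤ :=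
  if p = 2 then (if a % 8 = 1 ∨ a % 8 = 7 then 1 else -1)
  else if ∃ x : ℤ, (p : ℤ) ∣ (x ^ 2 - a) then 1 else -1

open scoped Classical in
noncomputable def quartSym (a : ℤ) (p : ℕ) : ℤ :=
  if p = 2 then (if a % 16 = 1 ∨ a % 16 = 15 then 1 else -1)
  else if ∃ x : ℤ, (p : ℤ) ∣ (x ^ 4 - a) then 1 else -1

open scoped NumberTheorySymbols

theorem GaussianInt.exists_norm_eq_prime_dvd {p : ℕ} (hp : p.Prime) (hp4 : p % 4 ≠ 3)
    {z : GaussianInt} (h : (p : ℤ) ∣ z.norm) : ∃ w : GaussianInt, w.norm = p ∧ w ∣ z := by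
  have := Fact.mk hp
  obtain ⟨a, b, hab⟩ := Nat.Prime.sq_add_sq hp4
  let w : GaussianInt := ⟨a, b⟩
  have hw : w.norm = p := by
    rw [Zsqrtd.norm_def, ← hab]; push_cast; ring
  have hirr : Irreducible w := by
    constructor
    · rw [← Zsqrtd.norm_eq_one_iff, hw]; simpa using hp.one_lt.ne'
    · intro x y hxy
      have h1 : p = x.norm.natAbs * y.norm.natAbs := by
        rw [← Int.natAbs_mul, ← Zsqrtd.norm_mul, ← hxy, hw]; simp
      rw [← Zsqrtd.norm_eq_one_iff, ← Zsqrtd.norm_eq_one_iff]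
      rcases (Nat.dvd_prime hp).1 ⟨_, h1⟩ with h2 | h2
      · exact Or.inl h2
      · right
        rw [h2] at h1
        exact Nat.eq_of_mul_eq_mul_left hp.pos (by omega)
  have hprime : Prime w := hirr.prime
  have hdvd : w ∣ z * star z := by
    rw [← Zsqrtd.norm_eq_mul_conj]
    refine Dvd.dvd.trans ?_ ((Zsqrtd.intCast_dvd_intCast _ _).2 h)
    exact ⟨star w, by rw [← Zsqrtd.norm_eq_mul_conj, hw]⟩
  rcases hprime.dvd_or_dvd hdvd with h1 | h1
  · exact ⟨w, hw, h1⟩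
  · refine ⟨star w, by rw [Zsqrtd.norm_conj, hw], ?_⟩
    obtain ⟨c, hc⟩ := h1
    exact ⟨star c, by rw [← star_star z, hc, star_mul']⟩

theorem GaussianInt.exists_eq_mul_norm_eq_prime {p : ℕ} (hp : p.Prime) (hp4 : p % 4 ≠ 3)
    {z : GaussianInt} {m : ℤ} (h : z.norm = p * m) :
    ∃ w v : GaussianInt, z = w * v ∧ w.norm = p ∧ v.norm = m := by
  obtain ⟨w, hw, v, rfl⟩ := GaussianInt.exists_norm_eq_prime_dvd hp hp4 ⟨m, h⟩
  refine ⟨w, v, rfl, hw, ?_⟩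
  rw [Zsqrtd.norm_mul, hw] at h
  exact mul_left_cancel₀ (by exact_mod_cast hp.ne_zero) h

theorem exists_gaussian_factorization {p q r s : ℕ} (hp : p.Prime) (hq : q.Prime) (hr : r.Prime)
    (hs : s.Prime) (hp4 : p % 4 ≠ 3) (hq4 : q % 4 ≠ 3) (hr4 : r % 4 ≠ 3) (hs4 : s % 4 ≠ 3)
    {x y : ℤ} (hy : Odd y) (h : x ^ 2 + 1 = p * r * (q * s) * y ^ 2) :
    ∃ A B C D u v : ℤ, A ^ 2 + B ^ 2 = p * r ∧ C ^ 2 + D ^ 2 = q * s ∧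
      (A * D + B * C) * (u ^ 2 - v ^ 2) + 2 * (A * C - B * D) * (u * v) = 1 := by
  let z : GaussianInt := ⟨x, 1⟩
  have hz : z.norm = p * (r * (q * (s * y ^ 2))) := by
    rw [Zsqrtd.norm_def]; linear_combination h
  obtain ⟨w1, v1, e1, n1, hv1⟩ := GaussianInt.exists_eq_mul_norm_eq_prime hp hp4 hz
  obtain ⟨w2, v2, e2, n2, hv2⟩ := GaussianInt.exists_eq_mul_norm_eq_prime hr hr4 hv1
  obtain ⟨w3, v3, e3, n3, hv3⟩ := GaussianInt.exists_eq_mul_norm_eq_prime hq hq4 hv2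
  obtain ⟨w4, w, e4, n4, hw⟩ := GaussianInt.exists_eq_mul_norm_eq_prime hs hs4 hv3
  have hzw : z = w1 * w2 * (w3 * w4) * w := by rw [e1, e2, e3, e4]; ring
  have hwz : w ∣ z := ⟨_, hzw.trans (mul_comm _ _)⟩
  have hmul : w * star w = (y : GaussianInt) ^ 2 := by
    rw [← Zsqrtd.norm_eq_mul_conj, hw]; push_cast; rfl
  have hcop : IsCoprime w (star w) := by
    obtain ⟨k, hk⟩ := hy
    obtain ⟨c, hc⟩ := hwz
    have h2 : w * c - star w * star c = 2 * ⟨0, 1⟩ := by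
      rw [← hc, ← star_mul', ← hc]
      ext <;> simp [z]
    have hii : (⟨0, 1⟩ : GaussianInt) * ⟨0, 1⟩ = -1 := by ext <;> simp
    have hyk : (y : GaussianInt) = 2 * k + 1 := by rw [hk]; push_cast; ring
    set i : GaussianInt := ⟨0, 1⟩
    rw [hyk] at hmul
    refine ⟨(2 * k ^ 2 + 2 * k) * i * c + star w, -(2 * k ^ 2 + 2 * k) * i * star c, ?_⟩
    linear_combination (2 * k ^ 2 + 2 * k) * i * h2 + hmul + 2 * (2 * k ^ 2 + 2 * k) * hii
  obtain ⟨b, e, hb⟩ := exists_associated_pow_of_mul_eq_pow' hcop hmul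
  let P := w1 * w2 * e
  let Q := w3 * w4
  have hzP : z = P * Q * b ^ 2 := by rw [hzw, ← hb]; simp only [P, Q]; ring
  have he : (e : GaussianInt).norm = 1 := by
    have h1 : (e : GaussianInt).norm.natAbs = 1 := Zsqrtd.norm_eq_one_iff.2 e.isUnit
    have h2 := GaussianInt.norm_nonneg (e : GaussianInt)
    omega
  have hP : P.norm = p * r := by simp only [P, Zsqrtd.norm_mul, n1, n2, he, mul_one]
  have hQ : Q.norm = q * s := by simp only [Q, Zsqrtd.norm_mul, n3, n4]
  refine ⟨P.re, P.im, Q.re, Q.im, b.re, b.im, ?_, ?_, ?_⟩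
  · rw [← hP, Zsqrtd.norm_def]; ring
  · rw [← hQ, Zsqrtd.norm_def]; ring
  · have := congrArg Zsqrtd.im hzP
    simp [z, sq] at this
    linear_combination -this

theorem exists_isotropic_of_isSquare_mod {d e : ℕ} {m n : ℤ} (hd0 : d ≠ 0) (he0 : e ≠ 0)
    (hd : ¬ IsSquare d) (he : ¬ IsSquare e) (hde : ¬ IsSquare (d * e)) (hcop : d.Coprime e)
    (hm : (e : ℤ) ∣ m ^ 2 - d) (hn : (d : ℤ) ∣ n ^ 2 - e) :
    ∃ X Y Z : ℤ, X ^ 2 = d * Y ^ 2 + e * Z ^ 2 ∧ (X ≠ 0 ∨ Y ≠ 0 ∨ Z ≠ 0) := by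
  have : NeZero d := ⟨hd0⟩
  have : NeZero e := ⟨he0⟩
  let f : Fin (Nat.sqrt (d * e) + 1) × Fin (Nat.sqrt e + 1) × Fin (Nat.sqrt d + 1) →
      ZMod e × ZMod d := fun t =>
    ((t.1 : ℕ) - m * (t.2.1 : ℕ), (t.1 : ℕ) - n * (t.2.2 : ℕ))
  have hcard : Fintype.card (ZMod e × ZMod d) <
      Fintype.card (Fin (Nat.sqrt (d * e) + 1) × Fin (Nat.sqrt e + 1) × Fin (Nat.sqrt d + 1)) := by
    simp only [Fintype.card_prod, ZMod.card, Fintype.card_fin]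
    have h1 := Nat.lt_succ_sqrt (d * e)
    have h2 := Nat.lt_succ_sqrt e
    have h3 := Nat.lt_succ_sqrt d
    simp only [Nat.succ_eq_add_one] at h1 h2 h3
    have h4 := Nat.mul_lt_mul'' h2 h3
    have h5 := Nat.mul_lt_mul'' h1 h4
    rw [← Nat.mul_self_lt_mul_self_iff]
    calc _ = d * e * (e * d) := by ring
      _ < _ := h5
      _ = _ := by ring
  obtain ⟨⟨x, y, z⟩, ⟨x', y', z'⟩, hne, hf⟩ := Fintype.exists_ne_map_eq_of_card_lt f hcard
  simp only [f, Prod.mk.injEq] at hf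
  obtain ⟨hf1, hf2⟩ := hf
  set X : ℤ := (x : ℕ) - (x' : ℕ) with hX
  set Y : ℤ := (y : ℕ) - (y' : ℕ) with hY
  set Z : ℤ := (z : ℕ) - (z' : ℕ) with hZ
  have bound : ∀ {k : ℕ} (a b : Fin (Nat.sqrt k + 1)), ¬ IsSquare k →
      (((a : ℕ) : ℤ) - ((b : ℕ) : ℤ)) ^ 2 < k := by
    intro k a b hk
    have h1 : Nat.sqrt k * Nat.sqrt k ≤ k := Nat.sqrt_le k
    have h2 : Nat.sqrt k * Nat.sqrt k < k := lt_of_le_of_ne h1 fun h => hk ⟨_, h.symm⟩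
    have h3 : |((a : ℕ) : ℤ) - ((b : ℕ) : ℤ)| ≤ Nat.sqrt k := by
      have := a.2; have := b.2
      rw [abs_le]; omega
    calc _ = |((a : ℕ) : ℤ) - ((b : ℕ) : ℤ)| ^ 2 := (sq_abs _).symm
      _ ≤ (Nat.sqrt k : ℤ) ^ 2 := by gcongr
      _ < k := by rw [sq]; exact_mod_cast h2
  have hXb : X ^ 2 < (d * e : ℕ) := bound x x' hde
  have hYb : Y ^ 2 < e := bound y y' he
  have hZb : Z ^ 2 < d := bound z z' hd
  push_cast at hXb
  have hnz : X ≠ 0 ∨ Y ≠ 0 ∨ Z ≠ 0 := by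
    by_contra hcon
    push Not at hcon
    apply hne
    simp only [Prod.mk.injEq, Fin.ext_iff]
    omega
  have hXY : (e : ℤ) ∣ X - m * Y := by
    rw [← ZMod.intCast_zmod_eq_zero_iff_dvd]
    simp only [hX, hY]; push_cast
    linear_combination hf1
  have hXZ : (d : ℤ) ∣ X - n * Z := by
    rw [← ZMod.intCast_zmod_eq_zero_iff_dvd]
    simp only [hX, hZ]; push_cast
    linear_combination hf2
  have hdvd : (d * e : ℤ) ∣ X ^ 2 - d * Y ^ 2 - e * Z ^ 2 := by
    apply IsCoprime.mul_dvd (Nat.isCoprime_iff_coprime.2 hcop)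
    · obtain ⟨a, ha⟩ := hXZ
      obtain ⟨b, hb⟩ := hn
      exact ⟨a * (X + n * Z) + b * Z ^ 2 - Y ^ 2, by
        linear_combination (X + n * Z) * ha + Z ^ 2 * hb⟩
    · obtain ⟨a, ha⟩ := hXY
      obtain ⟨b, hb⟩ := hm
      exact ⟨a * (X + m * Y) + b * Y ^ 2 - Z ^ 2, by
        linear_combination (X + m * Y) * ha + Y ^ 2 * hb⟩
  obtain ⟨k, hk⟩ := hdvd
  have hd1 : (0 : ℤ) < d := by exact_mod_cast Nat.pos_of_ne_zero hd0
  have he1 : (0 : ℤ) < e := by exact_mod_cast Nat.pos_of_ne_zero he0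
  have hN : (0 : ℤ) < d * e := mul_pos hd1 he1
  have hk1 : k < 1 := by
    by_contra hcon
    push Not at hcon
    nlinarith [mul_le_mul_of_nonneg_left hcon hN.le, mul_nonneg hd1.le (sq_nonneg Y),
      mul_nonneg he1.le (sq_nonneg Z)]
  have hk2 : -2 < k := by
    by_contra hcon
    push Not at hcon
    nlinarith [mul_le_mul_of_nonneg_left hcon hN.le, mul_lt_mul_of_pos_left hYb hd1,
      mul_lt_mul_of_pos_left hZb he1, sq_nonneg X]
  obtain rfl | rfl : k = 0 ∨ k = -1 := by omega
  · exact ⟨X, Y, Z, by linear_combination hk, hnz⟩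
  · refine ⟨X * Z + d * Y, X + Y * Z, Z ^ 2 - d, ?_, Or.inr (Or.inr ?_)⟩
    · linear_combination (Z ^ 2 - d) * hk
    · intro h
      apply hd
      refine ⟨Z.natAbs, ?_⟩
      zify
      rw [abs_mul_abs_self]
      linear_combination -h

theorem exists_primitive_isotropic {d e : ℕ} (hd : ¬ IsSquare d) (he : ¬ IsSquare e)
    {X Y Z : ℤ} (h : X ^ 2 = d * Y ^ 2 + e * Z ^ 2) (hnz : X ≠ 0 ∨ Y ≠ 0 ∨ Z ≠ 0) :
    ∃ X Y Z : ℤ, X ^ 2 = d * Y ^ 2 + e * Z ^ 2 ∧ 0 < X ∧ Y ≠ 0 ∧ Z ≠ 0 ∧ IsCoprime Y Z := by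
  have key : ∀ {k : ℕ} {a b : ℤ}, ¬ IsSquare k → a ^ 2 = k * b ^ 2 → b = 0 := by
    intro k a b hk hab
    by_contra hb
    apply hk
    obtain ⟨c, rfl⟩ : b ∣ a := by
      rw [← Int.pow_dvd_pow_iff two_ne_zero]; exact ⟨k, by rw [hab]; ring⟩
    refine ⟨c.natAbs, ?_⟩
    zify
    rw [abs_mul_abs_self]
    apply mul_left_cancel₀ (pow_ne_zero 2 hb)
    linear_combination -hab
  have hd0 : 0 < (d : ℤ) := by
    rcases Nat.eq_zero_or_pos d with rfl | h
    · exact absurd ⟨0, rfl⟩ hd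
    · exact_mod_cast h
  have he0 : 0 < (e : ℤ) := by
    rcases Nat.eq_zero_or_pos e with rfl | h
    · exact absurd ⟨0, rfl⟩ he
    · exact_mod_cast h
  have hY : Y ≠ 0 := by
    rintro rfl
    have hZ : Z = 0 := key he (a := X) (by linear_combination h)
    subst hZ
    simp at h; simp [h] at hnz
  have hZ : Z ≠ 0 := by
    rintro rfl
    exact hY (key hd (a := X) (by linear_combination h))
  obtain ⟨g, Y', Z', hg, hcop, rfl, rfl⟩ := Int.exists_gcd_one' (m := Y) (n := Z) (Int.gcd_pos_of_ne_zero_left _ hY)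
  have hg0 : (g : ℤ) ≠ 0 := by positivity
  obtain ⟨X', rfl⟩ : (g : ℤ) ∣ X := by
    rw [← Int.pow_dvd_pow_iff two_ne_zero, h]
    exact ⟨d * Y' ^ 2 + e * Z' ^ 2, by ring⟩
  have hY' : Y' ≠ 0 := left_ne_zero_of_mul hY
  have hX : X' ^ 2 = d * Y' ^ 2 + e * Z' ^ 2 := by
    apply mul_left_cancel₀ (pow_ne_zero 2 hg0)
    linear_combination h
  refine ⟨|X'|, Y', Z', by rw [sq_abs, hX], ?_, hY', left_ne_zero_of_mul hZ,
    Int.isCoprime_iff_gcd_eq_one.2 hcop⟩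
  rw [abs_pos]
  rintro rfl
  nlinarith [sq_pos_of_ne_zero hY', mul_pos hd0 (sq_pos_of_ne_zero hY'), mul_nonneg he0.le (sq_nonneg Z')]

theorem isCoprime_of_forall_prime {a b : ℤ}
    (h : ∀ l : ℕ, l.Prime → (l : ℤ) ∣ a → (l : ℤ) ∣ b → False) : IsCoprime a b := by
  rw [Int.isCoprime_iff_gcd_eq_one]
  by_contra hg
  obtain ⟨l, hl, hlg⟩ := Nat.exists_prime_and_dvd hg
  exact h l hl ((Int.natCast_dvd_natCast.2 hlg).trans (Int.gcd_dvd_left ..))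
    ((Int.natCast_dvd_natCast.2 hlg).trans (Int.gcd_dvd_right ..))

theorem not_dvd_of_isCoprime {a b : ℤ} {l : ℕ} (h : IsCoprime a b) (hl : l.Prime)
    (ha : (l : ℤ) ∣ a) : ¬ (l : ℤ) ∣ b := fun hb =>
  (Nat.prime_iff_prime_int.1 hl).not_isUnit (h.isUnit_of_dvd' ha hb)

theorem jacobiSym_eq_of_dvd_sub {b : ℕ} {x y : ℤ} (h : (b : ℤ) ∣ x - y) : J(x | b) = J(y | b) :=
  jacobiSym.mod_left' (Int.emod_eq_emod_iff_emod_sub_eq_zero.2 (Int.emod_eq_zero_of_dvd h))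

theorem jacobiSym_sq_eq_one {b : ℕ} {a : ℤ} (h : IsCoprime a b) : J(a ^ 2 | b) = 1 :=
  jacobiSym.sq_one' (Int.isCoprime_iff_gcd_eq_one.1 h)

theorem jacobiSym_eq_one_of_dvd_sub_sq {b : ℕ} {a m : ℤ} (hab : IsCoprime a b)
    (h : (b : ℤ) ∣ m ^ 2 - a) : J(a | b) = 1 := by
  rw [← jacobiSym_eq_of_dvd_sub h]
  apply jacobiSym_sq_eq_one
  apply isCoprime_of_forall_prime
  intro l hl hm hb
  refine not_dvd_of_isCoprime hab.symm hl hb ?_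
  have h1 := hb.trans h
  rwa [dvd_sub_right (dvd_pow hm two_ne_zero)] at h1

theorem jacobiSym_neg_one_of_one_mod_four {d : ℕ} (hd : d % 4 = 1) : J(-1 | d) = 1 := by
  rw [jacobiSym.at_neg_one (Nat.odd_iff.2 (by omega)), ZMod.χ₄_nat_one_mod_four hd]

theorem jacobiSym_natAbs_left {d : ℕ} (hd : d % 4 = 1) (n : ℤ) : J((n.natAbs : ℤ) | d) = J(n | d) := by
  rcases Int.natAbs_eq n with h | h
  · rw [← h]
  · conv_rhs => rw [h, ← neg_one_mul, jacobiSym.mul_left, jacobiSym_neg_one_of_one_mod_four hd, one_mul]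

/-- Reciprocity against a modulus `n` for which `d` is a square up to a square. -/
theorem jacobiSym_eq_one_of_odd {d : ℕ} (hd : d % 4 = 1) {n x z : ℤ} (hn : Odd n)
    (h : n ∣ d * z ^ 2 - x ^ 2) (hz : IsCoprime n z) (hnd : IsCoprime n d) : J(n | d) = 1 := by
  have hn' : Odd n.natAbs := Int.natAbs_odd.2 hn
  rw [← jacobiSym_natAbs_left hd, jacobiSym.quadratic_reciprocity_one_mod_four' hn' hd]
  have hz' : IsCoprime z (n.natAbs : ℤ) := by
    rw [Int.natCast_natAbs]; exact (IsCoprime.abs_left hz).symm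
  have hd' : IsCoprime (d : ℤ) (n.natAbs : ℤ) := by
    rw [Int.natCast_natAbs]; exact (IsCoprime.abs_left hnd).symm
  have h1 : J((d : ℤ) * z ^ 2 | n.natAbs) = 1 := by
    apply jacobiSym_eq_one_of_dvd_sub_sq (m := x) (hd'.mul_left hz'.pow_left)
    rw [Int.natCast_natAbs, abs_dvd, ← dvd_neg, neg_sub]
    exact h
  rwa [jacobiSym.mul_left, jacobiSym_sq_eq_one hz', mul_one] at h1

theorem jacobiSym_two_of_one_mod_eight {d : ℕ} (hd : d % 8 = 1) : J(2 | d) = 1 := by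
  rw [jacobiSym.at_two (Nat.odd_iff.2 (by omega)), ZMod.χ₈_nat_eq_if_mod_eight]
  simp [hd]; omega

theorem jacobiSym_two_of_five_mod_eight {d : ℕ} (hd : d % 8 = 5) : J(2 | d) = -1 := by
  rw [jacobiSym.at_two (Nat.odd_iff.2 (by omega)), ZMod.χ₈_nat_eq_if_mod_eight]
  simp [hd]; omega

theorem jacobiSym_eq_two_of_even {d : ℕ} (hd : d % 4 = 1) {n x z : ℤ} (hn : Even n) (hn0 : n ≠ 0)
    (h4 : (4 : ℤ) ∣ n → d % 8 = 1)
    (h : n ∣ d * z ^ 2 - x ^ 2) (hz : IsCoprime n z) (hnd : IsCoprime n d) :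
    J(n | d) = J(2 | d) := by
  obtain ⟨m, hk, hm⟩ := (Int.finiteMultiplicity_iff.2 ⟨by decide, hn0⟩ :
    FiniteMultiplicity (2 : ℤ) n).exists_eq_pow_mul_and_not_dvd
  rw [← even_iff_two_dvd, Int.not_even_iff_odd] at hm
  generalize multiplicity 2 n = k at hk
  have hmn : m ∣ n := ⟨2 ^ k, by rw [hk]; ring⟩
  have hm1 : J(m | d) = 1 := jacobiSym_eq_one_of_odd hd hm (hmn.trans h)
    (hz.of_isCoprime_of_dvd_left hmn) (hnd.of_isCoprime_of_dvd_left hmn)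
  rw [hk, jacobiSym.mul_left, hm1, mul_one, jacobiSym.pow_left]
  match k, hk with
  | 0, hk => 
    rw [pow_zero, one_mul] at hk
    exact absurd hn (by rw [hk]; exact Int.not_even_iff_odd.2 hm)
  | 1, hk => simp
  | k + 2, hk =>
    rw [jacobiSym_two_of_one_mod_eight (h4 ⟨2 ^ k * m, by rw [hk]; ring⟩), one_pow]

theorem jacobiSym_neg_eq_one_of_mul_eq_sq_add (d : ℤ) (T : ℕ) : ∀ {S a b : ℤ}, Odd T →
    IsCoprime (T : ℤ) d → T * S = a ^ 2 + d * b ^ 2 →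
    (∀ l : ℕ, l.Prime → (l : ℤ) ∣ T → (l : ℤ) ∣ S → (l : ℤ) ∣ a → False) → J(-d | T) = 1 := by
  induction T using Nat.strong_induction_on with
  | _ T ih =>
  intro S a b hT hTd h hl
  by_cases hcop : ∃ l : ℕ, l.Prime ∧ (l : ℤ) ∣ T ∧ (l : ℤ) ∣ a
  · obtain ⟨l, lp, hlT, hla⟩ := hcop
    have lp' : Prime (l : ℤ) := Nat.prime_iff_prime_int.1 lp
    have hlb : (l : ℤ) ∣ b := by
      have h1 : (l : ℤ) ∣ a ^ 2 + d * b ^ 2 := h ▸ hlT.mul_right S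
      rw [dvd_add_right (dvd_pow hla two_ne_zero)] at h1
      exact lp'.dvd_of_dvd_pow ((lp'.dvd_or_dvd h1).resolve_left (not_dvd_of_isCoprime hTd lp hlT))
    obtain ⟨a, rfl⟩ := hla
    obtain ⟨b, rfl⟩ := hlb
    have hlS : ¬ (l : ℤ) ∣ S := fun hS => hl l lp hlT hS (dvd_mul_right _ _)
    have hl2 : (l : ℤ) ^ 2 ∣ T := by
      refine lp'.pow_dvd_of_dvd_mul_right 2 hlS (b := S) (a := (T : ℤ)) ?_
      exact ⟨a ^ 2 + d * b ^ 2, by rw [h]; ring⟩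
    obtain ⟨T', rfl⟩ : l ^ 2 ∣ T := by exact_mod_cast hl2
    have hl0 : l ≠ 0 := lp.ne_zero
    have hT0 : T' ≠ 0 := by rintro rfl; simp at hT
    have : NeZero l := ⟨hl0⟩
    have : NeZero T' := ⟨hT0⟩
    have hdvd : (T' : ℤ) ∣ ((l ^ 2 * T' : ℕ) : ℤ) := by push_cast; exact dvd_mul_left _ _
    have hlt : T' < l ^ 2 * T' := by
      exact lt_mul_left (Nat.pos_of_ne_zero hT0) (Nat.one_lt_pow two_ne_zero lp.one_lt)
    have key := ih T' hlt (S := S) (a := a) (b := b) (Nat.odd_mul.1 hT).2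
      (hTd.of_isCoprime_of_dvd_left hdvd)
      (by
        have : ((l : ℤ) ^ 2) ≠ 0 := pow_ne_zero _ (by exact_mod_cast hl0)
        apply mul_left_cancel₀ this
        push_cast at h
        linear_combination h)
      (fun l' lp' h1 h2 h3 => hl l' lp' (h1.trans hdvd) h2 (h3.mul_left _))
    have hlc : IsCoprime (-d) (l : ℤ) := (hTd.of_isCoprime_of_dvd_left hlT).symm.neg_left
    rw [sq, mul_assoc, jacobiSym.mul_right, jacobiSym.mul_right, key, mul_one, ← sq]
    exact jacobiSym.sq_one (Int.isCoprime_iff_gcd_eq_one.1 hlc)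
  · push Not at hcop
    have hb : IsCoprime b T := by
      apply isCoprime_of_forall_prime
      intro l lp h1 h2
      refine hcop l lp h2 ?_
      have h3 : (l : ℤ) ∣ a ^ 2 + d * b ^ 2 := h ▸ h2.mul_right S
      rw [dvd_add_left ((dvd_pow h1 two_ne_zero).mul_left _)] at h3
      exact (Nat.prime_iff_prime_int.1 lp).dvd_of_dvd_pow h3
    have h1 : J(-d * b ^ 2 | T) = 1 := by
      apply jacobiSym_eq_one_of_dvd_sub_sq (m := a) (hTd.symm.neg_left.mul_left hb.pow_left)
      exact ⟨S, by rw [h]; ring⟩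
    rwa [jacobiSym.mul_left, jacobiSym_sq_eq_one hb, mul_one] at h1

theorem jacobiSym_eq_χ₄_of_mul_eq_sq_add {d T : ℕ} {S a b : ℤ} (hd : d % 4 = 1) (hT : Odd T)
    (hTd : IsCoprime (T : ℤ) d) (h : T * S = a ^ 2 + d * b ^ 2)
    (hl : ∀ l : ℕ, l.Prime → (l : ℤ) ∣ T → (l : ℤ) ∣ S → (l : ℤ) ∣ a → False) :
    J(T | d) = ZMod.χ₄ T := by
  rw [jacobiSym.quadratic_reciprocity_one_mod_four' hT hd, ← neg_neg (d : ℤ), jacobiSym.neg _ hT,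
    jacobiSym_neg_eq_one_of_mul_eq_sq_add d T hT hTd h hl, mul_one]

theorem not_dvd_of_isotropic {d e : ℕ} (he : Squarefree e) {X Y Z : ℤ}
    (h : X ^ 2 = d * Y ^ 2 + e * Z ^ 2) (hYZ : IsCoprime Y Z) {l : ℕ} (hl : l.Prime)
    (hX : (l : ℤ) ∣ X) : ¬ (l : ℤ) ∣ Y := by
  intro hY
  have hl' := Nat.prime_iff_prime_int.1 hl
  have hZ := not_dvd_of_isCoprime hYZ hl hY
  have h1 : (l : ℤ) ^ 2 ∣ e * Z ^ 2 := by
    rw [← dvd_add_right ((pow_dvd_pow_of_dvd hY 2).mul_left (d : ℤ)), ← h]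
    exact pow_dvd_pow_of_dvd hX 2
  have h2 : (l : ℤ) ^ 2 ∣ e :=
    hl'.pow_dvd_of_dvd_mul_right 2 (fun hc => hZ (hl'.dvd_of_dvd_pow hc)) h1
  have h3 : l * l ∣ e := by rw [← sq]; exact_mod_cast h2
  exact hl.not_isUnit (he l h3)

theorem not_dvd_of_isotropic_of_dvd {d e : ℕ} (he : Squarefree e) {X Y Z : ℤ}
    (h : X ^ 2 = d * Y ^ 2 + e * Z ^ 2) (hYZ : IsCoprime Y Z) {l : ℕ} (hl : l.Prime)
    (hle : (l : ℤ) ∣ e) : ¬ (l : ℤ) ∣ Y := by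
  intro hY
  refine not_dvd_of_isotropic he h hYZ hl ?_ hY
  apply (Nat.prime_iff_prime_int.1 hl).dvd_of_dvd_pow (n := 2)
  rw [h]
  exact dvd_add ((dvd_pow hY two_ne_zero).mul_left _) (hle.mul_right _)

theorem not_dvd_of_sq_add_sq {e : ℕ} (he : Squarefree e) {C D : ℤ} (h : C ^ 2 + D ^ 2 = e)
    {l : ℕ} (hl : l.Prime) (hC : (l : ℤ) ∣ C) : ¬ (l : ℤ) ∣ D := by
  intro hD
  have h2 : (l : ℤ) ^ 2 ∣ e := by
    rw [← h]; exact dvd_add (pow_dvd_pow_of_dvd hC 2) (pow_dvd_pow_of_dvd hD 2)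
  have h3 : l * l ∣ e := by rw [← sq]; exact_mod_cast h2
  exact hl.not_isUnit (he l h3)

theorem Int.sq_mod_eight_of_odd {a : ℤ} (ha : Odd a) : a ^ 2 % 8 = 1 := by
  obtain ⟨k, rfl⟩ := ha
  obtain ⟨m, hm⟩ := Int.even_mul_succ_self k
  have : (2 * k + 1) ^ 2 = 8 * m + 1 := by linear_combination 4 * hm
  omega

theorem mod_four_eq_one_of_χ₄ {t : ℕ} (h : ZMod.χ₄ (t : ZMod 4) = 1) : t % 4 = 1 := by
  rw [ZMod.χ₄_nat_eq_if_mod_four] at h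
  split_ifs at h <;> first | assumption | simp at h

theorem add_emod_four_of_isCoprime {d e : ℕ} {A B C D u v X Y Z : ℤ} (hd : Squarefree d)
    (he : Squarefree e) (he1 : e ≠ 1) (he4 : e % 4 = 1) (he8 : Even d → e % 8 = 1)
    (hAB : A ^ 2 + B ^ 2 = d) (hCD : C ^ 2 + D ^ 2 = e)
    (huv : (A * D + B * C) * (u ^ 2 - v ^ 2) + 2 * (A * C - B * D) * (u * v) = 1)
    (h : X ^ 2 = d * Y ^ 2 + e * Z ^ 2) (hX0 : 0 < X) (hY0 : Y ≠ 0) (hZ0 : Z ≠ 0) (hY : Even Y)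
    (hYZ : IsCoprime Y Z) (hT : IsCoprime (X + A * Y) e) : (X + Y) % 4 = 1 := by
  have hed : Odd e := Nat.odd_iff.2 (by omega)
  have he2 : IsCoprime (2 : ℤ) e := by
    rw [Int.isCoprime_iff_gcd_eq_one]; exact_mod_cast Nat.coprime_two_left.2 hed
  have hedZ : Odd (e : ℤ) := by exact_mod_cast hed
  have hZ : Odd Z := by
    rw [← Int.not_even_iff_odd]
    intro hZ
    exact not_dvd_of_isCoprime hYZ Nat.prime_two (even_iff_two_dvd.1 hY) (even_iff_two_dvd.1 hZ)
  have hXo : Odd X := by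
    have : Odd (X ^ 2) := by
      rw [h]
      exact Even.add_odd ((hY.pow_of_ne_zero two_ne_zero).mul_left _) (hedZ.mul hZ.pow)
    exact Int.Odd.of_mul_left (n := X) (by rwa [← sq])
  have hX8 := Int.sq_mod_eight_of_odd hXo
  have hZ8 := Int.sq_mod_eight_of_odd hZ
  have hYe : IsCoprime Y e := isCoprime_of_forall_prime fun l hl h1 h2 =>
    not_dvd_of_isotropic_of_dvd he h hYZ hl h2 h1
  have hDe : IsCoprime D e := by
    refine isCoprime_of_forall_prime fun l hl h1 h2 => ?_
    refine not_dvd_of_sq_add_sq he hCD hl ?_ h1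
    apply (Nat.prime_iff_prime_int.1 hl).dvd_of_dvd_pow (n := 2)
    rwa [← hCD, dvd_add_left (dvd_pow h1 two_ne_zero)] at h2
  have hD0 : D ≠ 0 := by
    rintro rfl
    rw [isCoprime_zero_left, Int.isUnit_iff] at hDe
    omega
  set E := A * D + B * C with hE
  have hEe : IsCoprime E e := by
    refine isCoprime_of_forall_prime fun l hl h1 h2 => ?_
    have hl' := Nat.prime_iff_prime_int.1 hl
    have hF : (l : ℤ) ∣ A * C - B * D := by
      apply hl'.dvd_of_dvd_pow (n := 2)
      have : (A * C - B * D) ^ 2 = d * e - E ^ 2 := by rw [← hAB, ← hCD, hE]; ring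
      rw [this]
      exact dvd_sub (h2.mul_left _) (dvd_pow h1 two_ne_zero)
    apply hl'.not_dvd_one
    rw [← huv]
    exact dvd_add (h1.mul_right _) ((hF.mul_left _).mul_right _)
  have hEo : Odd E := by
    rw [← Int.not_even_iff_odd]
    rintro ⟨k, hk⟩
    rw [hk] at huv
    have : 2 * (k * (u ^ 2 - v ^ 2) + (A * C - B * D) * (u * v)) = 1 := by linear_combination huv
    omega
  have hepos : (0 : ℤ) < e := by exact_mod_cast Nat.pos_of_ne_zero he.ne_zero
  have hTS : (X + A * Y) * (X - A * Y) = (B * Y) ^ 2 + e * Z ^ 2 := by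
    linear_combination h - Y ^ 2 * hAB
  have hTpos : 0 < X + A * Y := by
    have h1 : 0 < (X + A * Y) * (X - A * Y) := by
      rw [hTS]; have := mul_pos hepos (sq_pos_of_ne_zero hZ0); positivity
    rcases pos_and_pos_or_neg_and_neg_of_mul_pos h1 with h2 | h2
    · exact h2.1
    · linarith [h2.1, h2.2]
  have hTo : Odd (X + A * Y) := hXo.add_even (hY.mul_left _)
  obtain ⟨t, ht⟩ := Int.eq_ofNat_of_zero_le hTpos.le
  have hto : Odd t := by rw [ht] at hTo; exact_mod_cast hTo
  have hJT : jacobiSym (X + A * Y) e = ZMod.χ₄ t := by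
    rw [ht] at hTS hT ⊢
    refine jacobiSym_eq_χ₄_of_mul_eq_sq_add he4 hto hT hTS fun l hl h1 h2 h3 => ?_
    have hl' := Nat.prime_iff_prime_int.1 hl
    rw [← ht] at h1
    have hl2 : ¬ (l : ℤ) ∣ 2 := fun hc => by
      have : (2 : ℤ) ∣ X + A * Y := by
        have : l = 2 := (Nat.prime_dvd_prime_iff_eq hl Nat.prime_two).1 (by exact_mod_cast hc)
        subst this; exact_mod_cast h1
      exact Int.not_even_iff_odd.2 hTo (even_iff_two_dvd.2 this)
    have hlX : (l : ℤ) ∣ X := by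
      have : (l : ℤ) ∣ 2 * X := by
        have := dvd_add h1 h2; ring_nf at this; rwa [mul_comm] at this
      exact (hl'.dvd_or_dvd this).resolve_left hl2
    have hlY := not_dvd_of_isotropic he h hYZ hl hlX
    rw [dvd_add_right hlX] at h1
    exact not_dvd_of_sq_add_sq hd hAB hl ((hl'.dvd_or_dvd h1).resolve_right hlY)
      ((hl'.dvd_or_dvd h3).resolve_right hlY)
  have hY4 : (4 : ℤ) ∣ Y → e % 8 = 1 := by
    rintro ⟨y, rfl⟩
    obtain ⟨k, hk⟩ : ∃ k, Z ^ 2 = 8 * k + 1 := ⟨Z ^ 2 / 8, by omega⟩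
    rw [hk] at h
    have : X ^ 2 = 8 * (2 * d * y ^ 2 + e * k) + e := by rw [h]; ring
    omega
  have hJY : jacobiSym Y e = jacobiSym 2 e :=
    jacobiSym_eq_two_of_even he4 hY hY0 hY4 ⟨-(d * Y), by rw [h]; ring⟩ hYZ hYe
  have hJE : jacobiSym E e = 1 :=
    jacobiSym_eq_one_of_dvd_sub_sq hEe (m := E * u + (A * C - B * D) * v)
      ⟨d * v ^ 2, by
        rw [← hAB, ← hCD]
        linear_combination E * huv + v ^ 2 * (E + A * D + B * C) * hE⟩
  have hprod : jacobiSym (2 * (X + A * Y) * E * D * Y) e = 1 := by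
    apply jacobiSym_eq_one_of_dvd_sub_sq (m := E * Y + D * X)
      ((((he2.mul_left hT).mul_left hEe).mul_left hDe).mul_left hYe)
    refine ⟨D ^ 2 * Z ^ 2 + B ^ 2 * Y ^ 2, ?_⟩
    linear_combination D ^ 2 * h - D ^ 2 * Y ^ 2 * hAB + B ^ 2 * Y ^ 2 * hCD
  have h22 : jacobiSym 2 e ^ 2 = 1 := jacobiSym.sq_one (Int.isCoprime_iff_gcd_eq_one.1 he2)
  simp only [jacobiSym.mul_left, hJE, hJY, hJT] at hprod
  have hTD : ZMod.χ₄ t * jacobiSym D e = 1 := by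
    linear_combination hprod - ZMod.χ₄ t * jacobiSym D e * h22
  obtain ⟨y, hy⟩ := hY
  have hCo : D ∣ e * 1 ^ 2 - C ^ 2 := ⟨D, by rw [← hCD]; ring⟩
  rcases Int.even_or_odd D with hD | hD
  · have hCodd : Odd C := by
      rw [← Int.not_even_iff_odd]
      intro hC
      exact not_dvd_of_sq_add_sq he hCD Nat.prime_two (even_iff_two_dvd.1 hC) (even_iff_two_dvd.1 hD)
    have hC8 := Int.sq_mod_eight_of_odd hCodd
    have hBo : Odd B := by
      rw [hE, Int.odd_add', ] at hEo
      exact Int.Odd.of_mul_left (hEo.2 (hD.mul_left _))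
    have hJD : jacobiSym D e = jacobiSym 2 e := by
      refine jacobiSym_eq_two_of_even he4 hD hD0 ?_ hCo isCoprime_one_right hDe
      rintro ⟨k, rfl⟩
      have : C ^ 2 + 8 * (2 * k ^ 2) = e := by rw [← hCD]; ring
      omega
    rw [hJD] at hTD
    rcases Int.even_or_odd A with hA | hA
    · obtain ⟨a, rfl⟩ := hA
      obtain ⟨b, hb⟩ := hBo
      have hd4 : 4 * (a ^ 2 + b ^ 2 + b) + 1 = (d : ℤ) := by rw [← hAB, hb]; ring
      obtain ⟨k, hk⟩ : ∃ k, Z ^ 2 = 8 * k + 1 := ⟨Z ^ 2 / 8, by omega⟩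
      have hXm : X ^ 2 = 8 * (2 * (a ^ 2 + b ^ 2 + b) * y ^ 2 + e * k) + 4 * y ^ 2 + e := by
        rw [h, hk, hy, ← hd4]; ring
      have hTm : X + 4 * (a * y) = t := by rw [← ht, hy]; ring
      rcases Int.even_or_odd y with hy2 | hy2
      · have he' : e % 8 = 1 := hY4 (by obtain ⟨k, rfl⟩ := hy2; exact ⟨k, by rw [hy]; ring⟩)
        rw [jacobiSym_two_of_one_mod_eight he', mul_one] at hTD
        have := mod_four_eq_one_of_χ₄ hTD
        obtain ⟨k, rfl⟩ := hy2
        omega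
      · have hy8 := Int.sq_mod_eight_of_odd hy2
        have he' : e % 8 = 5 := by omega
        rw [jacobiSym_two_of_five_mod_eight he'] at hTD
        have ht1 : t % 4 ≠ 1 := by
          intro hc
          rw [ZMod.χ₄_nat_one_mod_four hc] at hTD
          norm_num at hTD
        obtain ⟨k, rfl⟩ := hy2
        obtain ⟨k', hk'⟩ := hto
        omega
    · have hde : Even d := by
        have : Even (d : ℤ) := by
          rw [← hAB]; exact hA.pow.add_odd hBo.pow
        exact_mod_cast this
      rw [jacobiSym_two_of_one_mod_eight (he8 hde), mul_one] at hTD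
      have := mod_four_eq_one_of_χ₄ hTD
      obtain ⟨a, rfl⟩ := hA
      have hTm : X + Y + 4 * (a * y) = t := by rw [← ht, hy]; ring
      omega
  · rw [jacobiSym_eq_one_of_odd he4 hD hCo isCoprime_one_right hDe, mul_one] at hTD
    have := mod_four_eq_one_of_χ₄ hTD
    have hCe : Even C := by
      have h1 : Odd (C ^ 2 + D ^ 2) := hCD ▸ hedZ
      rw [Int.odd_add'] at h1
      exact (Int.even_pow' two_ne_zero).1 (h1.1 hD.pow)
    have hA : Odd A := by
      rw [hE, Int.odd_add] at hEo
      exact Int.Odd.of_mul_left (hEo.2 (hCe.mul_left _))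
    obtain ⟨a, rfl⟩ := hA
    have hTm : X + Y + 4 * (a * y) = t := by rw [← ht, hy]; ring
    omega

theorem add_emod_four {d q s : ℕ} {A B C D u v X Y Z : ℤ} (hd : Squarefree d)
    (hq : q.Prime) (hs : s.Prime) (hqs : q ≠ s) (hq4 : q % 4 = 1) (hs4 : s % 4 = 1)
    (hcop : d.Coprime (q * s)) (he8 : Even d → q * s % 8 = 1)
    (hAB : A ^ 2 + B ^ 2 = d) (hCD : C ^ 2 + D ^ 2 = (q * s : ℕ))
    (huv : (A * D + B * C) * (u ^ 2 - v ^ 2) + 2 * (A * C - B * D) * (u * v) = 1)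
    (h : X ^ 2 = d * Y ^ 2 + (q * s : ℕ) * Z ^ 2) (hX0 : 0 < X) (hY0 : Y ≠ 0) (hZ0 : Z ≠ 0)
    (hY : Even Y) (hYZ : IsCoprime Y Z) : (X + Y) % 4 = 1 := by
  have he : Squarefree (q * s) :=
    (Nat.squarefree_mul ((Nat.coprime_primes hq hs).2 hqs)).2 ⟨hq.squarefree, hs.squarefree⟩
  have he1 : q * s ≠ 1 := fun hc => hq.one_lt.ne' (Nat.eq_one_of_mul_eq_one_right hc)
  have he4 : q * s % 4 = 1 := by rw [Nat.mul_mod, hq4, hs4]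
  have hdvd : ∀ {l : ℕ} {A B Y : ℤ}, l.Prime → l ∣ q * s → A ^ 2 + B ^ 2 = d →
      X ^ 2 = d * Y ^ 2 + (q * s : ℕ) * Z ^ 2 → IsCoprime Y Z → (l : ℤ) ∣ X + A * Y →
      (l : ℤ) ∣ B := by
    intro l A B Y hl hle hAB h hYZ hlT
    have hl' := Nat.prime_iff_prime_int.1 hl
    have hle' : (l : ℤ) ∣ (q * s : ℕ) := by exact_mod_cast hle
    have h1 : (l : ℤ) ∣ (B * Y) ^ 2 := by
      have : (B * Y) ^ 2 = (X + A * Y) * (X - A * Y) - (q * s : ℕ) * Z ^ 2 := by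
        linear_combination Y ^ 2 * hAB - h
      rw [this]
      exact dvd_sub (hlT.mul_right _) (hle'.mul_right _)
    exact (hl'.dvd_or_dvd (hl'.dvd_of_dvd_pow h1)).resolve_right
      (not_dvd_of_isotropic_of_dvd he h hYZ hl hle')
  have hcoprime : ∀ {T : ℤ}, ¬ (q : ℤ) ∣ T → ¬ (s : ℤ) ∣ T → IsCoprime T (q * s : ℕ) := by
    intro T h1 h2
    push_cast
    exact IsCoprime.mul_right ((Nat.prime_iff_prime_int.1 hq).coprime_iff_not_dvd.2 h1).symm
      ((Nat.prime_iff_prime_int.1 hs).coprime_iff_not_dvd.2 h2).symm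
  have hABl : ∀ {l : ℕ}, l.Prime → l ∣ q * s → (l : ℤ) ∣ A → ¬ (l : ℤ) ∣ B := fun hl _ hA =>
    not_dvd_of_sq_add_sq hd hAB hl hA
  have hl2X : ∀ {l : ℕ}, l.Prime → l ∣ q * s → (l : ℤ) ∣ X + A * Y → ¬ (l : ℤ) ∣ X + A * -Y := by
    intro l hl hle h1 h2
    have hl' := Nat.prime_iff_prime_int.1 hl
    have hle' : (l : ℤ) ∣ (q * s : ℕ) := by exact_mod_cast hle
    have h3 : (l : ℤ) ∣ 2 * X := by
      have := dvd_add h1 h2; ring_nf at this; rwa [mul_comm] at this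
    have hl2 : ¬ (l : ℤ) ∣ 2 := fun hc => by
      have : l = 2 := (Nat.prime_dvd_prime_iff_eq hl Nat.prime_two).1 (by exact_mod_cast hc)
      subst this; omega
    have hX := (hl'.dvd_or_dvd h3).resolve_left hl2
    have hdY : (l : ℤ) ∣ d * Y ^ 2 := by
      have : d * Y ^ 2 = X ^ 2 - (q * s : ℕ) * Z ^ 2 := by linear_combination -h
      rw [this]
      exact dvd_sub (dvd_pow hX two_ne_zero) (hle'.mul_right _)
    rcases hl'.dvd_or_dvd hdY with h4 | h4
    · exact Nat.not_coprime_of_dvd_of_dvd hl.one_lt (by exact_mod_cast h4) hle hcop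
    · exact not_dvd_of_isotropic he h hYZ hl hX (hl'.dvd_of_dvd_pow h4)
  have hqe : q ∣ q * s := dvd_mul_right _ _
  have hse : s ∣ q * s := dvd_mul_left _ _
  have direct : IsCoprime (X + A * Y) (q * s : ℕ) → (X + Y) % 4 = 1 :=
    add_emod_four_of_isCoprime hd he he1 he4 he8 hAB hCD huv h hX0 hY0 hZ0 hY hYZ
  have flipped : IsCoprime (X + A * -Y) (q * s : ℕ) → (X + Y) % 4 = 1 := by
    intro hT
    have := add_emod_four_of_isCoprime hd he he1 he4 he8 hAB hCD huv (by rw [h]; ring) hX0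
      (neg_ne_zero.2 hY0) hZ0 hY.neg hYZ.neg_left hT
    obtain ⟨y, rfl⟩ := hY
    omega
  have swapped : ¬ (q : ℤ) ∣ A → ¬ (s : ℤ) ∣ A → (X + Y) % 4 = 1 := by
    intro h1 h2
    have hAB' : (-B) ^ 2 + A ^ 2 = d := by rw [← hAB]; ring
    exact add_emod_four_of_isCoprime (A := -B) (B := A) (C := D) (D := -C) (u := u) (v := v) hd he he1 he4 he8 hAB'
      (by rw [← hCD]; ring) (by linear_combination huv) h hX0 hY0 hZ0 hY hYZ
      (hcoprime (fun hc => h1 (hdvd hq hqe hAB' h hYZ hc)) (fun hc => h2 (hdvd hs hse hAB' h hYZ hc)))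
  have mixed : ∀ {l m : ℕ}, l.Prime → m.Prime → l ∣ q * s → m ∣ q * s → (m : ℤ) ∣ A →
      (∀ {T : ℤ}, ¬ (l : ℤ) ∣ T → ¬ (m : ℤ) ∣ T → IsCoprime T (q * s : ℕ)) →
      (X + Y) % 4 = 1 := by
    intro l m hl hm hle hme hA hc
    have hB := hABl hm hme hA
    by_cases hT : (l : ℤ) ∣ X + A * Y
    · exact flipped (hc (hl2X hl hle hT) fun h1 =>
        hB (hdvd hm hme hAB (by rw [h]; ring) hYZ.neg_left h1))
    · exact direct (hc hT fun h1 => hB (hdvd hm hme hAB h hYZ h1))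
  by_cases hqA : (q : ℤ) ∣ A
  · exact mixed hs hq hse hqe hqA fun h1 h2 => hcoprime h2 h1
  by_cases hsA : (s : ℤ) ∣ A
  · exact mixed hq hs hqe hse hsA fun h1 h2 => hcoprime h1 h2
  exact swapped hqA hsA

theorem isCoprime_of_not_dvd {l : ℕ} (hl : l.Prime) {a : ℤ} (h : ¬ (l : ℤ) ∣ a) :
    IsCoprime a l :=
  ((Nat.prime_iff_prime_int.1 hl).coprime_iff_not_dvd.2 h).symm

theorem jacobiSym_eq_one_iff_exists {q : ℕ} (hq : q.Prime) {a : ℤ} (ha : ¬ (q : ℤ) ∣ a) :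
    J(a | q) = 1 ↔ ∃ x : ℤ, (q : ℤ) ∣ x ^ 2 - a := by
  have := Fact.mk hq
  constructor
  · intro h
    rw [← jacobiSym.legendreSym.to_jacobiSym, legendreSym.eq_one_iff] at h
    · obtain ⟨y, hy⟩ := h
      obtain ⟨x, rfl⟩ := ZMod.intCast_surjective y
      refine ⟨x, ?_⟩
      rw [← ZMod.intCast_zmod_eq_zero_iff_dvd]
      push_cast
      rw [hy]; ring
    · rwa [Ne, ZMod.intCast_zmod_eq_zero_iff_dvd]
  · rintro ⟨x, hx⟩
    exact jacobiSym_eq_one_of_dvd_sub_sq (isCoprime_of_not_dvd hq ha) hx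

theorem legSym_eq_jacobiSym {q : ℕ} (hq : q.Prime) (hq2 : q ≠ 2) {a : ℤ} (ha : ¬ (q : ℤ) ∣ a) :
    legSym a q = J(a | q) := by
  rw [legSym, if_neg hq2]
  have h := jacobiSym_eq_one_iff_exists hq ha
  split_ifs with hx
  · exact (h.2 hx).symm
  · have := jacobiSym.eq_one_or_neg_one
      (Int.isCoprime_iff_gcd_eq_one.1 (isCoprime_of_not_dvd hq ha))
    exact (this.resolve_left fun hc => hx (h.1 hc)).symm

theorem quartSym_eq_jacobiSym {q : ℕ} (hq : q.Prime) (hq4 : q % 4 = 1) {a X Y : ℤ}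
    (h : (q : ℤ) ∣ X ^ 2 - a * Y ^ 2) (hX : ¬ (q : ℤ) ∣ X) (hY : ¬ (q : ℤ) ∣ Y) :
    quartSym a q = J(X | q) * J(Y | q) := by
  have hq' := Nat.prime_iff_prime_int.1 hq
  have hXY : ¬ (q : ℤ) ∣ X * Y := hq'.not_dvd_mul hX hY
  rw [quartSym, if_neg (by rintro rfl; omega), ← jacobiSym.mul_left]
  split_ifs with hx
  · obtain ⟨x, hx⟩ := hx
    have h1 : (q : ℤ) ∣ (X - x ^ 2 * Y) * (X + x ^ 2 * Y) := by
      have : (X - x ^ 2 * Y) * (X + x ^ 2 * Y) = X ^ 2 - a * Y ^ 2 - (x ^ 4 - a) * Y ^ 2 := by ring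
      rw [this]
      exact dvd_sub h (hx.mul_right _)
    rcases hq'.dvd_or_dvd h1 with h2 | h2
    · refine (jacobiSym_eq_one_of_dvd_sub_sq (m := x * Y) (isCoprime_of_not_dvd hq hXY) ?_).symm
      obtain ⟨c, hc⟩ := h2
      exact ⟨-(c * Y), by linear_combination -Y * hc⟩
    · have := jacobiSym_eq_one_of_dvd_sub_sq (a := -1 * (X * Y)) (m := x * Y)
        (by rw [neg_one_mul]; exact (isCoprime_of_not_dvd hq hXY).neg_left) (b := q) (by
          obtain ⟨c, hc⟩ := h2
          exact ⟨c * Y, by linear_combination Y * hc⟩)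
      rw [jacobiSym.mul_left, jacobiSym_neg_one_of_one_mod_four hq4, one_mul] at this
      exact this.symm
  · have := jacobiSym.eq_one_or_neg_one
      (Int.isCoprime_iff_gcd_eq_one.1 (isCoprime_of_not_dvd hq hXY))
    refine (this.resolve_left fun hc => hx ?_).symm
    obtain ⟨w, hw⟩ := (jacobiSym_eq_one_iff_exists hq hXY).1 hc
    obtain ⟨m, k, hmk⟩ := (isCoprime_of_not_dvd hq hY)
    obtain ⟨c, hc⟩ := hw
    obtain ⟨b, hb⟩ := h
    refine ⟨w * m, ?_⟩
    rw [← ZMod.intCast_zmod_eq_zero_iff_dvd]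
    have e1 : (m : ZMod q) * Y = 1 := by
      have := congrArg (Int.cast : ℤ → ZMod q) hmk
      simpa using this
    have e2 : (w : ZMod q) ^ 2 = X * Y := by
      have := congrArg (Int.cast : ℤ → ZMod q) hc
      push_cast at this
      rw [ZMod.natCast_self] at this
      linear_combination this
    have e3 : (X : ZMod q) ^ 2 = a * Y ^ 2 := by
      have := congrArg (Int.cast : ℤ → ZMod q) hb
      push_cast at this
      rw [ZMod.natCast_self] at this
      linear_combination this
    push_cast
    linear_combination m ^ 4 * (w ^ 2 + X * Y) * e2 + m ^ 4 * Y ^ 2 * e3 +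
      a * (m * Y + 1) * (m ^ 2 * Y ^ 2 + 1) * e1

theorem even_or_even_of_isotropic {d e : ℕ} {X Y Z : ℤ} (hd : d % 4 = 1) (he : e % 4 = 1)
    (h : X ^ 2 = d * Y ^ 2 + e * Z ^ 2) : Even Y ∨ Even Z := by
  by_contra hc
  rw [not_or, Int.not_even_iff_odd, Int.not_even_iff_odd] at hc
  obtain ⟨⟨y, rfl⟩, ⟨z, rfl⟩⟩ := hc
  have h1 : X ^ 2 = 4 * (d * (y ^ 2 + y) + e * (z ^ 2 + z)) + d + e := by rw [h]; ring
  rcases Int.even_or_odd X with ⟨x, rfl⟩ | hX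
  · have : (x + x) ^ 2 = 4 * x ^ 2 := by ring
    omega
  · have := Int.sq_mod_eight_of_odd hX
    omega

theorem even_of_isotropic_two_mul {r e : ℕ} {X Y Z : ℤ} (hr : Odd r) (he : e % 8 = 1)
    (h : X ^ 2 = (2 * r : ℕ) * Y ^ 2 + e * Z ^ 2) : Even Y := by
  by_contra hc
  rw [Int.not_even_iff_odd] at hc
  have hY := Int.sq_mod_eight_of_odd hc
  obtain ⟨k, hk⟩ : ∃ k, Y ^ 2 = 8 * k + 1 := ⟨Y ^ 2 / 8, by omega⟩
  obtain ⟨m, rfl⟩ := hr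
  have h1 : X ^ 2 = 2 * (2 * (4 * (2 * m + 1) * k + m) + 1) + e * Z ^ 2 := by
    rw [h, hk]; push_cast; ring
  rcases Int.even_or_odd Z with ⟨z, rfl⟩ | hZ
  · have h2 : e * (z + z) ^ 2 = 4 * (e * z ^ 2) := by ring
    rcases Int.even_or_odd X with ⟨x, rfl⟩ | hX
    · have : (x + x) ^ 2 = 4 * x ^ 2 := by ring
      omega
    · have := Int.sq_mod_eight_of_odd hX
      omega
  · have hZ8 := Int.sq_mod_eight_of_odd hZ
    obtain ⟨n, hn⟩ : ∃ n, Z ^ 2 = 8 * n + 1 := ⟨Z ^ 2 / 8, by omega⟩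
    have h2 : e * Z ^ 2 = 8 * (e * n) + e := by rw [hn]; ring
    rcases Int.even_or_odd X with ⟨x, rfl⟩ | hX
    · have : (x + x) ^ 2 = 4 * x ^ 2 := by ring
      omega
    · have := Int.sq_mod_eight_of_odd hX
      have h3 : X ^ 2 = 16 * ((2 * m + 1) * k) + 4 * m + 2 + (8 * (e * n) + e) := by
        rw [h1, h2]; ring
      omega

theorem not_dvd_left_of_isotropic {d e : ℕ} (he : Squarefree e) (hcop : d.Coprime e) {X Y Z : ℤ}
    (h : X ^ 2 = d * Y ^ 2 + e * Z ^ 2) (hYZ : IsCoprime Y Z) {l : ℕ} (hl : l.Prime)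
    (hle : (l : ℤ) ∣ e) : ¬ (l : ℤ) ∣ X := by
  intro hX
  have hl' := Nat.prime_iff_prime_int.1 hl
  have hdY : (l : ℤ) ∣ d * Y ^ 2 := by
    have : d * Y ^ 2 = X ^ 2 - e * Z ^ 2 := by linear_combination -h
    rw [this]
    exact dvd_sub (dvd_pow hX two_ne_zero) (hle.mul_right _)
  rcases hl'.dvd_or_dvd hdY with h4 | h4
  · exact Nat.not_coprime_of_dvd_of_dvd hl.one_lt (by exact_mod_cast h4) (by exact_mod_cast hle)
      hcop
  · exact not_dvd_of_isotropic he h hYZ hl hX (hl'.dvd_of_dvd_pow h4)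

theorem squarefree_mul_of_primes {p r : ℕ} (hp : p.Prime) (hr : r.Prime) (hpr : p ≠ r) :
    Squarefree (p * r) :=
  (Nat.squarefree_mul ((Nat.coprime_primes hp hr).2 hpr)).2 ⟨hp.squarefree, hr.squarefree⟩

theorem not_isSquare_of_squarefree {n : ℕ} (h : Squarefree n) (h1 : n ≠ 1) : ¬ IsSquare n := by
  rintro ⟨m, rfl⟩
  have := Nat.isUnit_iff.1 (h m dvd_rfl)
  subst this
  exact h1 rfl

theorem coprime_mul_mul_of_primes {p q r s : ℕ} (hp : p.Prime) (hq : q.Prime) (hr : r.Prime)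
    (hs : s.Prime) (hpq : p ≠ q) (hps : p ≠ s) (hqr : q ≠ r) (hrs : r ≠ s) :
    (p * r).Coprime (q * s) :=
  Nat.Coprime.mul_left
    (((Nat.coprime_primes hp hq).2 hpq).mul_right ((Nat.coprime_primes hp hs).2 hps))
    (((Nat.coprime_primes hr hq).2 hqr.symm).mul_right ((Nat.coprime_primes hr hs).2 hrs))

theorem jacobiSym_neg_mul_of_isotropic {d e x : ℕ} (hd : Squarefree d) (he : Squarefree e)
    (hcop : d.Coprime e) {Y Z : ℤ} (h : (x : ℤ) ^ 2 = d * Y ^ 2 + e * Z ^ 2) (hYZ : IsCoprime Y Z)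
    (hx : Odd x) : J(-(d * e : ℤ) | x) = 1 := by
  have h' : (x : ℤ) ^ 2 = e * Z ^ 2 + d * Y ^ 2 := by rw [h]; ring
  refine jacobiSym_neg_eq_one_of_mul_eq_sq_add (d * e) x (S := e * x) (a := e * Z) (b := Y) hx ?_
    (by linear_combination e * h) ?_
  · refine isCoprime_of_forall_prime fun l hl h1 h2 => ?_
    rcases (Nat.prime_iff_prime_int.1 hl).dvd_or_dvd h2 with h3 | h3
    · exact not_dvd_left_of_isotropic hd hcop.symm h' hYZ.symm hl h3 h1
    · exact not_dvd_left_of_isotropic he hcop h hYZ hl h3 h1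
  · intro l hl h1 _ h3
    rcases (Nat.prime_iff_prime_int.1 hl).dvd_or_dvd h3 with h3 | h3
    · exact not_dvd_left_of_isotropic he hcop h hYZ hl h3 h1
    · exact not_dvd_of_isotropic hd h' hYZ.symm hl h1 h3

/-- The quartic symbols at the primes of `q * s` in terms of an isotropic vector. -/
theorem quartSym_mul_quartSym {d q s : ℕ} (hq : q.Prime) (hs : s.Prime) (hqs : q ≠ s)
    (hq4 : q % 4 = 1) (hs4 : s % 4 = 1) (hcop : d.Coprime (q * s)) {X Y Z : ℤ}
    (h : X ^ 2 = d * Y ^ 2 + (q * s : ℕ) * Z ^ 2) (hYZ : IsCoprime Y Z) :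
    quartSym d q * quartSym d s = J(X | q * s) * J(Y | q * s) := by
  have := NeZero.mk hq.ne_zero
  have := NeZero.mk hs.ne_zero
  have he := squarefree_mul_of_primes hq hs hqs
  have hqe : (q : ℤ) ∣ (q * s : ℕ) := by exact_mod_cast dvd_mul_right q s
  have hse : (s : ℤ) ∣ (q * s : ℕ) := by exact_mod_cast dvd_mul_left s q
  have hdvd : ((q * s : ℕ) : ℤ) ∣ X ^ 2 - d * Y ^ 2 := ⟨Z ^ 2, by rw [h]; ring⟩
  rw [quartSym_eq_jacobiSym hq hq4 (hqe.trans hdvd)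
      (not_dvd_left_of_isotropic he hcop h hYZ hq hqe)
      (not_dvd_of_isotropic_of_dvd he h hYZ hq hqe),
    quartSym_eq_jacobiSym hs hs4 (hse.trans hdvd)
      (not_dvd_left_of_isotropic he hcop h hYZ hs hse)
      (not_dvd_of_isotropic_of_dvd he h hYZ hs hse),
    jacobiSym.mul_right, jacobiSym.mul_right]
  ring

theorem odd_left_of_isotropic {d e : ℕ} {X Y Z : ℤ} (he : Odd e)
    (h : X ^ 2 = d * Y ^ 2 + e * Z ^ 2) (hYZ : IsCoprime Y Z) (hY : Even Y) : Odd X ∧ Odd Z := by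
  have hZ : Odd Z := by
    rw [← Int.not_even_iff_odd]
    intro hZ
    exact not_dvd_of_isCoprime hYZ Nat.prime_two (even_iff_two_dvd.1 hY) (even_iff_two_dvd.1 hZ)
  refine ⟨?_, hZ⟩
  have hedZ : Odd (e : ℤ) := by exact_mod_cast he
  have : Odd (X ^ 2) := by
    rw [h]
    exact Even.add_odd ((hY.pow_of_ne_zero two_ne_zero).mul_left _) (hedZ.mul hZ.pow)
  exact Int.Odd.of_mul_left (n := X) (by rwa [← sq])

theorem emod_eight_of_four_dvd {d e : ℕ} {X Y Z : ℤ} (he : Odd e)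
    (h : X ^ 2 = d * Y ^ 2 + e * Z ^ 2) (hYZ : IsCoprime Y Z) (hY : 4 ∣ Y) : e % 8 = 1 := by
  obtain ⟨hX, hZ⟩ := odd_left_of_isotropic he h hYZ (even_iff_two_dvd.2 (dvd_trans (by decide) hY))
  have hX8 := Int.sq_mod_eight_of_odd hX
  have hZ8 := Int.sq_mod_eight_of_odd hZ
  obtain ⟨y, rfl⟩ := hY
  obtain ⟨k, hk⟩ : ∃ k, Z ^ 2 = 8 * k + 1 := ⟨Z ^ 2 / 8, by omega⟩
  rw [hk] at h
  have : X ^ 2 = 8 * (2 * d * y ^ 2 + e * k) + e := by rw [h]; ring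
  omega

theorem jacobiSym_right_of_isotropic {d e : ℕ} {X Y Z : ℤ} (he : Squarefree e) (he4 : e % 4 = 1)
    (h : X ^ 2 = d * Y ^ 2 + e * Z ^ 2) (hYZ : IsCoprime Y Z) (hY : Even Y) (hY0 : Y ≠ 0) :
    J(Y | e) = J(2 | e) :=
  jacobiSym_eq_two_of_even he4 hY hY0
    (emod_eight_of_four_dvd (Nat.odd_iff.2 (by omega)) h hYZ)
    ⟨-(d * Y), by rw [h]; ring⟩ hYZ
    (isCoprime_of_forall_prime fun _ hl h1 h2 => not_dvd_of_isotropic_of_dvd he h hYZ hl h2 h1)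

theorem quartSym_prod_of_odd {p q r s : ℕ} (hp : p.Prime) (hq : q.Prime) (hr : r.Prime)
    (hs : s.Prime) (hpq : p ≠ q) (hpr : p ≠ r) (hps : p ≠ s) (hqr : q ≠ r) (hqs : q ≠ s)
    (hrs : r ≠ s) (hp4 : p % 4 = 1) (hq4 : q % 4 = 1) (hr4 : r % 4 = 1) (hs4 : s % 4 = 1)
    {X Y Z : ℤ} (h : X ^ 2 = (p * r : ℕ) * Y ^ 2 + (q * s : ℕ) * Z ^ 2) (hX0 : 0 < X)
    (hY0 : Y ≠ 0) (hY : Even Y) (hYZ : IsCoprime Y Z) (hXY : (X + Y) % 4 = 1) :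
    quartSym ((p * r : ℕ) : ℤ) q * quartSym ((p * r : ℕ) : ℤ) s *
      quartSym ((q * s : ℕ) : ℤ) p * quartSym ((q * s : ℕ) : ℤ) r = 1 := by
  have hcop := coprime_mul_mul_of_primes hp hq hr hs hpq hps hqr hrs
  have hd := squarefree_mul_of_primes hp hr hpr
  have he := squarefree_mul_of_primes hq hs hqs
  have hd4 : p * r % 4 = 1 := by rw [Nat.mul_mod, hp4, hr4]
  have he4 : q * s % 4 = 1 := by rw [Nat.mul_mod, hq4, hs4]
  have hde4 : (p * r) * (q * s) % 4 = 1 := by rw [Nat.mul_mod, hd4, he4]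
  have h' : X ^ 2 = (q * s : ℕ) * Z ^ 2 + (p * r : ℕ) * Y ^ 2 := by rw [h]; ring
  have heo : Odd (q * s) := Nat.odd_iff.2 (by omega)
  rw [mul_assoc, quartSym_mul_quartSym hq hs hqs hq4 hs4 hcop h hYZ,
    quartSym_mul_quartSym hp hr hpr hp4 hr4 hcop.symm h' hYZ.symm,
    jacobiSym_right_of_isotropic he he4 h hYZ hY hY0]
  obtain ⟨hX, hZ⟩ := odd_left_of_isotropic heo h hYZ hY
  have hJZ : J(Z | p * r) = 1 :=
    jacobiSym_eq_one_of_odd hd4 hZ (x := X) (z := Y) ⟨-((q * s : ℕ) * Z), by rw [h]; ring⟩ hYZ.symm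
      (isCoprime_of_forall_prime fun l hl h1 h2 =>
        not_dvd_of_isotropic_of_dvd hd h' hYZ.symm hl h2 h1)
  obtain ⟨x, rfl⟩ := Int.eq_ofNat_of_zero_le hX0.le
  have hx : Odd x := by exact_mod_cast hX
  have hJX : J(x | q * s) * J(x | p * r) = ZMod.χ₄ x := by
    have h1 := jacobiSym_neg_mul_of_isotropic hd he hcop h hYZ hx
    have : NeZero (q * s) := ⟨he.ne_zero⟩
    have : NeZero (p * r) := ⟨hd.ne_zero⟩
    rw [← mul_comm J(x | p * r), ← jacobiSym.mul_right,
      jacobiSym.quadratic_reciprocity_one_mod_four' hx hde4, ← neg_neg (((_ : ℕ) : ℤ)),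
      jacobiSym.neg _ hx, Nat.cast_mul, h1, mul_one]
  have key : ZMod.χ₄ x * J(2 | q * s) = 1 := by
    have hx4 : x % 4 = 1 ∨ x % 4 = 3 := by have := Nat.odd_iff.1 hx; omega
    rcases hx4 with hx4 | hx4
    · rw [ZMod.χ₄_nat_one_mod_four hx4, jacobiSym_two_of_one_mod_eight, one_mul]
      exact emod_eight_of_four_dvd heo h hYZ (by omega)
    · have he8 : q * s % 8 = 5 := by
        obtain ⟨y, rfl⟩ := hY
        have hy : Odd y := by rw [Int.odd_iff]; omega
        have hX8 := Int.sq_mod_eight_of_odd hX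
        have hy8 := Int.sq_mod_eight_of_odd hy
        have hZ8 := Int.sq_mod_eight_of_odd hZ
        obtain ⟨a, ha⟩ : ∃ a, y ^ 2 = 8 * a + 1 := ⟨y ^ 2 / 8, by omega⟩
        obtain ⟨b, hb⟩ : ∃ b, Z ^ 2 = 8 * b + 1 := ⟨Z ^ 2 / 8, by omega⟩
        generalize q * s = e at *
        generalize p * r = d at *
        have : (x : ℤ) ^ 2 = 8 * (4 * d * a + e * b) + 4 * d + e := by
          rw [h, hb]; linear_combination 4 * d * ha
        omega
      rw [ZMod.χ₄_nat_three_mod_four hx4, jacobiSym_two_of_five_mod_eight he8]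
      norm_num
  rw [hJZ]
  linear_combination J(2 | q * s) * hJX + key

theorem Nat.sq_emod_sixteen_of_odd {n : ℕ} (hn : Odd n) :
    (n : ℤ) ^ 2 % 16 = if n % 8 = 1 ∨ n % 8 = 7 then 1 else 9 := by
  obtain ⟨k, hk⟩ : ∃ k, n = 8 * k + n % 8 := ⟨n / 8, by omega⟩
  have h8 : n % 8 = 1 ∨ n % 8 = 3 ∨ n % 8 = 5 ∨ n % 8 = 7 := by have := Nat.odd_iff.1 hn; omega
  rcases h8 with h | h | h | h
  all_goals
    rw [h] at hk
    have : (n : ℤ) ^ 2 = 16 * (4 * k ^ 2 + k * (n % 8 : ℕ)) + (n % 8 : ℕ) ^ 2 := by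
      rw [h, hk]; push_cast; ring
    rw [h] at this
    simp only [h]
    push_cast at this
    norm_num
    omega

theorem quartSym_prod_of_two {q r s : ℕ} (hq : q.Prime) (hr : r.Prime)
    (hs : s.Prime) (hqr : q ≠ r) (hqs : q ≠ s)
    (hrs : r ≠ s) (hq4 : q % 4 = 1) (hr4 : r % 4 = 1) (hs4 : s % 4 = 1) (he8 : q * s % 8 = 1)
    {X Y Z : ℤ} (h : X ^ 2 = (2 * r : ℕ) * Y ^ 2 + (q * s : ℕ) * Z ^ 2) (hX0 : 0 < X)
    (hY0 : Y ≠ 0) (hY : Even Y) (hYZ : IsCoprime Y Z) (hXY : (X + Y) % 4 = 1) :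
    quartSym ((2 * r : ℕ) : ℤ) q * quartSym ((2 * r : ℕ) : ℤ) s *
      quartSym ((q * s : ℕ) : ℤ) 2 * quartSym ((q * s : ℕ) : ℤ) r = 1 := by
  have h2r : 2 ≠ r := by omega
  have hcop := coprime_mul_mul_of_primes Nat.prime_two hq hr hs (by omega) (by omega) hqr hrs
  have hd := squarefree_mul_of_primes Nat.prime_two hr h2r
  have he := squarefree_mul_of_primes hq hs hqs
  have he4 : q * s % 4 = 1 := by rw [Nat.mul_mod, hq4, hs4]
  have hre4 : r * (q * s) % 4 = 1 := by rw [Nat.mul_mod, hr4, he4]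
  have h' : X ^ 2 = (q * s : ℕ) * Z ^ 2 + (2 * r : ℕ) * Y ^ 2 := by rw [h]; ring
  have heo : Odd (q * s) := Nat.odd_iff.2 (by omega)
  have hrd : (r : ℤ) ∣ (2 * r : ℕ) := by exact_mod_cast dvd_mul_left r 2
  rw [quartSym_mul_quartSym hq hs hqs hq4 hs4 hcop h hYZ,
    jacobiSym_right_of_isotropic he he4 h hYZ hY hY0, jacobiSym_two_of_one_mod_eight he8,
    quartSym_eq_jacobiSym hr hr4
      (hrd.trans (⟨Y ^ 2, by rw [h]; ring⟩ : ((2 * r : ℕ) : ℤ) ∣ X ^ 2 - (q * s : ℕ) * Z ^ 2))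
      (not_dvd_left_of_isotropic hd hcop.symm h' hYZ.symm hr hrd)
      (not_dvd_of_isotropic_of_dvd hd h' hYZ.symm hr hrd)]
  obtain ⟨hX, hZ⟩ := odd_left_of_isotropic heo h hYZ hY
  have hro : Odd r := Nat.odd_iff.2 (by omega)
  have hZo : Odd Z.natAbs := Int.natAbs_odd.2 hZ
  have hZd : IsCoprime Z ((2 * r : ℕ) : ℤ) := isCoprime_of_forall_prime fun l hl h1 h2 =>
    not_dvd_of_isotropic_of_dvd hd h' hYZ.symm hl h2 h1
  have hJZ : J(Z | r) = ZMod.χ₈ Z.natAbs := by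
    have hYc : IsCoprime Y (Z.natAbs : ℤ) := by
      rw [Int.natCast_natAbs]; exact IsCoprime.abs_right hYZ
    have hdc : IsCoprime ((2 * r : ℕ) : ℤ) (Z.natAbs : ℤ) := by
      rw [Int.natCast_natAbs]; exact IsCoprime.abs_right hZd.symm
    have h1 : J(((2 * r : ℕ) : ℤ) * Y ^ 2 | Z.natAbs) = 1 := by
      apply jacobiSym_eq_one_of_dvd_sub_sq (m := X) (hdc.mul_left hYc.pow_left)
      rw [Int.natCast_natAbs, abs_dvd]
      exact ⟨(q * s : ℕ) * Z, by rw [h]; ring⟩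
    rw [jacobiSym.mul_left, jacobiSym_sq_eq_one hYc, mul_one, Nat.cast_mul, jacobiSym.mul_left,
      Nat.cast_two, jacobiSym.at_two hZo] at h1
    rw [← jacobiSym_natAbs_left hr4, jacobiSym.quadratic_reciprocity_one_mod_four' hZo hr4]
    exact (Int.eq_of_mul_eq_one h1).symm
  obtain ⟨x, rfl⟩ := Int.eq_ofNat_of_zero_le hX0.le
  have hx : Odd x := by exact_mod_cast hX
  have hJX : J(x | q * s) * J(x | r) = ZMod.χ₄ x * ZMod.χ₈ x := by
    have h1 := jacobiSym_neg_mul_of_isotropic hd he hcop h hYZ hx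
    have : NeZero (q * s) := ⟨he.ne_zero⟩
    have : NeZero r := ⟨hr.ne_zero⟩
    rw [← mul_comm J(x | r), ← jacobiSym.mul_right,
      jacobiSym.quadratic_reciprocity_one_mod_four' hx hre4]
    rw [jacobiSym.neg _ hx, Nat.cast_mul 2 r, mul_assoc, ← Nat.cast_mul, jacobiSym.mul_left,
      Nat.cast_two, jacobiSym.at_two hx, ← mul_assoc] at h1
    exact (Int.eq_of_mul_eq_one h1).symm
  have key : ZMod.χ₄ x * ZMod.χ₈ x * ZMod.χ₈ Z.natAbs * quartSym ((q * s : ℕ) : ℤ) 2 = 1 := by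
    obtain ⟨y, rfl⟩ := hY
    have hsq : (x : ℤ) ^ 2 = 8 * r * y ^ 2 + (q * s : ℕ) * (Z.natAbs : ℤ) ^ 2 := by
      rw [h, Int.natCast_natAbs, sq_abs]; push_cast; ring
    generalize Z.natAbs = z at *
    generalize q * s = e at *
    obtain ⟨k, hk⟩ := hro
    have hw : (8 * r * y ^ 2 : ℤ) % 16 = if Even y then 0 else 8 := by
      split_ifs with hy
      · obtain ⟨m, rfl⟩ := hy
        have : (8 * r * (m + m) ^ 2 : ℤ) = 16 * (2 * r * m ^ 2) := by ring
        omega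
      · obtain ⟨m, rfl⟩ := Int.not_even_iff_odd.1 hy
        have : (8 * r * (2 * m + 1) ^ 2 : ℤ) =
            16 * (2 * r * (m ^ 2 + m) + k) + 8 := by rw [hk]; push_cast; ring
        omega
    have hz : ((e : ℤ) * (z : ℤ) ^ 2) % 16 =
        (if z % 8 = 1 ∨ z % 8 = 7 then (e : ℤ) else e + 8) % 16 := by
      obtain ⟨m, hm⟩ : ∃ m, (z : ℤ) ^ 2 = 16 * m + (z : ℤ) ^ 2 % 16 := ⟨(z : ℤ) ^ 2 / 16, by omega⟩
      rw [Nat.sq_emod_sixteen_of_odd hZo] at hm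
      split_ifs at hm ⊢
      · have : (e : ℤ) * (z : ℤ) ^ 2 = 16 * (e * m) + e := by rw [hm]; ring
        omega
      · have : (e : ℤ) * (z : ℤ) ^ 2 = 16 * (e * m) + 9 * e := by rw [hm]; ring
        omega
    have hx16 := Nat.sq_emod_sixteen_of_odd hx
    rw [hsq] at hx16
    rw [ZMod.χ₄_nat_eq_if_mod_four, ZMod.χ₈_nat_eq_if_mod_eight, ZMod.χ₈_nat_eq_if_mod_eight,
      quartSym, if_pos rfl]
    rw [Nat.odd_iff] at hx hZo
    simp only [Int.even_iff] at hw
    generalize (8 * r * y ^ 2 : ℤ) = w1 at *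
    generalize ((e : ℤ) * (z : ℤ) ^ 2) = w2 at *
    split_ifs at * <;> first | rfl | omega
  linear_combination quartSym ((q * s : ℕ) : ℤ) 2 * J(Z | r) * hJX +
    ZMod.χ₄ x * ZMod.χ₈ x * quartSym ((q * s : ℕ) : ℤ) 2 * hJZ + key

theorem not_exists_pell_of_isSquare_mod {p q r s : ℕ}
    (hp : p.Prime) (hq : q.Prime) (hr : r.Prime) (hs : s.Prime)
    (hpq : p ≠ q) (hpr : p ≠ r) (hps : p ≠ s) (hqr : q ≠ r) (hqs : q ≠ s) (hrs : r ≠ s)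
    (hp4 : p = 2 ∧ q * s % 8 = 1 ∨ p % 4 = 1) (hq4 : q % 4 = 1) (hr4 : r % 4 = 1)
    (hs4 : s % 4 = 1) {m n : ℤ} (hm : ((q * s : ℕ) : ℤ) ∣ m ^ 2 - (p * r : ℕ))
    (hn : ((p * r : ℕ) : ℤ) ∣ n ^ 2 - (q * s : ℕ))
    (hquart : quartSym ((p * r : ℕ) : ℤ) q * quartSym ((p * r : ℕ) : ℤ) s *
      quartSym ((q * s : ℕ) : ℤ) p * quartSym ((q * s : ℕ) : ℤ) r = -1) :
    ¬ ∃ x y : ℤ, x ^ 2 - (p * q * r * s : ℕ) * y ^ 2 = -1 := by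
  rintro ⟨x, y, hxy⟩
  have hy : Odd y := by
    rw [← Int.not_even_iff_odd]
    rintro ⟨k, rfl⟩
    have h1 : x ^ 2 + 1 = 4 * ((p * q * r * s : ℕ) * k ^ 2) := by linear_combination hxy
    rcases Int.even_or_odd x with ⟨a, rfl⟩ | hx
    · have : (a + a) ^ 2 = 4 * a ^ 2 := by ring
      omega
    · have := Int.sq_mod_eight_of_odd hx
      omega
  obtain ⟨A, B, C, D, u, v, hAB, hCD, huv⟩ := exists_gaussian_factorization hp hq hr hs
    (by omega) (by omega) (by omega) (by omega) hy (x := x) (by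
      push_cast at hxy; linear_combination hxy)
  rw [← Nat.cast_mul] at hAB hCD
  have hcop := coprime_mul_mul_of_primes hp hq hr hs hpq hps hqr hrs
  have hd := squarefree_mul_of_primes hp hr hpr
  have he := squarefree_mul_of_primes hq hs hqs
  have hd1 : p * r ≠ 1 := fun hc => hp.one_lt.ne' (Nat.eq_one_of_mul_eq_one_right hc)
  have he1 : q * s ≠ 1 := fun hc => hq.one_lt.ne' (Nat.eq_one_of_mul_eq_one_right hc)
  have hdS := not_isSquare_of_squarefree hd hd1
  have heS := not_isSquare_of_squarefree he he1
  obtain ⟨X, Y, Z, h, hnz⟩ := exists_isotropic_of_isSquare_mod hd.ne_zero he.ne_zero hdS heS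
    (not_isSquare_of_squarefree ((Nat.squarefree_mul hcop).2 ⟨hd, he⟩)
      fun hc => hd1 (Nat.eq_one_of_mul_eq_one_right hc)) hcop hm hn
  obtain ⟨X, Y, Z, h, hX0, hY0, hZ0, hYZ⟩ := exists_primitive_isotropic hdS heS h hnz
  rcases hp4 with ⟨rfl, he8⟩ | hp4
  · have hY := even_of_isotropic_two_mul (Nat.odd_iff.2 (by omega)) he8 h
    have hXY := add_emod_four hd hq hs hqs hq4 hs4 hcop (fun _ => he8) hAB hCD huv h hX0 hY0 hZ0
      hY hYZ
    have := quartSym_prod_of_two hq hr hs hqr hqs hrs hq4 hr4 hs4 he8 h hX0 hY0 hY hYZ hXY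
    omega
  · have hd4 : p * r % 4 = 1 := by rw [Nat.mul_mod, hp4, hr4]
    have he4 : q * s % 4 = 1 := by rw [Nat.mul_mod, hq4, hs4]
    rcases even_or_even_of_isotropic hd4 he4 h with hY | hZ
    · have hXY := add_emod_four hd hq hs hqs hq4 hs4 hcop
        (fun hev => by rw [Nat.even_iff] at hev; omega) hAB hCD huv h hX0 hY0 hZ0 hY hYZ
      have := quartSym_prod_of_odd hp hq hr hs hpq hpr hps hqr hqs hrs hp4 hq4 hr4 hs4 h hX0 hY0 hY
        hYZ hXY
      omega
    · rw [add_comm] at h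
      have hXZ := add_emod_four (u := u) (v := v) he hp hr hpr hp4 hr4 hcop.symm
        (fun hev => by rw [Nat.even_iff] at hev; omega) hCD hAB (by linear_combination huv) h hX0
        hZ0 hY0 hZ hYZ.symm
      have := quartSym_prod_of_odd hq hp hs hr hpq.symm hqs hqr hps hpr hrs.symm hq4 hp4 hs4 hr4 h
        hX0 hZ0 hZ hYZ.symm hXZ
      linarith

theorem exists_sq_sub_dvd_mul {q s : ℕ} (hq : q.Prime) (hs : s.Prime) (hqs : q ≠ s) {d : ℤ}
    (hdq : ∃ x : ℤ, (q : ℤ) ∣ x ^ 2 - d) (hds : ∃ x : ℤ, (s : ℤ) ∣ x ^ 2 - d) :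
    ∃ x : ℤ, ((q * s : ℕ) : ℤ) ∣ x ^ 2 - d := by
  obtain ⟨a, ha⟩ := hdq
  obtain ⟨b, hb⟩ := hds
  have hcop : IsCoprime (q : ℤ) s := Nat.isCoprime_iff_coprime.2 ((Nat.coprime_primes hq hs).2 hqs)
  obtain ⟨m, n, hmn⟩ := hcop
  refine ⟨b * m * q + a * n * s, ?_⟩
  push_cast
  refine IsCoprime.mul_dvd ⟨m, n, hmn⟩ ?_ ?_
  · obtain ⟨c, hc⟩ := ha
    have e1 : b * m * q + a * n * s = a + q * ((b - a) * m) := by linear_combination a * hmn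
    exact ⟨c + (b - a) * m * (2 * a + q * ((b - a) * m)), by rw [e1]; linear_combination hc⟩
  · obtain ⟨c, hc⟩ := hb
    have e1 : b * m * q + a * n * s = b + s * ((a - b) * n) := by linear_combination b * hmn
    exact ⟨c + (a - b) * n * (2 * b + s * ((a - b) * n)), by rw [e1]; linear_combination hc⟩

theorem exists_sq_of_jacobiSym_eq {p q r : ℕ} (hp : p.Prime) (hq : q.Prime) (hr : r.Prime)
    (hpq : p ≠ q) (hqr : q ≠ r) (h : J(p | q) = J(r | q)) :
    ∃ x : ℤ, (q : ℤ) ∣ x ^ 2 - (p * r : ℕ) := by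
  have hnd : ∀ {l : ℕ}, l.Prime → l ≠ q → ¬ (q : ℤ) ∣ l := fun hl hne hc =>
    hne ((Nat.prime_dvd_prime_iff_eq hq hl).1 (by exact_mod_cast hc)).symm
  rw [← jacobiSym_eq_one_iff_exists hq, Nat.cast_mul, jacobiSym.mul_left, h, ← sq]
  · exact jacobiSym.sq_one
      (Int.isCoprime_iff_gcd_eq_one.1 (isCoprime_of_not_dvd hq (hnd hr hqr.symm)))
  · rw [Nat.cast_mul]
    exact (Nat.prime_iff_prime_int.1 hq).not_dvd_mul (hnd hp hpq) (hnd hr hqr.symm)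

theorem not_exists_pell_of_legSym {p q r s : ℕ}
    (hp : p.Prime) (hq : q.Prime) (hr : r.Prime) (hs : s.Prime)
    (hpq : p ≠ q) (hpr : p ≠ r) (hps : p ≠ s) (hqr : q ≠ r) (hqs : q ≠ s) (hrs : r ≠ s)
    (hp4 : p = 2 ∨ p % 4 = 1) (hq4 : q % 4 = 1) (hr4 : r % 4 = 1) (hs4 : s % 4 = 1)
    (h1 : legSym (p : ℤ) q = legSym (q : ℤ) r)
    (h2 : legSym (q : ℤ) r = legSym (r : ℤ) s)
    (h3 : legSym (r : ℤ) s = legSym (s : ℤ) p)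
    (hquart : quartSym ((p * r : ℕ) : ℤ) q * quartSym ((p * r : ℕ) : ℤ) s *
      quartSym ((q * s : ℕ) : ℤ) p * quartSym ((q * s : ℕ) : ℤ) r = -1) :
    ¬ ∃ x y : ℤ, x ^ 2 - (p * q * r * s : ℕ) * y ^ 2 = -1 := by
  have leg : ∀ {k l : ℕ}, k.Prime → l.Prime → k ≠ l → l % 4 = 1 → legSym (k : ℤ) l = J(k | l) :=
    fun hk hl hne hl4 => legSym_eq_jacobiSym hl (by omega) fun hc =>
      hne ((Nat.prime_dvd_prime_iff_eq hl hk).1 (by exact_mod_cast hc)).symm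
  have recip : ∀ {k l : ℕ}, k % 4 = 1 → l % 4 = 1 → J(k | l) = J(l | k) := fun hk hl =>
    jacobiSym.quadratic_reciprocity_one_mod_four hk (Nat.odd_iff.2 (by omega))
  have hsp : legSym (s : ℤ) p = J(p | s) := by
    rcases hp4 with rfl | hp4
    · rw [legSym, if_pos rfl, Nat.cast_two, jacobiSym.at_two (Nat.odd_iff.2 (by omega)),
        ZMod.χ₈_nat_eq_if_mod_eight]
      split_ifs <;> first | rfl | omega
    · rw [leg hs hp hps.symm hp4, recip hs4 hp4]
  rw [leg hp hq hpq hq4, leg hq hr hqr hr4] at h1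
  rw [leg hq hr hqr hr4, leg hr hs hrs hs4] at h2
  rw [leg hr hs hrs hs4, hsp] at h3
  obtain ⟨m, hm⟩ := exists_sq_sub_dvd_mul hq hs hqs
    (exists_sq_of_jacobiSym_eq hp hq hr hpq hqr (h1.trans (recip hq4 hr4)))
    (exists_sq_of_jacobiSym_eq hp hs hr hps hrs.symm h3.symm)
  have hr' := exists_sq_of_jacobiSym_eq hq hr hs hqr hrs (h2.trans (recip hr4 hs4))
  have hpq' : J(p | q) = J(p | s) := h1.trans (h2.trans h3)
  have hp' : ∃ x : ℤ, (p : ℤ) ∣ x ^ 2 - (q * s : ℕ) := by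
    rcases hp4 with rfl | hp4
    · refine ⟨1, ?_⟩
      have : q * s % 4 = 1 := by rw [Nat.mul_mod, hq4, hs4]
      omega
    · exact exists_sq_of_jacobiSym_eq hq hp hs hpq.symm hps
        (by rw [recip hq4 hp4, hpq', recip hp4 hs4])
  obtain ⟨n, hn⟩ := exists_sq_sub_dvd_mul hp hr hpr hp' hr'
  refine not_exists_pell_of_isSquare_mod hp hq hr hs hpq hpr hps hqr hqs hrs ?_ hq4 hr4 hs4 hm hn
    hquart
  rcases hp4 with rfl | hp4
  · refine Or.inl ⟨rfl, ?_⟩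
    rw [Nat.cast_two, jacobiSym.at_two (Nat.odd_iff.2 (by omega)),
      jacobiSym.at_two (Nat.odd_iff.2 (by omega)), ZMod.χ₈_nat_eq_if_mod_eight,
      ZMod.χ₈_nat_eq_if_mod_eight] at hpq'
    have : q % 8 = 1 ∧ s % 8 = 1 ∨ q % 8 = 5 ∧ s % 8 = 5 := by
      split_ifs at hpq' <;> omega
    rcases this with ⟨a, b⟩ | ⟨a, b⟩ <;> rw [Nat.mul_mod, a, b]
  · exact Or.inr hp4

theorem stmt_9 (p q r s : ℕ)
    (hp : p.Prime) (hq : q.Prime) (hr : r.Prime) (hs : s.Prime)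
    (hpq : p ≠ q) (hpr : p ≠ r) (hps : p ≠ s) (hqr : q ≠ r) (hqs : q ≠ s) (hrs : r ≠ s)
    (hp4 : p % 4 ≠ 3) (hq4 : q % 4 ≠ 3) (hr4 : r % 4 ≠ 3) (hs4 : s % 4 ≠ 3)
    (h1 : legSym (p : ℤ) q = legSym (q : ℤ) r)
    (h2 : legSym (q : ℤ) r = legSym (r : ℤ) s)
    (h3 : legSym (r : ℤ) s = legSym (s : ℤ) p)
    (hquart : quartSym ((p * r : ℕ) : ℤ) q * quartSym ((p * r : ℕ) : ℤ) s *
      quartSym ((q * s : ℕ) : ℤ) p * quartSym ((q * s : ℕ) : ℤ) r = -1) :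
    ¬ ∃ x y : ℤ, x ^ 2 - (p * q * r * s : ℕ) * y ^ 2 = -1 := by
  have cls : ∀ {l : ℕ}, l.Prime → l % 4 ≠ 3 → l = 2 ∨ l % 4 = 1 := by
    intro l hl h4
    rcases hl.eq_two_or_odd with h | h
    · exact Or.inl h
    · exact Or.inr (by omega)
  have odd : ∀ {l : ℕ}, l.Prime → l % 4 ≠ 3 → l ≠ 2 → l % 4 = 1 := fun hl h4 h2 =>
    (cls hl h4).resolve_left h2
  by_cases hq2 : q = 2
  · rw [show p * q * r * s = q * r * s * p by ring]
    refine not_exists_pell_of_legSym hq hr hs hp hqr hqs hpq.symm hrs hpr.symm hps.symm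
      (Or.inl hq2) (odd hr hr4 (by omega)) (odd hs hs4 (by omega)) (odd hp hp4 (by omega))
      h2 h3 (h3.symm.trans (h2.symm.trans h1.symm)) ?_
    rw [mul_comm r p]
    linear_combination hquart
  by_cases hr2 : r = 2
  · rw [show p * q * r * s = r * s * p * q by ring]
    refine not_exists_pell_of_legSym hr hs hp hq hrs hpr.symm hqr.symm hps.symm hqs.symm hpq
      (Or.inl hr2) (odd hs hs4 (by omega)) (odd hp hp4 (by omega)) (odd hq hq4 (by omega))
      h3 (h3.symm.trans (h2.symm.trans h1.symm)) h1 ?_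
    rw [mul_comm r p, mul_comm s q]
    linear_combination hquart
  by_cases hs2 : s = 2
  · rw [show p * q * r * s = s * p * q * r by ring]
    refine not_exists_pell_of_legSym hs hp hq hr hps.symm hqs.symm hrs.symm hpq hpr hqr
      (Or.inl hs2) (odd hp hp4 (by omega)) (odd hq hq4 (by omega)) (odd hr hr4 (by omega))
      (h3.symm.trans (h2.symm.trans h1.symm)) h1 h2 ?_
    rw [mul_comm s q]
    linear_combination hquart
  exact not_exists_pell_of_legSym hp hq hr hs hpq hpr hps hqr hqs hrs (cls hp hp4)
    (odd hq hq4 hq2) (odd hr hr4 hr2) (odd hs hs4 hs2) h1 h2 h3 hquart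
end

section
/- Let p, q, r be distinct primes, none congruent to 3 modulo 4, with (p/q) = (q/r) = (r/p) = −1. Then Nε_{pq} = Nε_{qr} = Nε_{rp} = −1, and the product ε_{pq}·ε_{qr}·ε_{rp} (formed inside ℝ) is a square in the field ℚ(√(pq), √(pr)) ⊆ ℝ if and only if (pq/r)₄ (qr/p)₄ (rp/q)₄ = −1 (these quartic symbols are defined since (pq/r) = (qr/p) = (rp/q) = 1). -/
def InO (m : ℕ) (x : ℝ) : Prop :=
  (∃ a b : ℚ, x = (a : ℝ) + (b : ℝ) * Real.sqrt m) ∧ IsIntegral ℤ x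

/-- `ε` is the fundamental unit `> 1` of the ring of integers of `ℚ(√m) ⊆ ℝ`. -/
def IsFundUnit (m : ℕ) (ε : ℝ) : Prop :=
  InO m ε ∧ InO m ε⁻¹ ∧ 1 < ε ∧
    ∀ u : ℝ, InO m u → InO m u⁻¹ → ∃ n : ℤ, u = ε ^ n ∨ u = -(ε ^ n)

/-- The norm of `ε ∈ ℚ(√m)` from `ℚ(√m)` to `ℚ` equals `-1`. -/
def NormNegOne (m : ℕ) (ε : ℝ) : Prop :=
  ∃ a b : ℚ, ε = (a : ℝ) + (b : ℝ) * Real.sqrt m ∧ a ^ 2 - (m : ℚ) * b ^ 2 = -1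


/-- Pigeonhole step towards Legendre's theorem on `p x² = q y² + r z²`. -/
lemma exists_small_ternary {p q r : ℕ} (hp : p.Prime) (hq : q.Prime) (hr : r.Prime)
    (hpq : p ≠ q) (hqr : q ≠ r) (hrp : r ≠ p) {α β γ : ℤ}
    (hα : (p : ℤ) ∣ q * α ^ 2 + r) (hβ : (q : ℤ) ∣ p * β ^ 2 - r)
    (hγ : (r : ℤ) ∣ p * γ ^ 2 - q) :
    ∃ x y z : ℤ, (x ≠ 0 ∨ y ≠ 0 ∨ z ≠ 0) ∧ x ^ 2 < q * r ∧ y ^ 2 < r * p ∧ z ^ 2 < p * q ∧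
      (p * q * r : ℤ) ∣ p * x ^ 2 - q * y ^ 2 - r * z ^ 2 := by
  have := Fact.mk hp
  have := Fact.mk hq
  have := Fact.mk hr
  let S : Finset (ℕ × ℕ × ℕ) := Finset.range (Nat.sqrt (q * r) + 1) ×ˢ
    Finset.range (Nat.sqrt (r * p) + 1) ×ˢ Finset.range (Nat.sqrt (p * q) + 1)
  let f : ℕ × ℕ × ℕ → ZMod p × ZMod q × ZMod r := fun t =>
    (((t.2.1 - α * t.2.2 : ℤ) : ZMod p), ((t.1 - β * t.2.2 : ℤ) : ZMod q),
      ((t.1 - γ * t.2.1 : ℤ) : ZMod r))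
  have hcard : (Finset.univ : Finset (ZMod p × ZMod q × ZMod r)).card < S.card := by
    simp only [S, Finset.card_univ, Fintype.card_prod, ZMod.card, Finset.card_product,
      Finset.card_range]
    have h1 := Nat.lt_succ_sqrt' (q * r)
    have h2 := Nat.lt_succ_sqrt' (r * p)
    have h3 := Nat.lt_succ_sqrt' (p * q)
    refine lt_of_pow_lt_pow_left₀ 2 (Nat.zero_le _) ?_
    calc (p * (q * r)) ^ 2 = (q * r) * ((r * p) * (p * q)) := by ring
      _ < _ := Nat.mul_lt_mul'' h1 (Nat.mul_lt_mul'' h2 h3)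
      _ = _ := by simp only [Nat.succ_eq_add_one]; ring
  obtain ⟨a, ha, b, hb, hab, hf⟩ := Finset.exists_ne_map_eq_of_card_lt_of_maps_to hcard
    (f := f) (fun _ _ => Finset.mem_coe.2 (Finset.mem_univ _))
  obtain ⟨a1, a2, a3⟩ := a
  obtain ⟨b1, b2, b3⟩ := b
  simp only [S, Finset.mem_product, Finset.mem_range] at ha hb
  simp only [f, Prod.mk.injEq, ZMod.intCast_eq_intCast_iff_dvd_sub] at hf
  obtain ⟨hfp, hfq, hfr⟩ := hf
  have key : ∀ {n m u v : ℕ}, n.Prime → m.Prime → n ≠ m → u < Nat.sqrt (n * m) + 1 →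
      v < Nat.sqrt (n * m) + 1 → ((v : ℤ) - u) ^ 2 < n * m := by
    intro n m u v hn hm hnm hu hv
    have hs : Nat.sqrt (n * m) ^ 2 < n * m := by
      refine lt_of_le_of_ne (Nat.sqrt_le' _) fun h => ?_
      have h1 : n ∣ Nat.sqrt (n * m) := hn.dvd_of_dvd_pow (h ▸ Dvd.intro _ rfl)
      obtain ⟨c, hc⟩ := h1
      rw [hc] at h
      have h2 : n * c ^ 2 = m := Nat.eq_of_mul_eq_mul_left hn.pos (by nlinarith)
      exact hnm ((Nat.prime_dvd_prime_iff_eq hn hm).1 (h2 ▸ Dvd.intro _ rfl))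
    have hs' : ((Nat.sqrt (n * m) : ℕ) : ℤ) ^ 2 < n * m := by exact_mod_cast hs
    refine lt_of_le_of_lt (sq_le_sq' ?_ ?_) hs' <;> omega
  refine ⟨b1 - a1, b2 - a2, b3 - a3, ?_, key hq hr hqr ha.1 hb.1, key hr hp hrp ha.2.1 hb.2.1,
    key hp hq hpq ha.2.2 hb.2.2, ?_⟩
  · by_contra! h
    apply hab
    simp only [Prod.mk.injEq]
    omega
  · have cop : ∀ {n m : ℕ}, n.Prime → m.Prime → n ≠ m → IsCoprime (n : ℤ) m :=
      fun hn hm h => Nat.isCoprime_iff_coprime.2 ((Nat.coprime_primes hn hm).2 h)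
    refine IsCoprime.mul_dvd (IsCoprime.mul_left (cop hp hr hrp.symm) (cop hq hr hqr))
      (IsCoprime.mul_dvd (cop hp hq hpq) ?_ ?_) ?_
    · obtain ⟨c, hc⟩ := hfp
      obtain ⟨e, he⟩ := hα
      have : (b2 : ℤ) - a2 = α * (b3 - a3) + p * c := by linear_combination hc
      rw [this]
      exact ⟨(b1 - a1) ^ 2 - e * (b3 - a3) ^ 2 - q * c * (2 * α * (b3 - a3) + p * c), by
        linear_combination (-(b3 - a3) ^ 2 : ℤ) * he⟩
    · obtain ⟨c, hc⟩ := hfq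
      obtain ⟨e, he⟩ := hβ
      have : (b1 : ℤ) - a1 = β * (b3 - a3) + q * c := by linear_combination hc
      rw [this]
      exact ⟨-(b2 - a2) ^ 2 + e * (b3 - a3) ^ 2 + p * c * (2 * β * (b3 - a3) + q * c), by
        linear_combination ((b3 - a3) ^ 2 : ℤ) * he⟩
    · obtain ⟨c, hc⟩ := hfr
      obtain ⟨e, he⟩ := hγ
      have : (b1 : ℤ) - a1 = γ * (b2 - a2) + r * c := by linear_combination hc
      rw [this]
      exact ⟨-(b3 - a3) ^ 2 + e * (b2 - a2) ^ 2 + p * c * (2 * γ * (b2 - a2) + r * c), by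
        linear_combination ((b2 - a2) ^ 2 : ℤ) * he⟩

lemma not_prime_mul_sq_eq {p q : ℕ} (hp : p.Prime) (hq : q.Prime) (hpq : p ≠ q) {x y : ℤ}
    (h : p * x ^ 2 = q * y ^ 2) : x = 0 ∧ y = 0 := by
  have key : ¬ IsSquare (p * q) := by
    rintro ⟨c, hc⟩
    have h1 : p ∣ c := by
      have : p ∣ c * c := hc ▸ Dvd.intro _ rfl
      exact (hp.dvd_mul.1 this).elim id id
    obtain ⟨d, rfl⟩ := h1
    have h2 : q = p * (d * d) := Nat.eq_of_mul_eq_mul_left hp.pos (by rw [hc]; ring)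
    exact hpq ((Nat.prime_dvd_prime_iff_eq hp hq).1 (h2 ▸ Dvd.intro _ rfl))
  have hy : y = 0 := by
    by_contra hy
    apply key
    have h1 : (p * x) ^ 2 = (p * q : ℤ) * y ^ 2 := by linear_combination (p : ℤ) * h
    have h2 : y ∣ p * x := by
      rw [← Int.pow_dvd_pow_iff two_ne_zero, h1]; exact Dvd.intro_left _ rfl
    obtain ⟨c, hc⟩ := h2
    rw [hc] at h1
    have h3 : (p * q : ℤ) = c ^ 2 := by
      have : y ^ 2 * (c ^ 2 - p * q) = 0 := by linear_combination h1
      rcases mul_eq_zero.1 this with h | h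
      · exact absurd (pow_eq_zero_iff two_ne_zero |>.1 h) hy
      · linarith
    refine ⟨c.natAbs, ?_⟩
    zify
    rw [h3, ← sq, sq_abs]
  subst hy
  have : (p : ℤ) ≠ 0 := by exact_mod_cast hp.ne_zero
  simp_all

/-- Legendre's theorem for `p x² = q y² + r z²` with distinct primes `p, q, r`. -/
lemma exists_ternary {p q r : ℕ} (hp : p.Prime) (hq : q.Prime) (hr : r.Prime)
    (hpq : p ≠ q) (hqr : q ≠ r) (hrp : r ≠ p) {α β γ : ℤ}
    (hα : (p : ℤ) ∣ q * α ^ 2 + r) (hβ : (q : ℤ) ∣ p * β ^ 2 - r)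
    (hγ : (r : ℤ) ∣ p * γ ^ 2 - q) :
    ∃ x y z : ℤ, z ≠ 0 ∧ p * x ^ 2 = q * y ^ 2 + r * z ^ 2 := by
  obtain ⟨x, y, z, h0, hx, hy, hz, k, hk⟩ :=
    exists_small_ternary hp hq hr hpq hqr hrp hα hβ hγ
  have hp0 : (0 : ℤ) < p := by exact_mod_cast hp.pos
  have hq0 : (0 : ℤ) < q := by exact_mod_cast hq.pos
  have hr0 : (0 : ℤ) < r := by exact_mod_cast hr.pos
  have hpqr : (0 : ℤ) < p * q * r := by positivity
  have hx' : (p : ℤ) * x ^ 2 < p * q * r := by nlinarith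
  have hy' : (q : ℤ) * y ^ 2 < p * q * r := by nlinarith
  have hz' : (r : ℤ) * z ^ 2 < p * q * r := by nlinarith
  have hx0 : 0 ≤ (p : ℤ) * x ^ 2 := by positivity
  have hy0 : 0 ≤ (q : ℤ) * y ^ 2 := by positivity
  have hz0 : 0 ≤ (r : ℤ) * z ^ 2 := by positivity
  have hk1 : k < 1 := by
    by_contra! h
    nlinarith
  have hk2 : -2 < k := by
    by_contra! h
    nlinarith
  obtain rfl | rfl : k = 0 ∨ k = -1 := by omega
  · refine ⟨x, y, z, ?_, by linarith⟩
    rintro rfl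
    have := not_prime_mul_sq_eq hp hq hpq (x := x) (y := y) (by linarith)
    simp_all
  · refine ⟨x * z + q * y, p * x + y * z, z ^ 2 - p * q, ?_, ?_⟩
    · intro h
      linarith
    · linear_combination ((z : ℤ) ^ 2 - p * q) * hk

lemma exists_coprime_ternary {p q r : ℕ} (hp : p.Prime) (hq : q.Prime) (hr : r.Prime)
    (hpq : p ≠ q) (hqr : q ≠ r) (hrp : r ≠ p) {α β γ : ℤ}
    (hα : (p : ℤ) ∣ q * α ^ 2 + r) (hβ : (q : ℤ) ∣ p * β ^ 2 - r)
    (hγ : (r : ℤ) ∣ p * γ ^ 2 - q) :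
    ∃ x y z : ℕ, 0 < x ∧ 0 < y ∧ 0 < z ∧ x.Coprime y ∧ y.Coprime z ∧ z.Coprime x ∧
      p * x ^ 2 = q * y ^ 2 + r * z ^ 2 := by
  have hex : ∃ z : ℕ, 0 < z ∧ ∃ x y : ℕ, p * x ^ 2 = q * y ^ 2 + r * z ^ 2 := by
    obtain ⟨x, y, z, hz, h⟩ := exists_ternary hp hq hr hpq hqr hrp hα hβ hγ
    refine ⟨z.natAbs, Int.natAbs_pos.2 hz, x.natAbs, y.natAbs, ?_⟩
    zify
    simpa using h
  classical
  obtain ⟨hz, x, y, h⟩ := Nat.find_spec hex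
  have hmin := fun m => Nat.find_min hex (m := m)
  set z := Nat.find hex
  have hx : 0 < x := by
    rcases Nat.eq_zero_or_pos x with rfl | hx
    · have : 0 < r * z ^ 2 := by have := hr.pos; positivity
      omega
    · exact hx
  have hy : 0 < y := by
    rcases Nat.eq_zero_or_pos y with rfl | hy
    · have := not_prime_mul_sq_eq hp hr hrp.symm (x := x) (y := z)
        (by exact_mod_cast (show p * x ^ 2 = r * z ^ 2 by simpa using h))
      simp at this
      omega
    · exact hy
  have hall : ∀ l : ℕ, l.Prime → l ∣ x → l ∣ y → l ∣ z → False := by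
    rintro l hl ⟨x', rfl⟩ ⟨y', rfl⟩ ⟨z', hz'⟩
    have hz0 : 0 < z' := by
      rcases Nat.eq_zero_or_pos z' with rfl | h
      · omega
      · exact h
    refine hmin z' ?_ ⟨hz0, x', y', ?_⟩
    · rw [hz']; have := hl.two_le; nlinarith
    · rw [hz'] at h
      have : 0 < l ^ 2 := by have := hl.pos; positivity
      exact Nat.eq_of_mul_eq_mul_left this (by linarith)
  have hthird : ∀ {l m n : ℕ}, l.Prime → m.Prime → l ^ 2 ∣ m * n ^ 2 → l ∣ n := by
    intro l m n hl hm hd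
    by_contra hln
    have h1 : (l ^ 2).Coprime (n ^ 2) := Nat.Coprime.pow _ _ ((hl.coprime_iff_not_dvd).2 hln)
    have h2 : l ^ 2 ∣ m := h1.dvd_of_dvd_mul_right hd
    have h3 : l = m := (Nat.prime_dvd_prime_iff_eq hl hm).1 ((Dvd.intro_left _ (by ring)).trans h2)
    subst h3
    have := Nat.le_of_dvd hl.pos h2
    have := hl.two_le
    nlinarith
  refine ⟨x, y, z, hx, hy, hz, ?_, ?_, ?_, h⟩
  · refine Nat.Coprime.symm (Nat.coprime_of_dvd fun l hl hly hlx => hall l hl hlx hly ?_)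
    refine hthird hl hr ((Nat.dvd_add_right (Dvd.dvd.mul_left (pow_dvd_pow_of_dvd hly 2) q)).1 ?_)
    exact h ▸ Dvd.dvd.mul_left (pow_dvd_pow_of_dvd hlx 2) p
  · refine Nat.coprime_of_dvd fun l hl hly hlz => hall l hl ?_ hly hlz
    refine hthird hl hp ?_
    rw [h]
    exact dvd_add (Dvd.dvd.mul_left (pow_dvd_pow_of_dvd hly 2) q)
      (Dvd.dvd.mul_left (pow_dvd_pow_of_dvd hlz 2) r)
  · refine Nat.coprime_of_dvd fun l hl hlz hlx => hall l hl hlx ?_ hlz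
    refine hthird hl hq ((Nat.dvd_add_left (Dvd.dvd.mul_left (pow_dvd_pow_of_dvd hlz 2) r)).1 ?_)
    exact h ▸ Dvd.dvd.mul_left (pow_dvd_pow_of_dvd hlx 2) p

open scoped NumberTheorySymbols

lemma jacobi_eq_of_dvd_sub {a b : ℤ} {n : ℕ} (h : (n : ℤ) ∣ a - b) : J(a | n) = J(b | n) :=
  jacobiSym.mod_left' (Int.ModEq.symm (Int.modEq_iff_dvd.2 h))

lemma odd_sq_eq {x : ℤ} (hx : x % 2 = 1) : ∃ k : ℤ, x ^ 2 = 8 * k + 1 := by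
  obtain ⟨u, rfl⟩ : ∃ u, x = 2 * u + 1 := ⟨x / 2, by omega⟩
  obtain ⟨k, hk⟩ := (Int.even_mul_succ_self u)
  exact ⟨k, by linear_combination 4 * hk⟩

lemma even_sq_eq {x : ℤ} (hx : x % 2 = 0) : ∃ k : ℤ, x ^ 2 = 4 * k :=
  ⟨(x / 2) ^ 2, by obtain ⟨u, rfl⟩ : ∃ u, x = 2 * u := ⟨x / 2, by omega⟩; simp; ring⟩

lemma not_dvd_of_jacobi_eq_neg_one {a : ℤ} {p : ℕ} (hp : p.Prime) (h : J(a | p) = -1) (x y : ℤ)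
    (hx : ¬ (p : ℤ) ∣ x) : ¬ (p : ℤ) ∣ x ^ 2 - a * y ^ 2 := by
  have := Fact.mk hp
  intro hd
  exact hx (jacobiSym.prime_dvd_of_eq_neg_one h hd).1

lemma jacobi_neg_one_of_mod_four {n : ℕ} (hn : n % 4 = 1) : J(-1 | n) = 1 := by
  rw [jacobiSym.at_neg_one (Nat.odd_iff.2 (by omega)), ZMod.χ₄_nat_one_mod_four hn]

/-- The negative Pell equation for `p q` is solvable if `p` is a nonresidue modulo `q`. -/
lemma exists_neg_pell {p q : ℕ} (hp : p.Prime) (hq : q.Prime) (hpq : p ≠ q)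
    (hp4 : p % 4 ≠ 3) (hp0 : p % 4 ≠ 0) (hq4 : q % 4 = 1) (h : J(p | q) = -1) :
    ∃ T U : ℤ, 0 < T ∧ 0 < U ∧ T ^ 2 + 1 = p * q * U ^ 2 := by
  have hp1 : (0 : ℤ) < p := by exact_mod_cast hp.pos
  have hq1 : (0 : ℤ) < q := by exact_mod_cast hq.pos
  have hns : ¬ IsSquare ((p : ℤ) * q) := by
    rintro ⟨c, hc⟩
    have := not_prime_mul_sq_eq hp hq hpq (x := q) (y := c) (by linear_combination (q : ℤ) * hc)
    omega
  obtain ⟨a, ha⟩ := Pell.IsFundamental.exists_of_not_isSquare (d := (p : ℤ) * q) (by positivity) hns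
  have hx1 : 1 < a.x := ha.1
  have hprop := a.prop
  have hmin : ∀ b c : ℤ, 1 < b → b ^ 2 - p * q * c ^ 2 = 1 → a.x ≤ b := fun b c hb hbc =>
    ha.x_le_x (a := Pell.Solution₁.mk b c hbc) (by simpa using hb)
  generalize a.x = x at *
  generalize a.y = y at *
  have hm4 : (p * q : ℤ) % 4 = 1 ∨ (p * q : ℤ) % 4 = 2 := by
    have h1 : (p : ℤ) % 4 = 1 ∨ (p : ℤ) % 4 = 2 := by omega
    have h2 : (q : ℤ) % 4 = 1 := by omega
    rcases h1 with h1 | h1 <;> simp [Int.mul_emod, h1, h2]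
  have hpar : x % 2 = 1 ∧ y % 2 = 0 := by
    generalize (p * q : ℤ) = m at hprop hm4
    rcases Int.emod_two_eq_zero_or_one x with hx | hx <;>
      rcases Int.emod_two_eq_zero_or_one y with hy | hy
    · obtain ⟨k, hk⟩ := even_sq_eq hx
      obtain ⟨l, hl⟩ := even_sq_eq hy
      rw [hk, hl, mul_left_comm] at hprop
      omega
    · obtain ⟨k, hk⟩ := even_sq_eq hx
      obtain ⟨l, hl⟩ := odd_sq_eq hy
      rw [hk, hl, mul_add, mul_left_comm] at hprop
      omega
    · exact ⟨hx, hy⟩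
    · obtain ⟨k, hk⟩ := odd_sq_eq hx
      obtain ⟨l, hl⟩ := odd_sq_eq hy
      rw [hk, hl, mul_add, mul_left_comm] at hprop
      omega
  obtain ⟨u, rfl⟩ : ∃ u, x = 2 * u + 1 := ⟨x / 2, by omega⟩
  obtain ⟨v, rfl⟩ : ∃ v, y = 2 * v := ⟨y / 2, by omega⟩
  have huv : u * (u + 1) = p * q * v ^ 2 := by linarith
  have hu : 0 < u := by omega
  have hcop : IsCoprime u (u + 1) := ⟨-1, 1, by ring⟩
  have hpp : Prime (p : ℤ) := Nat.prime_iff_prime_int.1 hp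
  have hqp : Prime (q : ℤ) := Nat.prime_iff_prime_int.1 hq
  have hcpq : IsCoprime (p : ℤ) q := Nat.isCoprime_iff_coprime.2 ((Nat.coprime_primes hp hq).2 hpq)
  have sqs : ∀ {A B m : ℤ}, 0 ≤ A → 0 ≤ B → m ≠ 0 → IsCoprime A B → m * (A * B) = m * v ^ 2 →
      ∃ c d : ℤ, A = c ^ 2 ∧ B = d ^ 2 := by
    intro A B m hA hB hm hAB h
    have h' := mul_left_cancel₀ hm h
    have key : ∀ {A B : ℤ}, 0 ≤ A → IsCoprime A B → A * B = v ^ 2 → ∃ c : ℤ, A = c ^ 2 := by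
      intro A B hA hAB h
      obtain ⟨c, hc | hc⟩ := Int.sq_of_isCoprime hAB h
      · exact ⟨c, hc⟩
      · exact ⟨0, by nlinarith [sq_nonneg c]⟩
    obtain ⟨c, hc⟩ := key hA hAB h'
    obtain ⟨d, hd⟩ := key hB hAB.symm (by rw [mul_comm]; exact h')
    exact ⟨c, d, hc, hd⟩
  have hpq0 : (p * q : ℤ) ≠ 0 := by positivity
  have hdp : (p : ℤ) ∣ u ∨ (p : ℤ) ∣ u + 1 :=
    hpp.dvd_or_dvd (huv ▸ Dvd.intro (q * v ^ 2 : ℤ) (by ring))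
  have hdq : (q : ℤ) ∣ u ∨ (q : ℤ) ∣ u + 1 :=
    hqp.dvd_or_dvd (huv ▸ Dvd.intro (p * v ^ 2 : ℤ) (by ring))
  have hneg := jacobi_neg_one_of_mod_four hq4
  have nq : ∀ {c : ℤ} {a : ℤ}, J(a | q) = -1 → (q : ℤ) ∣ a * c ^ 2 - 1 → False := by
    intro c a ha hd
    refine not_dvd_of_jacobi_eq_neg_one hq ha 1 c ?_ ?_
    · exact fun h => hqp.not_isUnit (isUnit_of_dvd_one h)
    · rw [← dvd_neg]; simpa using hd
  rcases hdp with ⟨A, hA⟩ | ⟨A, hA⟩ <;> rcases hdq with hB | hB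
  · obtain ⟨C, hC⟩ := hcpq.mul_dvd ⟨A, hA⟩ hB
    have hC0 : 0 ≤ C := by
      by_contra! h
      nlinarith [mul_pos hp1 hq1]
    have hcop' : IsCoprime C (u + 1) := hcop.of_isCoprime_of_dvd_left ⟨p * q, by rw [hC]; ring⟩
    obtain ⟨c, d, hc, hd⟩ := sqs hC0 (by omega) hpq0 hcop' (by rw [← huv, ← mul_assoc, ← hC])
    have hd1 : 1 < |d| := by
      by_contra! h
      have := sq_le_one_iff_abs_le_one d |>.2 h
      omega
    have := hmin |d| c hd1 (by rw [sq_abs]; linear_combination hC - hd + (p * q : ℤ) * hc)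
    nlinarith [sq_abs d]
  · obtain ⟨B, hB⟩ := hB
    have hcop' : IsCoprime A B :=
      (hcop.of_isCoprime_of_dvd_left ⟨p, by rw [hA]; ring⟩).of_isCoprime_of_dvd_right
      ⟨q, by rw [hB]; ring⟩
    obtain ⟨c, d, hc, hd⟩ := sqs (by by_contra! h; nlinarith) (by by_contra! h; nlinarith) hpq0 hcop'
      (by rw [← huv, hB]; linear_combination -(q * B : ℤ) * hA)
    refine (nq (c := c) (a := -1 * p) (by rw [jacobiSym.mul_left, hneg, h]; rfl) ⟨-B, ?_⟩).elim
    linear_combination -hB + hA + p * hc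
  · obtain ⟨B, hB⟩ := hB
    have hcop' : IsCoprime A B :=
      (hcop.of_isCoprime_of_dvd_left ⟨q, by rw [hB]; ring⟩).of_isCoprime_of_dvd_right
      ⟨p, by rw [hA]; ring⟩ |>.symm
    obtain ⟨c, d, hc, hd⟩ := sqs (by by_contra! h; nlinarith) (by by_contra! h; nlinarith) hpq0 hcop'
      (by rw [← huv, hA]; linear_combination -(p * A : ℤ) * hB)
    refine (nq (c := c) h ⟨B, ?_⟩).elim
    linear_combination hB - hA - p * hc
  · obtain ⟨C, hC⟩ := hcpq.mul_dvd ⟨A, hA⟩ hB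
    have hC0 : 0 ≤ C := by
      by_contra! h
      nlinarith [mul_pos hp1 hq1]
    have hcop' : IsCoprime u C := hcop.of_isCoprime_of_dvd_right ⟨p * q, by rw [hC]; ring⟩
    obtain ⟨c, d, hc, hd⟩ := sqs (by omega) hC0 hpq0 hcop' (by rw [← huv, hC]; ring)
    refine ⟨|c|, |d|, abs_pos.2 ?_, abs_pos.2 ?_, ?_⟩
    · rintro rfl; omega
    · rintro rfl
      rw [hd] at hC
      norm_num at hC
      omega
    · rw [sq_abs, sq_abs]; linear_combination hC - hc + p * q * hd

/-- The field `F(s)` for `s² ∈ F`, described by its elements `a + b s`. -/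
def quadExt (F : IntermediateField ℚ ℝ) (s : ℝ) (hs : s ^ 2 ∈ F) : IntermediateField ℚ ℝ where
  carrier := {x | ∃ a ∈ F, ∃ b ∈ F, x = a + b * s}
  mul_mem' := by
    rintro _ _ ⟨a, ha, b, hb, rfl⟩ ⟨c, hc, d, hd, rfl⟩
    exact ⟨a * c + b * d * s ^ 2, add_mem (mul_mem ha hc) (mul_mem (mul_mem hb hd) hs),
      a * d + b * c, add_mem (mul_mem ha hd) (mul_mem hb hc), by ring⟩
  add_mem' := by
    rintro _ _ ⟨a, ha, b, hb, rfl⟩ ⟨c, hc, d, hd, rfl⟩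
    exact ⟨a + c, add_mem ha hc, b + d, add_mem hb hd, by ring⟩
  algebraMap_mem' x := ⟨_, F.algebraMap_mem x, 0, zero_mem F, by simp⟩
  inv_mem' := by
    rintro _ ⟨a, ha, b, hb, rfl⟩
    by_cases h1 : a + b * s = 0
    · exact ⟨0, zero_mem F, 0, zero_mem F, by rw [h1]; simp⟩
    by_cases h2 : a - b * s = 0
    · refine ⟨(a + a)⁻¹, inv_mem (add_mem ha ha), 0, zero_mem F, ?_⟩
      rw [← sub_eq_zero.1 h2]; ring
    · have h3 : a ^ 2 - b ^ 2 * s ^ 2 ≠ 0 := by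
        rw [show a ^ 2 - b ^ 2 * s ^ 2 = (a + b * s) * (a - b * s) by ring]
        exact mul_ne_zero h1 h2
      have hn : a ^ 2 - b ^ 2 * s ^ 2 ∈ F :=
        sub_mem (pow_mem ha 2) (mul_mem (pow_mem hb 2) hs)
      refine ⟨a * (a ^ 2 - b ^ 2 * s ^ 2)⁻¹, mul_mem ha (inv_mem hn),
        -b * (a ^ 2 - b ^ 2 * s ^ 2)⁻¹, mul_mem (neg_mem hb) (inv_mem hn), ?_⟩
      field_simp
      ring

lemma le_quadExt {F : IntermediateField ℚ ℝ} {s : ℝ} (hs : s ^ 2 ∈ F) {x : ℝ} (hx : x ∈ F) :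
    x ∈ quadExt F s hs :=
  ⟨x, hx, 0, zero_mem F, by simp⟩

lemma mem_quadExt_self {F : IntermediateField ℚ ℝ} {s : ℝ} (hs : s ^ 2 ∈ F) :
    s ∈ quadExt F s hs :=
  ⟨0, zero_mem F, 1, one_mem F, by simp⟩

/-- An element of `F` that is a square in `F(s)` is a square in `F`, possibly after
multiplication by `s²`. -/
lemma exists_sq_eq_of_mem_quadExt {F : IntermediateField ℚ ℝ} {s : ℝ} (hs : s ^ 2 ∈ F) {x : ℝ}
    (hx : x ∈ quadExt F s hs) (hn : x ^ 2 ∈ F) :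
    (∃ a ∈ F, a ^ 2 = x ^ 2) ∨ ∃ a ∈ F, a ^ 2 = x ^ 2 * s ^ 2 := by
  obtain ⟨a, ha, b, hb, rfl⟩ := hx
  by_cases hab : a * b = 0
  · rcases mul_eq_zero.1 hab with rfl | rfl
    · exact Or.inr ⟨b * s ^ 2, mul_mem hb hs, by ring⟩
    · exact Or.inl ⟨a, ha, by ring⟩
  · have hsF : s ∈ F := by
      have h2 : (2 : ℝ) ∈ F := by simp
      obtain ⟨ha0, hb0⟩ := mul_ne_zero_iff.1 hab
      have hs' : s = ((a + b * s) ^ 2 - a ^ 2 - b ^ 2 * s ^ 2) * (2 * (a * b))⁻¹ := by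
        field_simp
        ring
      rw [hs']
      exact mul_mem (sub_mem (sub_mem hn (pow_mem ha 2)) (mul_mem (pow_mem hb 2) hs))
        (inv_mem (mul_mem h2 (mul_mem ha hb)))
    exact Or.inl ⟨a + b * s, add_mem ha (mul_mem hb hsF), rfl⟩

/-- A natural number that is a square in `ℚ(√m, √k)` is a rational square up to a factor
`1, m, k, m k`. -/
lemma exists_rat_sq_of_mem_adjoin {m k n : ℕ} {x : ℝ}
    (hx : x ∈ IntermediateField.adjoin ℚ {Real.sqrt (m : ℝ), Real.sqrt (k : ℝ)})
    (hn : x ^ 2 = n) :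
    ∃ a : ℚ, a ^ 2 = n ∨ a ^ 2 = n * m ∨ a ^ 2 = n * k ∨ a ^ 2 = n * k * m := by
  have hm : Real.sqrt (m : ℝ) ^ 2 = m := Real.sq_sqrt (Nat.cast_nonneg m)
  have hk : Real.sqrt (k : ℝ) ^ 2 = k := Real.sq_sqrt (Nat.cast_nonneg k)
  have h1 : Real.sqrt (m : ℝ) ^ 2 ∈ (⊥ : IntermediateField ℚ ℝ) := by simp [hm]
  have h2 : Real.sqrt (k : ℝ) ^ 2 ∈ quadExt ⊥ _ h1 := by simp [hk]
  have hle : IntermediateField.adjoin ℚ {Real.sqrt (m : ℝ), Real.sqrt (k : ℝ)} ≤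
      quadExt (quadExt ⊥ _ h1) _ h2 := by
    rw [IntermediateField.adjoin_le_iff]
    rintro y (rfl | rfl)
    · exact le_quadExt h2 (mem_quadExt_self h1)
    · exact mem_quadExt_self h2
  have hbot : ∀ {y : ℝ} {c : ℕ}, y ∈ quadExt ⊥ _ h1 → y ^ 2 = c →
      ∃ a : ℚ, a ^ 2 = c ∨ a ^ 2 = c * m := by
    intro y c hy hc
    rcases exists_sq_eq_of_mem_quadExt h1 hy (by simp [hc]) with
      ⟨a, ha, h⟩ | ⟨a, ha, h⟩ <;> obtain ⟨b, rfl⟩ := IntermediateField.mem_bot.1 ha <;>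
      rw [hc] at h
    · exact ⟨b, Or.inl (by simp at h; exact_mod_cast h)⟩
    · rw [hm] at h
      exact ⟨b, Or.inr (by simp at h; exact_mod_cast h)⟩
  rcases exists_sq_eq_of_mem_quadExt h2 (hle hx) (by simp [hn]) with
    ⟨a, ha, h⟩ | ⟨a, ha, h⟩ <;> rw [hn] at h
  · obtain ⟨b, hb | hb⟩ := hbot ha h
    · exact ⟨b, Or.inl hb⟩
    · exact ⟨b, Or.inr (Or.inl hb)⟩
  · rw [hk] at h
    obtain ⟨b, hb | hb⟩ := hbot ha (c := n * k) (by rw [h]; push_cast; ring)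
    · exact ⟨b, Or.inr (Or.inr (Or.inl (by rw [hb]; push_cast; ring)))⟩
    · exact ⟨b, Or.inr (Or.inr (Or.inr (by rw [hb]; push_cast; ring)))⟩

lemma rat_sq_ne_squarefree_mul {t c : ℕ} (ht : Squarefree t) (ht1 : t ≠ 1) (hc : c ≠ 0) (a : ℚ) :
    a ^ 2 ≠ t * c ^ 2 := by
  intro h
  have hsq : IsSquare ((t : ℕ) : ℚ) := by
    refine ⟨a / c, ?_⟩
    have : (c : ℚ) ≠ 0 := by exact_mod_cast hc
    field_simp
    linarith
  rw [Rat.isSquare_natCast_iff] at hsq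
  obtain ⟨b, rfl⟩ := hsq
  have := Nat.isUnit_iff.1 (ht b dvd_rfl)
  subst this
  exact ht1 rfl

/-- Neither `p` nor `q` is a square in `ℚ(√(pq), √(pr))`. -/
lemma not_sq_in_biquadratic {p q r : ℕ} (hp : p.Prime) (hq : q.Prime) (hr : r.Prime)
    (hpq : p ≠ q) (hqr : q ≠ r) (hrp : r ≠ p) {n : ℕ} (hn : n = p ∨ n = q) {x : ℝ}
    (hx : x ∈ IntermediateField.adjoin ℚ
      {Real.sqrt ((p * q : ℕ) : ℝ), Real.sqrt ((p * r : ℕ) : ℝ)}) : x ^ 2 ≠ n := by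
  intro h
  have hpqr : Squarefree (p * q * r) := by
    refine (Nat.squarefree_mul ?_).2 ⟨(Nat.squarefree_mul ?_).2 ⟨?_, ?_⟩, ?_⟩
    · exact Nat.Coprime.mul_left ((Nat.coprime_primes hp hr).2 hrp.symm)
        ((Nat.coprime_primes hq hr).2 hqr)
    · exact (Nat.coprime_primes hp hq).2 hpq
    · exact hp.prime.squarefree
    · exact hq.prime.squarefree
    · exact hr.prime.squarefree
  have hpqr1 : p * q * r ≠ 1 := by
    intro h
    exact hr.one_lt.ne' (Nat.eq_one_of_mul_eq_one_left h)
  obtain ⟨a, ha⟩ := exists_rat_sq_of_mem_adjoin hx h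
  have h1 := fun {c : ℕ} => rat_sq_ne_squarefree_mul (c := c) hp.prime.squarefree hp.one_lt.ne'
  have h2 := fun {c : ℕ} => rat_sq_ne_squarefree_mul (c := c) hq.prime.squarefree hq.one_lt.ne'
  have h3 := fun {c : ℕ} => rat_sq_ne_squarefree_mul (c := c) hr.prime.squarefree hr.one_lt.ne'
  have h4 := fun {c : ℕ} => rat_sq_ne_squarefree_mul (c := c) hpqr hpqr1
  rcases hn with rfl | rfl
  · rcases ha with ha | ha | ha | ha
    · exact h1 one_ne_zero a (by rw [ha]; simp)
    · exact h2 hp.ne_zero a (by rw [ha]; push_cast; ring)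
    · exact h3 hp.ne_zero a (by rw [ha]; push_cast; ring)
    · exact h4 hp.ne_zero a (by rw [ha]; push_cast; ring)
  · rcases ha with ha | ha | ha | ha
    · exact h2 one_ne_zero a (by rw [ha]; simp)
    · exact h1 hq.ne_zero a (by rw [ha]; push_cast; ring)
    · exact h4 one_ne_zero a (by rw [ha]; push_cast; ring)
    · exact h3 (mul_ne_zero hp.ne_zero hq.ne_zero) a (by rw [ha]; push_cast; ring)

/-- A quarter of `(ε₁ε₂ε₃ - ε₁ - ε₂ - ε₃)² / (ε₁ε₂ε₃)` for units `εᵢ = Tᵢ + Uᵢ √mᵢ` of norm `-1`,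
where `n = √(m₁ m₂ m₃)`. -/
def unitResolvent (n T₁ U₁ T₂ U₂ T₃ U₃ : ℤ) : ℤ :=
  T₁ * T₂ * T₃ + U₁ * U₂ * U₃ * n - T₁ - T₂ - T₃

lemma sq_eq_unitResolvent_mul {n T₁ U₁ T₂ U₂ T₃ U₃ : ℤ} {s₁ s₂ s₃ : ℝ}
    (h₁ : (T₁ : ℝ) ^ 2 + 1 = U₁ ^ 2 * s₁ ^ 2) (h₂ : (T₂ : ℝ) ^ 2 + 1 = U₂ ^ 2 * s₂ ^ 2)
    (h₃ : (T₃ : ℝ) ^ 2 + 1 = U₃ ^ 2 * s₃ ^ 2) (hs : s₁ * s₂ * s₃ = n) :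
    ((T₁ + U₁ * s₁) * (T₂ + U₂ * s₂) * (T₃ + U₃ * s₃) - (T₁ + U₁ * s₁) - (T₂ + U₂ * s₂)
      - (T₃ + U₃ * s₃)) ^ 2 = 4 * unitResolvent n T₁ U₁ T₂ U₂ T₃ U₃ *
      ((T₁ + U₁ * s₁) * (T₂ + U₂ * s₂) * (T₃ + U₃ * s₃)) := by
  have hres : (4 * unitResolvent n T₁ U₁ T₂ U₂ T₃ U₃ : ℝ) =
      (T₁ + U₁ * s₁) * (T₂ + U₂ * s₂) * (T₃ + U₃ * s₃)
      + (T₁ + U₁ * s₁) * (T₂ - U₂ * s₂) * (T₃ - U₃ * s₃)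
      + (T₁ - U₁ * s₁) * (T₂ + U₂ * s₂) * (T₃ - U₃ * s₃)
      + (T₁ - U₁ * s₁) * (T₂ - U₂ * s₂) * (T₃ + U₃ * s₃)
      - 2 * ((T₁ + U₁ * s₁) + (T₁ - U₁ * s₁) + ((T₂ + U₂ * s₂) + (T₂ - U₂ * s₂))
        + ((T₃ + U₃ * s₃) + (T₃ - U₃ * s₃))) := by
    simp only [unitResolvent]
    push_cast
    rw [← hs]
    ring
  have k₁ : (T₁ + U₁ * s₁) * (T₁ - U₁ * s₁) = -1 := by linear_combination h₁
  have k₂ : (T₂ + U₂ * s₂) * (T₂ - U₂ * s₂) = -1 := by linear_combination h₂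
  have k₃ : (T₃ + U₃ * s₃) * (T₃ - U₃ * s₃) = -1 := by linear_combination h₃
  rw [hres]
  generalize (T₁ + U₁ * s₁ : ℝ) = a at *
  generalize (T₂ + U₂ * s₂ : ℝ) = b at *
  generalize (T₃ + U₃ * s₃ : ℝ) = c at *
  generalize (T₁ - U₁ * s₁ : ℝ) = a' at *
  generalize (T₂ - U₂ * s₂ : ℝ) = b' at *
  generalize (T₃ - U₃ * s₃ : ℝ) = c' at *
  linear_combination (2 * b * c - b ^ 2 * c * c' - b * c ^ 2 * b') * k₁ +
    (2 * a * c - a ^ 2 * c * c' + c ^ 2) * k₂ + (2 * a * b + a ^ 2 + b ^ 2) * k₃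

/-- The product of two resolvents that differ by `T₂, T₃ ↦ -T₂, -T₃` is `m₁` times a square. -/
lemma unitResolvent_mul_unitResolvent {p q r T₁ U₁ T₂ U₂ T₃ U₃ : ℤ} (h₁ : T₁ ^ 2 + 1 = p * q * U₁ ^ 2)
    (h₂ : T₂ ^ 2 + 1 = q * r * U₂ ^ 2) (h₃ : T₃ ^ 2 + 1 = r * p * U₃ ^ 2) :
    unitResolvent (p * q * r) T₁ U₁ T₂ U₂ T₃ U₃ * unitResolvent (p * q * r) T₁ U₁ (-T₂) U₂ (-T₃) U₃ =
      p * q * (U₁ * (T₂ * T₃ - 1) + r * T₁ * U₂ * U₃) ^ 2 := by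
  simp only [unitResolvent]
  linear_combination ((T₂ * T₃ - 1) ^ 2 - p * q * r ^ 2 * U₂ ^ 2 * U₃ ^ 2) * h₁
    - (T₃ ^ 2 + 1) * h₂ - q * r * U₂ ^ 2 * h₃

lemma unitResolvent_rotate {n T₁ U₁ T₂ U₂ T₃ U₃ : ℤ} :
    unitResolvent n T₂ U₂ T₃ U₃ T₁ U₁ = unitResolvent n T₁ U₁ T₂ U₂ T₃ U₃ := by
  simp only [unitResolvent]
  ring

lemma prime_dvd_of_squarefree_part {l : ℕ} (hl : l.Prime) {d₀ : ℕ} (hd₀ : Squarefree d₀)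
    (hld : l ∣ d₀) {s m w e : ℤ} (hs : s ≠ 0) (hlm : ¬ (l : ℤ) ∣ m)
    (h : d₀ * s ^ 2 * e = m * w ^ 2) : (l : ℤ) ∣ e := by
  have h1 : (m * w) ^ 2 = s ^ 2 * (d₀ * (e * m)) := by linear_combination -m * h
  have h2 : s ∣ m * w := by
    rw [← Int.pow_dvd_pow_iff two_ne_zero, h1]
    exact Dvd.intro _ rfl
  obtain ⟨t, ht⟩ := h2
  rw [ht, mul_pow] at h1
  have h3 : t ^ 2 = d₀ * (e * m) := mul_left_cancel₀ (pow_ne_zero 2 hs) h1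
  have hlp : Prime (l : ℤ) := Nat.prime_iff_prime_int.1 hl
  have hl0 : (l : ℤ) ∣ d₀ := Int.natCast_dvd_natCast.2 hld
  have h4 : (l : ℤ) ∣ t := hlp.dvd_of_dvd_pow (h3 ▸ Dvd.dvd.mul_right hl0 _)
  have h5 : (l : ℤ) * l ∣ d₀ * (e * m) := by
    rw [← h3, sq]
    exact mul_dvd_mul h4 h4
  have h6 := (Int.squarefree_natCast.2 hd₀).dvd_of_squarefree_of_mul_dvd_mul_right h5
  exact (hlp.dvd_or_dvd h6).resolve_right hlm

lemma parity_of_sq_add_one {m T U : ℤ} (hm : m % 4 = 1) (h : T ^ 2 + 1 = m * U ^ 2) :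
    T % 2 = 0 ∧ U % 2 = 1 := by
  rcases Int.emod_two_eq_zero_or_one T with hT | hT <;>
    rcases Int.emod_two_eq_zero_or_one U with hU | hU
  · obtain ⟨k, hk⟩ := even_sq_eq hT
    obtain ⟨j, hj⟩ := even_sq_eq hU
    rw [hk, hj, mul_left_comm] at h
    omega
  · exact ⟨hT, hU⟩
  · obtain ⟨k, hk⟩ := odd_sq_eq hT
    obtain ⟨j, hj⟩ := even_sq_eq hU
    rw [hk, hj, mul_left_comm] at h
    omega
  · obtain ⟨k, hk⟩ := odd_sq_eq hT
    obtain ⟨j, hj⟩ := odd_sq_eq hU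
    rw [hk, hj, mul_add, mul_left_comm] at h
    omega

/-- The odd-valuation primes of the resolvent divide `p q r`. -/
lemma prime_dvd_of_dvd_unitResolvent_part {p q r : ℕ} (hp : p.Prime) (hq : q.Prime) (hr : r.Prime)
    (hp4 : p = 2 ∨ p % 4 = 1) (hq4 : q % 4 = 1) (hr4 : r % 4 = 1) {T₁ U₁ T₂ U₂ T₃ U₃ : ℤ}
    (h₁ : T₁ ^ 2 + 1 = p * q * U₁ ^ 2) (h₂ : T₂ ^ 2 + 1 = q * r * U₂ ^ 2)
    (h₃ : T₃ ^ 2 + 1 = r * p * U₃ ^ 2) {d₀ : ℕ} {s : ℤ} (hd₀ : Squarefree d₀) (hs : s ≠ 0)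
    (hd : unitResolvent (p * q * r) T₁ U₁ T₂ U₂ T₃ U₃ = d₀ * s ^ 2) {l : ℕ} (hl : l.Prime)
    (hld : l ∣ d₀) : l = p ∨ l = q ∨ l = r := by
  by_contra! hne
  obtain ⟨hlp, hlq, hlr⟩ := hne
  have hlz : Prime (l : ℤ) := Nat.prime_iff_prime_int.1 hl
  have nd : ∀ {a : ℕ}, a.Prime → l ≠ a → ¬ (l : ℤ) ∣ a := fun ha h hd =>
    h ((Nat.prime_dvd_prime_iff_eq hl ha).1 (Int.natCast_dvd_natCast.1 hd))
  have ndp := nd hp hlp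
  have ndq := nd hq hlq
  have ndr := nd hr hlr
  have nd2 : ∀ {a b : ℤ}, ¬ (l : ℤ) ∣ a → ¬ (l : ℤ) ∣ b → ¬ (l : ℤ) ∣ a * b :=
    fun ha hb h => (hlz.dvd_or_dvd h).elim ha hb
  have e₀ : (l : ℤ) ∣ unitResolvent (p * q * r) T₁ U₁ T₂ U₂ T₃ U₃ := by
    rw [hd]
    exact Dvd.dvd.mul_right (Int.natCast_dvd_natCast.2 hld) _
  have e₁ := prime_dvd_of_squarefree_part hl hd₀ hld hs (nd2 ndp ndq)
    (by rw [← hd]; exact unitResolvent_mul_unitResolvent h₁ h₂ h₃)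
  have e₂ := prime_dvd_of_squarefree_part hl hd₀ hld hs (nd2 ndq ndr)
    (by
      rw [← hd, ← unitResolvent_rotate, show (p * q * r : ℤ) = q * r * p by ring]
      exact unitResolvent_mul_unitResolvent h₂ h₃ h₁)
  have e₃ := prime_dvd_of_squarefree_part hl hd₀ hld hs (nd2 ndr ndp)
    (by
      rw [← hd, unitResolvent_rotate.symm.trans unitResolvent_rotate.symm,
        show (p * q * r : ℤ) = r * p * q by ring]
      exact unitResolvent_mul_unitResolvent h₃ h₁ h₂)
  simp only [unitResolvent] at e₀ e₁ e₂ e₃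
  by_cases hl2 : l = 2
  · subst hl2
    have hp1 : p % 4 = 1 := hp4.resolve_left hlp.symm
    have mod4 : ∀ {a b : ℕ}, a % 4 = 1 → b % 4 = 1 → (a * b : ℤ) % 4 = 1 := fun ha hb => by
      norm_cast
      simp [Nat.mul_mod, ha, hb]
    obtain ⟨t₁, u₁⟩ := parity_of_sq_add_one (mod4 (by omega) (by omega)) h₁
    obtain ⟨t₂, u₂⟩ := parity_of_sq_add_one (mod4 (by omega) (by omega)) h₂
    obtain ⟨t₃, u₃⟩ := parity_of_sq_add_one (mod4 (by omega) (by omega)) h₃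
    have hodd : (U₁ * U₂ * U₃ * (p * q * r)) % 2 = 1 := by
      rw [← Int.odd_iff] at *
      have hpo : Odd (p : ℤ) := Int.odd_iff.2 (by omega)
      have hqo : Odd (q : ℤ) := Int.odd_iff.2 (by omega)
      have hro : Odd (r : ℤ) := Int.odd_iff.2 (by omega)
      exact ((u₁.mul u₂).mul u₃).mul ((hpo.mul hqo).mul hro)
    have heven : (T₁ * T₂ * T₃) % 2 = 0 := by
      rw [mul_assoc, Int.mul_emod, t₁]; simp
    push_cast at e₀
    omega
  · have nd22 : ¬ (l : ℤ) ∣ 2 := fun h =>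
      hl2 ((Nat.prime_dvd_prime_iff_eq hl Nat.prime_two).1 (by exact_mod_cast h))
    have cancel2 : ∀ {a : ℤ}, (l : ℤ) ∣ 2 * a → (l : ℤ) ∣ a := fun h =>
      (hlz.dvd_or_dvd h).resolve_left nd22
    have s₁ : (l : ℤ) ∣ T₂ + T₃ := cancel2 ((dvd_sub e₁ e₀).trans (dvd_of_eq (by ring)))
    have s₂ : (l : ℤ) ∣ T₃ + T₁ := cancel2 ((dvd_sub e₂ e₀).trans (dvd_of_eq (by ring)))
    have s₃ : (l : ℤ) ∣ T₁ + T₂ := cancel2 ((dvd_sub e₃ e₀).trans (dvd_of_eq (by ring)))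
    have t₁ : (l : ℤ) ∣ T₁ := cancel2 ((dvd_sub (dvd_add s₂ s₃) s₁).trans (dvd_of_eq (by ring)))
    have t₂ : (l : ℤ) ∣ T₂ := (dvd_sub s₃ t₁).trans (dvd_of_eq (by ring))
    have t₃ : (l : ℤ) ∣ T₃ := (dvd_sub s₂ t₁).trans (dvd_of_eq (by ring))
    have hu : ∀ {T U m : ℤ}, (l : ℤ) ∣ T → T ^ 2 + 1 = m * U ^ 2 → ¬ (l : ℤ) ∣ U := by
      intro T U m hT h hU
      have h1 : (l : ℤ) ∣ T ^ 2 + 1 := h ▸ Dvd.dvd.mul_left (Dvd.dvd.pow hU two_ne_zero) _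
      exact hlz.not_isUnit (isUnit_of_dvd_one
        ((dvd_add_right (Dvd.dvd.pow hT two_ne_zero)).1 h1))
    have hA : (l : ℤ) ∣ U₁ * U₂ * U₃ * (p * q * r) := by
      have h1 : (l : ℤ) ∣ T₁ * T₂ * T₃ - T₁ - T₂ - T₃ :=
        dvd_sub (dvd_sub (dvd_sub (Dvd.dvd.mul_left t₃ _) t₁) t₂) t₃
      exact (dvd_sub e₀ h1).trans (dvd_of_eq (by ring))
    exact nd2 (nd2 (nd2 (hu t₁ h₁) (hu t₂ h₂)) (hu t₃ h₃)) (nd2 (nd2 ndp ndq) ndr) hA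

lemma add_mul_pos_of_sq_add_one {T U s : ℝ} (hU : 0 < U) (hs : 0 < s) (h : T ^ 2 + 1 = U ^ 2 * s ^ 2) :
    0 < T + U * s := by
  have h1 : |T| < U * s := abs_lt_of_sq_lt_sq (by rw [mul_pow]; linarith) (by positivity)
  linarith [neg_abs_le T]

lemma eq_of_squarefree_of_prime_dvd {p q n : ℕ} (hp : p.Prime) (hq : q.Prime) (hpq : p ≠ q)
    (hn : Squarefree n) (h : ∀ l : ℕ, l.Prime → l ∣ n → l = p ∨ l = q) :
    n = 1 ∨ n = p ∨ n = q ∨ n = p * q := by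
  have hdvd : n ∣ p * q := by
    rw [← Nat.prod_primeFactors_of_squarefree hn, show p * q = ∏ l ∈ {p, q}, l by simp [hpq]]
    refine Finset.prod_dvd_prod_of_subset _ _ _ fun l hl => ?_
    simpa using h l (Nat.prime_of_mem_primeFactors hl) (Nat.dvd_of_mem_primeFactors hl)
  obtain ⟨a, b, ha, hb, rfl⟩ := (Nat.dvd_mul).1 hdvd
  rcases (Nat.dvd_prime hp).1 ha with rfl | rfl <;> rcases (Nat.dvd_prime hq).1 hb with rfl | rfl <;>
    simp

/-- The product of three units of norm `-1` is a square iff its resolvent is a residue. -/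
lemma exists_sq_eq_prod_iff_jacobi {p q r : ℕ} (hp : p.Prime) (hq : q.Prime) (hr : r.Prime)
    (hpq : p ≠ q) (hp4 : p = 2 ∨ p % 4 = 1) (hq4 : q % 4 = 1) (hr4 : r % 4 = 1)
    (hJp : J(p | r) = -1) (hJq : J(q | r) = -1) {T₁ U₁ T₂ U₂ T₃ U₃ : ℤ}
    (h₁ : T₁ ^ 2 + 1 = p * q * U₁ ^ 2) (h₂ : T₂ ^ 2 + 1 = q * r * U₂ ^ 2)
    (h₃ : T₃ ^ 2 + 1 = r * p * U₃ ^ 2) (hU₁ : 0 < U₁) (hU₂ : 0 < U₂) (hU₃ : 0 < U₃)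
    (hrd : ¬ (r : ℤ) ∣ unitResolvent (p * q * r) T₁ U₁ T₂ U₂ T₃ U₃)
    {K : IntermediateField ℚ ℝ} {s₁ s₂ s₃ : ℝ} (hs₁ : 0 < s₁) (hs₂ : 0 < s₂) (hs₃ : 0 < s₃)
    (hs₁' : s₁ ^ 2 = p * q) (hs₂' : s₂ ^ 2 = q * r) (hs₃' : s₃ ^ 2 = r * p)
    (hK₁ : s₁ ∈ K) (hK₂ : s₂ ∈ K) (hK₃ : s₃ ∈ K)
    (hKp : ∀ x ∈ K, x ^ 2 ≠ (p : ℝ)) (hKq : ∀ x ∈ K, x ^ 2 ≠ (q : ℝ)) :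
    (∃ β ∈ K, β ^ 2 = (T₁ + U₁ * s₁) * (T₂ + U₂ * s₂) * (T₃ + U₃ * s₃)) ↔
      J(unitResolvent (p * q * r) T₁ U₁ T₂ U₂ T₃ U₃ | r) = 1 := by
  have g₁ : (T₁ : ℝ) ^ 2 + 1 = U₁ ^ 2 * s₁ ^ 2 := by rw [hs₁', mul_comm]; exact_mod_cast h₁
  have g₂ : (T₂ : ℝ) ^ 2 + 1 = U₂ ^ 2 * s₂ ^ 2 := by rw [hs₂', mul_comm]; exact_mod_cast h₂
  have g₃ : (T₃ : ℝ) ^ 2 + 1 = U₃ ^ 2 * s₃ ^ 2 := by rw [hs₃', mul_comm]; exact_mod_cast h₃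
  have hs : s₁ * s₂ * s₃ = ((p * q * r : ℤ) : ℝ) := by
    push_cast
    rw [← sq_eq_sq₀ (by positivity) (by positivity), mul_pow, mul_pow, hs₁', hs₂', hs₃']
    ring
  have key := sq_eq_unitResolvent_mul g₁ g₂ g₃ hs
  have e₁ := add_mul_pos_of_sq_add_one (Int.cast_pos.2 hU₁) hs₁ g₁
  have e₂ := add_mul_pos_of_sq_add_one (Int.cast_pos.2 hU₂) hs₂ g₂
  have e₃ := add_mul_pos_of_sq_add_one (Int.cast_pos.2 hU₃) hs₃ g₃
  have int_mem : ∀ n : ℤ, (n : ℝ) ∈ K := fun n => intCast_mem K n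
  have m₁ : (T₁ + U₁ * s₁ : ℝ) ∈ K := add_mem (int_mem _) (mul_mem (int_mem _) hK₁)
  have m₂ : (T₂ + U₂ * s₂ : ℝ) ∈ K := add_mem (int_mem _) (mul_mem (int_mem _) hK₂)
  have m₃ : (T₃ + U₃ * s₃ : ℝ) ∈ K := add_mem (int_mem _) (mul_mem (int_mem _) hK₃)
  have part := @prime_dvd_of_dvd_unitResolvent_part p q r hp hq hr hp4 hq4 hr4 _ _ _ _ _ _ h₁ h₂ h₃
  generalize unitResolvent (p * q * r) T₁ U₁ T₂ U₂ T₃ U₃ = d at *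
  generalize (T₁ + U₁ * s₁ : ℝ) = a at *
  generalize (T₂ + U₂ * s₂ : ℝ) = b at *
  generalize (T₃ + U₃ * s₃ : ℝ) = c at *
  have hd : 0 < d := by
    have h1 : (0 : ℝ) ≤ d := by
      by_contra! hneg
      have : (4 * d : ℝ) * (a * b * c) < 0 := mul_neg_of_neg_of_pos (by linarith) (by positivity)
      linarith [sq_nonneg (a * b * c - a - b - c)]
    have h2 : d ≠ 0 := fun h => hrd (h ▸ dvd_zero _)
    have h3 : 0 ≤ d := by exact_mod_cast h1
    omega
  obtain ⟨d₀, s, hds, hd₀⟩ : ∃ d₀ s : ℕ, d = d₀ * (s : ℤ) ^ 2 ∧ Squarefree d₀ := by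
    obtain ⟨d₀, s, h, hsq⟩ := Nat.sq_mul_squarefree d.toNat
    refine ⟨d₀, s, ?_, hsq⟩
    rw [← Int.toNat_of_nonneg hd.le, ← h]
    push_cast
    ring
  have hs0 : (s : ℤ) ≠ 0 := by
    rintro h
    rw [h] at hds
    simp [hds] at hd
  have hrs : ¬ (r : ℤ) ∣ s := fun h =>
    hrd (hds ▸ Dvd.dvd.mul_left (Dvd.dvd.pow h two_ne_zero) _)
  have hrd₀ : ¬ r ∣ d₀ := fun h =>
    hrd (hds ▸ Dvd.dvd.mul_right (Int.natCast_dvd_natCast.2 h) _)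
  have hJ : J(d | r) = J(d₀ | r) := by
    have hcop : (s : ℤ).gcd r = 1 := by
      rw [Int.gcd_natCast_natCast]
      exact ((Nat.Prime.coprime_iff_not_dvd hr).2 fun h => hrs (Int.natCast_dvd_natCast.2 h)).symm
    rw [hds, jacobiSym.mul_left, jacobiSym.pow_left, jacobiSym.sq_one hcop, mul_one]
  have hcases := eq_of_squarefree_of_prime_dvd hp hq hpq hd₀ fun l hl hld => by
    rcases part hd₀ hs0 hds hl hld with h | h | h
    · exact Or.inl h
    · exact Or.inr h
    · exact absurd (h ▸ hld) hrd₀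
  have hsR : (s : ℝ) ≠ 0 := by exact_mod_cast hs0
  obtain ⟨g, hg, hgd⟩ : ∃ g ∈ K, g ^ 2 = d₀ * (a * b * c) := by
    refine ⟨(a * b * c - a - b - c) / ((2 * s : ℤ) : ℝ), div_mem (sub_mem (sub_mem (sub_mem
      (mul_mem (mul_mem m₁ m₂) m₃) m₁) m₂) m₃) (int_mem _), ?_⟩
    rw [div_pow, key, hds]
    push_cast
    field_simp
    ring
  have hd₀R : (d₀ : ℝ) ≠ 0 := by exact_mod_cast hd₀.ne_zero
  have habc : a * b * c ≠ 0 := by positivity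
  have hiff : (∃ β ∈ K, β ^ 2 = a * b * c) ↔ ∃ x ∈ K, x ^ 2 = (d₀ : ℝ) := by
    constructor
    · rintro ⟨β, hβ, h⟩
      exact ⟨g / β, div_mem hg hβ, by rw [div_pow, hgd, h, mul_div_cancel_right₀ _ habc]⟩
    · rintro ⟨x, hx, h⟩
      exact ⟨g / x, div_mem hg hx, by rw [div_pow, hgd, h, mul_div_cancel_left₀ _ hd₀R]⟩
  rw [hiff, hJ]
  rcases hcases with rfl | rfl | rfl | rfl
  · simpa using ⟨1, one_mem K, by norm_num⟩
  · simp only [hJp]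
    exact iff_of_false (fun ⟨x, hx, h⟩ => hKp x hx h) (by norm_num)
  · simp only [hJq]
    exact iff_of_false (fun ⟨x, hx, h⟩ => hKq x hx h) (by norm_num)
  · refine iff_of_true ⟨s₁, hK₁, by rw [hs₁']; push_cast; rfl⟩ ?_
    rw [Nat.cast_mul, jacobiSym.mul_left, hJp, hJq]
    norm_num

lemma jacobi_sq_eq_one {r : ℕ} (hr : r.Prime) {a : ℤ} (ha : ¬ (r : ℤ) ∣ a) : J(a ^ 2 | r) = 1 :=
  jacobiSym.sq_one' ((Int.isCoprime_iff_gcd_eq_one.1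
    ((Nat.prime_iff_prime_int.1 hr).coprime_iff_not_dvd.2 ha).symm))

lemma jacobi_eq_of_mul_sub_sq {r : ℕ} (hr : r.Prime) {a b c : ℤ} (hc : ¬ (r : ℤ) ∣ c)
    (h : (r : ℤ) ∣ a * b - c ^ 2) : J(a | r) = J(b | r) := by
  apply Int.eq_of_mul_eq_one
  rw [← jacobiSym.mul_left, jacobi_eq_of_dvd_sub h, jacobi_sq_eq_one hr hc]

/-- After changing signs of `T₁` and `T₃`, the resolvent is a unit modulo `r`, and its residue
symbol is that of the unit `T₁ + U₁ √(p q)`. -/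
lemma exists_sign_jacobi_unitResolvent {p q r : ℕ} (hr : r.Prime) (hr4 : r % 4 = 1)
    {T₁ U₁ T₂ U₂ T₃ U₃ w : ℤ} (h₁ : T₁ ^ 2 + 1 = p * q * U₁ ^ 2)
    (h₂ : T₂ ^ 2 + 1 = q * r * U₂ ^ 2) (h₃ : T₃ ^ 2 + 1 = r * p * U₃ ^ 2)
    (hw : (r : ℤ) ∣ w ^ 2 - p * q) :
    ∃ S₁ S₃ : ℤ, S₁ ^ 2 = T₁ ^ 2 ∧ S₃ ^ 2 = T₃ ^ 2 ∧
      ¬ (r : ℤ) ∣ unitResolvent (p * q * r) S₁ U₁ T₂ U₂ S₃ U₃ ∧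
      J(unitResolvent (p * q * r) S₁ U₁ T₂ U₂ S₃ U₃ | r) = J(T₁ + U₁ * w | r) := by
  have hrz : Prime (r : ℤ) := Nat.prime_iff_prime_int.1 hr
  have nd1 : ¬ (r : ℤ) ∣ 1 := fun h => hrz.not_isUnit (isUnit_of_dvd_one h)
  have nd2 : ¬ (r : ℤ) ∣ 2 := fun h => by
    have := (Nat.prime_dvd_prime_iff_eq hr Nat.prime_two).1 (by exact_mod_cast h)
    omega
  have hj : (r : ℤ) ∣ T₂ ^ 2 + 1 := ⟨q * U₂ ^ 2, by rw [h₂]; ring⟩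
  have ndT : ¬ (r : ℤ) ∣ T₂ := fun h =>
    nd1 ((dvd_add_right (Dvd.dvd.pow h two_ne_zero)).1 hj)
  obtain ⟨k, hk⟩ := hw
  have hinv : (r : ℤ) ∣ (T₁ + U₁ * w) * (-T₁ + U₁ * w) - 1 :=
    ⟨U₁ ^ 2 * k, by linear_combination -h₁ + U₁ ^ 2 * hk⟩
  have hJinv : J(T₁ + U₁ * w | r) = J(-T₁ + U₁ * w | r) :=
    jacobi_eq_of_mul_sub_sq hr nd1 (by simpa using hinv)
  obtain ⟨S₁, hS₁, hS₁j, hS₁J⟩ : ∃ S₁ : ℤ, S₁ ^ 2 = T₁ ^ 2 ∧ ¬ (r : ℤ) ∣ S₁ + T₂ ∧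
      J(S₁ + U₁ * w | r) = J(T₁ + U₁ * w | r) := by
    by_cases h : (r : ℤ) ∣ T₁ + T₂
    · refine ⟨-T₁, by ring, fun h' => ?_, hJinv.symm⟩
      have : (r : ℤ) ∣ 2 * T₂ := (dvd_add h h').trans (dvd_of_eq (by ring))
      exact (hrz.dvd_or_dvd this).elim nd2 ndT
    · exact ⟨T₁, rfl, h, rfl⟩
  obtain ⟨S₃, hS₃, hS₃j⟩ : ∃ S₃ : ℤ, S₃ ^ 2 = T₃ ^ 2 ∧ (r : ℤ) ∣ S₃ - T₂ := by
    have : (r : ℤ) ∣ (T₃ - T₂) * (T₃ + T₂) :=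
      ⟨p * U₃ ^ 2 - q * U₂ ^ 2, by linear_combination h₃ - h₂⟩
    rcases hrz.dvd_or_dvd this with h | h
    · exact ⟨T₃, rfl, h⟩
    · exact ⟨-T₃, by ring, (dvd_neg.2 h).trans (dvd_of_eq (by ring))⟩
  have hmod : (r : ℤ) ∣ unitResolvent (p * q * r) S₁ U₁ T₂ U₂ S₃ U₃ - -1 * (2 * (S₁ + T₂)) := by
    obtain ⟨a, ha⟩ := hS₃j
    obtain ⟨b, hb⟩ := hj
    refine ⟨S₁ * b + S₁ * T₂ * a - a + U₁ * U₂ * U₃ * (p * q), ?_⟩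
    simp only [unitResolvent]
    linear_combination (S₁ * T₂ - 1) * ha + S₁ * hb
  have nd2S : ¬ (r : ℤ) ∣ 2 * (S₁ + T₂) := fun h => (hrz.dvd_or_dvd h).elim nd2 hS₁j
  have hsq : (r : ℤ) ∣ 2 * (S₁ + T₂) * (S₁ + U₁ * w) - (S₁ + T₂ + U₁ * w) ^ 2 := by
    obtain ⟨b, hb⟩ := hj
    exact ⟨-b - U₁ ^ 2 * k, by linear_combination hS₁ + h₁ - hb - U₁ ^ 2 * hk⟩
  have ndS : ¬ (r : ℤ) ∣ S₁ + U₁ * w := fun h => nd1 <| by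
    have h1 : (r : ℤ) ∣ (S₁ + U₁ * w) * (-S₁ + U₁ * w) - 1 :=
      ⟨U₁ ^ 2 * k, by linear_combination -hS₁ - h₁ + U₁ ^ 2 * hk⟩
    exact (dvd_sub_right (Dvd.dvd.mul_right h _)).1 h1
  refine ⟨S₁, S₃, hS₁, hS₃, fun h => nd2S ?_, ?_⟩
  · exact (dvd_sub hmod h).trans (dvd_of_eq (by ring))
  · rw [jacobi_eq_of_dvd_sub hmod, jacobiSym.mul_left, jacobi_neg_one_of_mod_four hr4, one_mul,
      ← hS₁J]
    refine jacobi_eq_of_mul_sub_sq hr (fun h => ?_) hsq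
    have := (dvd_add hsq (Dvd.dvd.pow h two_ne_zero)).trans (dvd_of_eq (sub_add_cancel _ _))
    exact (hrz.dvd_or_dvd this).elim nd2S ndS

/-- The quartic symbol of `a` is the quadratic symbol of a square root of `a`. -/
lemma quartSym_eq_jacobi {r : ℕ} (hr : r.Prime) (hr4 : r % 4 = 1) {a X Y : ℤ}
    (hX : ¬ (r : ℤ) ∣ X) (h : (r : ℤ) ∣ X ^ 2 - a * Y ^ 2) : quartSym a r = J(X * Y | r) := by
  have := Fact.mk hr
  have hrz : Prime (r : ℤ) := Nat.prime_iff_prime_int.1 hr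
  have hY : ¬ (r : ℤ) ∣ Y := fun hY => hX <| hrz.dvd_of_dvd_pow (n := 2) <|
    (dvd_sub_left (Dvd.dvd.mul_left (Dvd.dvd.pow hY two_ne_zero) a)).1 h
  have hXY : ¬ (r : ℤ) ∣ X * Y := fun h => (hrz.dvd_or_dvd h).elim hX hY
  have hr2 : r ≠ 2 := by omega
  simp only [quartSym, if_neg hr2]
  by_cases hex : ∃ x : ℤ, (r : ℤ) ∣ x ^ 4 - a
  · rw [if_pos hex]
    obtain ⟨x, hx⟩ := hex
    have h1 : (r : ℤ) ∣ (X - x ^ 2 * Y) * (X + x ^ 2 * Y) :=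
      (dvd_sub h (Dvd.dvd.mul_right hx (Y ^ 2))).trans (dvd_of_eq (by ring))
    have hxY : ∀ c : ℤ, (r : ℤ) ∣ X - c * (x ^ 2 * Y) → ¬ (r : ℤ) ∣ x * Y := by
      intro c hc hd
      refine hX ((dvd_sub_left ?_).1 hc)
      exact Dvd.dvd.mul_left (hd.trans ⟨x, by ring⟩) c
    rcases hrz.dvd_or_dvd h1 with h2 | h2
    · rw [← jacobi_sq_eq_one hr (hxY 1 (by simpa using h2))]
      exact jacobi_eq_of_dvd_sub (((dvd_neg.2 h2).mul_right Y).trans (dvd_of_eq (by ring)))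
    · rw [← jacobi_sq_eq_one hr (hxY (-1) (by simpa using h2)), ← one_mul J((x * Y) ^ 2 | r),
        ← jacobi_neg_one_of_mod_four hr4, ← jacobiSym.mul_left]
      exact jacobi_eq_of_dvd_sub (((dvd_neg.2 h2).mul_right Y).trans (dvd_of_eq (by ring)))
  · rw [if_neg hex]
    rcases jacobiSym.eq_one_or_neg_one (Int.isCoprime_iff_gcd_eq_one.1
      (hrz.coprime_iff_not_dvd.2 hXY).symm) with h1 | h1
    · refine absurd ?_ hex
      obtain ⟨z, hz⟩ := ZMod.isSquare_of_jacobiSym_eq_one h1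
      have hY0 : (Y : ZMod r) ≠ 0 := by rwa [Ne, ZMod.intCast_zmod_eq_zero_iff_dvd]
      obtain ⟨x, hx⟩ := ZMod.intCast_surjective (z / (Y : ZMod r))
      refine ⟨x, ?_⟩
      have h2 := (ZMod.intCast_zmod_eq_zero_iff_dvd _ r).2 h
      rw [← ZMod.intCast_zmod_eq_zero_iff_dvd]
      push_cast at h2 hz ⊢
      rw [hx, div_pow, sub_eq_zero, div_eq_iff (pow_ne_zero 4 hY0)]
      linear_combination -(X * Y + z * z) * hz + (Y : ZMod r) ^ 2 * h2
    · exact h1.symm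

lemma jacobi_eq_one_of_dvd_sq_sub {n : ℕ} {c X Y : ℤ} (hX : IsCoprime X n)
    (h : (n : ℤ) ∣ X ^ 2 - c * Y ^ 2) : J(c | n) = 1 := by
  have h1 : J(c | n) * J(Y | n) ^ 2 = 1 := by
    rw [← jacobiSym.pow_left, ← jacobiSym.mul_left, ← jacobi_eq_of_dvd_sub h,
      jacobiSym.sq_one' (Int.isCoprime_iff_gcd_eq_one.1 hX)]
  rcases Int.eq_one_or_neg_one_of_mul_eq_one h1 with h2 | h2
  · exact h2
  · rw [h2] at h1
    nlinarith [sq_nonneg J(Y | n)]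

lemma jacobi_eq_one_of_forall_prime {c : ℤ} {n : ℕ}
    (h : ∀ l : ℕ, l.Prime → l ∣ n → J(c | l) = 1) : J(c | n) = 1 := by
  induction n using induction_on_primes with
  | zero => simp
  | one => simp
  | prime_mul l a hl ih =>
    by_cases ha : a = 0
    · simp [ha]
    have := NeZero.mk ha
    have := NeZero.mk hl.ne_zero
    rw [jacobiSym.mul_right, h l hl (Dvd.intro _ rfl), ih fun m hm hd => h m hm (hd.mul_left _),
      mul_one]

lemma mod_four_eq_one_of_dvd_sq_add_one {U : ℕ} (hU : U % 2 = 1) {T : ℤ}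
    (h : (U : ℤ) ∣ T ^ 2 + 1) : U % 4 = 1 := by
  have h1 : J(-1 | U) = 1 := by
    refine jacobi_eq_one_of_dvd_sq_sub (X := T) (Y := 1) ?_ (by simpa using h)
    obtain ⟨k, hk⟩ := h
    exact ⟨-T, k, by linear_combination -hk⟩
  by_contra hne
  rw [jacobiSym.at_neg_one (Nat.odd_iff.2 hU), ZMod.χ₄_nat_three_mod_four (by omega)] at h1
  norm_num at h1

lemma not_dvd_of_ternary {p q r : ℕ} (hp : p.Prime) (hq : q.Prime) (hr : r.Prime)
    (hpq : p ≠ q) (hqr : q ≠ r) (hrp : r ≠ p) {x y z : ℕ} (hxy : x.Coprime y)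
    (hyz : y.Coprime z) (hzx : z.Coprime x) (h : p * x ^ 2 = q * y ^ 2 + r * z ^ 2) :
    (¬ p ∣ y ∧ ¬ p ∣ z) ∧ (¬ q ∣ x ∧ ¬ q ∣ z) ∧ ¬ r ∣ x ∧ ¬ r ∣ y := by
  have dvd_of : ∀ {l a u : ℕ}, l.Prime → a.Prime → l ≠ a → l ∣ a * u ^ 2 → l ∣ u := by
    intro l a u hl ha hla hd
    refine hl.dvd_of_dvd_pow ((hl.dvd_mul.1 hd).resolve_left fun h => hla ?_)
    exact (Nat.prime_dvd_prime_iff_eq hl ha).1 h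
  have sq_dvd : ∀ {l : ℕ} (a : ℕ) {u : ℕ}, l ∣ u → l ∣ a * u ^ 2 := fun a _ hd =>
    Dvd.dvd.mul_left (Dvd.dvd.pow hd two_ne_zero) a
  have absurd_of : ∀ {l a b : ℕ}, l.Prime → a.Coprime b → l ∣ a → l ∣ b → False :=
    fun hl hab ha hb => hl.one_lt.ne' (Nat.eq_one_of_dvd_coprimes hab ha hb)
  have dl : p ∣ q * y ^ 2 + r * z ^ 2 := h ▸ Dvd.intro _ rfl
  have hq1 : q ∣ q * y ^ 2 := Dvd.intro _ rfl
  have hr1 : r ∣ r * z ^ 2 := Dvd.intro _ rfl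
  refine ⟨⟨fun hd => ?_, fun hd => ?_⟩, ⟨fun hd => ?_, fun hd => ?_⟩, fun hd => ?_, fun hd => ?_⟩
  · exact absurd_of hp hyz hd (dvd_of hp hr hrp.symm ((Nat.dvd_add_right (sq_dvd q hd)).1 dl))
  · exact absurd_of hp hyz (dvd_of hp hq hpq ((Nat.dvd_add_left (sq_dvd r hd)).1 dl)) hd
  · exact absurd_of hq hzx (dvd_of hq hr hqr ((Nat.dvd_add_right hq1).1 (h ▸ sq_dvd p hd))) hd
  · exact absurd_of hq hzx hd (dvd_of hq hp hpq.symm (h ▸ dvd_add hq1 (sq_dvd r hd)))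
  · exact absurd_of hr hxy hd (dvd_of hr hq hqr.symm ((Nat.dvd_add_left hr1).1 (h ▸ sq_dvd p hd)))
  · exact absurd_of hr hxy (dvd_of hr hp hrp (h ▸ dvd_add (sq_dvd q hd) hr1)) hd

/-- Reciprocity for the symbol of the unit `T + U √(p q)` modulo `r`, the square root of `p q`
being read off from a solution of `p x² = q y² + r z²`. -/
lemma jacobi_unit_eq {p q r : ℕ} (hp : p.Prime) (hr : r.Prime) (hr4 : r % 4 = 1)
    {x y z T U : ℕ} (hxy : x.Coprime y) (hyz : y.Coprime z)
    (h : p * x ^ 2 = q * y ^ 2 + r * z ^ 2) (hpy : ¬ p ∣ y) (hry : ¬ r ∣ y)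
    (hTU : T ^ 2 + 1 = p * q * U ^ 2) (hodd : (T * y + U * (p * x)) % 2 = 1) {w : ℤ}
    (hw : (r : ℤ) ∣ w * y - p * x) :
    J(T + U * w | r) = J(-p | T * y + U * (p * x)) * J(y | r) := by
  have hz : (p : ℤ) * x ^ 2 = q * y ^ 2 + r * z ^ 2 := by exact_mod_cast h
  have hTUz : (T : ℤ) ^ 2 + 1 = p * q * U ^ 2 := by exact_mod_cast hTU
  set L : ℕ := T * y + U * (p * x) with hL
  have hLz : (L : ℤ) = T * y + U * (p * x) := by rw [hL]; push_cast; ring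
  have hone : J(-p * r | L) = 1 := by
    refine jacobi_eq_one_of_forall_prime fun l hl hlL => ?_
    have nd_one : ∀ {a b : ℕ}, a.Coprime b → l ∣ a → ¬ l ∣ b := fun hab ha hb =>
      hl.one_lt.ne' (Nat.eq_one_of_dvd_coprimes hab ha hb)
    have coprime_of : ∀ {a : ℕ}, ¬ l ∣ a → IsCoprime (a : ℤ) l := fun ha =>
      Nat.isCoprime_iff_coprime.2 ((hl.coprime_iff_not_dvd.2 ha).symm)
    by_cases hly : l ∣ y
    · have hlx : ¬ l ∣ x := fun hx => nd_one hxy hx hly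
      have hlU : l ∣ U := by
        have h1 : l ∣ U * (p * x) := (Nat.dvd_add_right (Dvd.dvd.mul_left hly T)).1 hlL
        refine (hl.dvd_mul.1 h1).resolve_right fun h2 => ?_
        rcases hl.dvd_mul.1 h2 with h3 | h3
        · exact hpy ((Nat.prime_dvd_prime_iff_eq hl hp).1 h3 ▸ hly)
        · exact hlx h3
      have hlT : ¬ l ∣ T := fun hT => by
        have h1 : l ∣ T ^ 2 + 1 := hTU ▸ Dvd.dvd.mul_left (Dvd.dvd.pow hlU two_ne_zero) _
        exact hl.one_lt.ne' (Nat.dvd_one.1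
          ((Nat.dvd_add_right (Dvd.dvd.pow hT two_ne_zero)).1 h1))
      have hlr : ¬ l ∣ r := fun h1 =>
        hry ((Nat.prime_dvd_prime_iff_eq hl hr).1 h1 ▸ hly)
      refine jacobi_eq_one_of_dvd_sq_sub (X := T * r * z) (Y := x)
        (((coprime_of hlT).mul_left (coprime_of hlr)).mul_left (coprime_of (nd_one hyz hly))) ?_
      obtain ⟨a, ha⟩ := hly
      obtain ⟨b, hb⟩ := hlU
      have haz : (y : ℤ) = l * a := by exact_mod_cast ha
      have hbz : (U : ℤ) = l * b := by exact_mod_cast hb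
      refine ⟨r ^ 2 * z ^ 2 * p * q * l * b ^ 2 + r * q * l * a ^ 2, ?_⟩
      linear_combination r ^ 2 * z ^ 2 * hTUz + r * hz
        + r ^ 2 * z ^ 2 * p * q * (U + l * b) * hbz + r * q * (y + l * a) * haz
    · refine jacobi_eq_one_of_dvd_sq_sub (X := y) (Y := U * z) (coprime_of hly) ?_
      refine (Int.natCast_dvd_natCast.2 hlL).trans ⟨-(T * y - U * (p * x)), ?_⟩
      rw [hLz]
      linear_combination (y : ℤ) ^ 2 * hTUz - p * U ^ 2 * hz
  have hsplit : J(L | r) = J(T + U * w | r) * J(y | r) := by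
    rw [← jacobiSym.mul_left]
    refine jacobi_eq_of_dvd_sub (((dvd_neg.2 hw).mul_left (U : ℤ)).trans (dvd_of_eq ?_))
    rw [hLz]
    ring
  have hy1 : J(y | r) * J(y | r) = 1 := by
    rw [← jacobiSym.mul_left, ← sq]
    exact jacobi_sq_eq_one hr fun hd => hry (Int.natCast_dvd_natCast.1 hd)
  have hrec : J(L | r) = J(-p | L) := by
    rw [← jacobiSym.quadratic_reciprocity_one_mod_four hr4 (Nat.odd_iff.2 hodd)]
    rw [jacobiSym.mul_left] at hone
    exact (Int.eq_of_mul_eq_one hone).symm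
  rw [← hrec, hsplit, mul_assoc, hy1, mul_one]

/-- The symbol `(x / q r)` for a solution of `p x² = q y² + r z²`. -/
lemma jacobi_ternary_left {p q r : ℕ} (hq : q.Prime) (hq4 : q % 4 = 1)
    (hr4 : r % 4 = 1) {x y z : ℕ} (hx : x % 2 = 1) (hxy : x.Coprime y)
    (h : p * x ^ 2 = q * y ^ 2 + r * z ^ 2) (hqx : ¬ q ∣ x) :
    J(x | q) * J(x | r) = J(-1 | x) := by
  have hz : (p : ℤ) * x ^ 2 = q * y ^ 2 + r * z ^ 2 := by exact_mod_cast h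
  have hxo := Nat.odd_iff.2 hx
  have h1 : J(-1 * (q * r) | x) = 1 := by
    refine jacobi_eq_one_of_dvd_sq_sub (X := q * y) (Y := z) ?_
      ⟨q * p * x, by linear_combination -q * hz⟩
    exact (Nat.isCoprime_iff_coprime.2 (hq.coprime_iff_not_dvd.2 hqx)).mul_left
      (Nat.isCoprime_iff_coprime.2 hxy.symm)
  rw [← jacobiSym.quadratic_reciprocity_one_mod_four hq4 hxo,
    ← jacobiSym.quadratic_reciprocity_one_mod_four hr4 hxo, ← jacobiSym.mul_left]
  rw [jacobiSym.mul_left] at h1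
  exact (Int.eq_of_mul_eq_one h1).symm

lemma jacobi_two_mul_jacobi_two {p q : ℕ} (hpq : p * q % 4 = 1) :
    J(2 | p) * J(2 | q) = if p * q % 8 = 1 then 1 else -1 := by
  have hp0 : p ≠ 0 := by rintro rfl; simp at hpq
  have hq0 : q ≠ 0 := by rintro rfl; simp at hpq
  rw [← jacobiSym.mul_right' _ hp0 hq0, jacobiSym.at_two (Nat.odd_iff.2 (by omega)),
    ZMod.χ₈_nat_eq_if_mod_eight]
  split_ifs <;> first | rfl | omega

/-- The symbol `(z / p q)` for a solution of `p x² = q y² + r z²` with `x` odd. -/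
lemma jacobi_ternary_right {p q r : ℕ} (hp : p.Prime) (hp4 : p % 4 = 1) (hq4 : q % 4 = 1)
    {x y z : ℕ} (hx : x % 2 = 1) (hz0 : z ≠ 0) (hzx : z.Coprime x)
    (h : p * x ^ 2 = q * y ^ 2 + r * z ^ 2) (hpz : ¬ p ∣ z) :
    J(z | p) * J(z | q) = if z % 2 = 0 then J(2 | p) * J(2 | q) else 1 := by
  obtain ⟨k, m, hm, hzm⟩ := Nat.exists_eq_two_pow_mul_odd hz0
  have hz : (p : ℤ) * x ^ 2 = q * y ^ 2 + r * z ^ 2 := by exact_mod_cast h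
  have hmz : m ∣ z := hzm ▸ Dvd.intro_left _ rfl
  have hm1 : J(m | p) * J(m | q) = 1 := by
    rw [← jacobiSym.quadratic_reciprocity_one_mod_four hp4 hm,
      ← jacobiSym.quadratic_reciprocity_one_mod_four hq4 hm, ← jacobiSym.mul_left]
    refine jacobi_eq_one_of_dvd_sq_sub (X := p * x) (Y := y) ?_
      ((Int.natCast_dvd_natCast.2 hmz).trans ⟨p * r * z, by linear_combination p * hz⟩)
    exact (Nat.isCoprime_iff_coprime.2 (hp.coprime_iff_not_dvd.2 fun hd => hpz (hd.trans hmz))).mul_left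
      (Nat.isCoprime_iff_coprime.2 (hzx.coprime_dvd_left hmz).symm)
  have hsplit : J(z | p) * J(z | q) = (J(2 | p) * J(2 | q)) ^ k := by
    rw [hzm]
    push_cast
    rw [jacobiSym.mul_left, jacobiSym.mul_left, jacobiSym.pow_left, jacobiSym.pow_left, mul_pow]
    linear_combination J(2 | p) ^ k * J(2 | q) ^ k * hm1
  rw [hsplit]
  rcases k with _ | _ | k
  · rw [if_neg (by have := Nat.odd_iff.1 hm; simp at hzm; omega), pow_zero]
  · rw [if_pos (by omega), zero_add, pow_one]
  · rw [if_pos (by rw [hzm, pow_succ, mul_assoc, Nat.mul_mod, Nat.mul_mod 2]; simp)]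
    have hpq : p * q % 4 = 1 := by simp [Nat.mul_mod, hp4, hq4]
    rw [jacobi_two_mul_jacobi_two hpq, if_pos, one_pow]
    have hz4 : z = 4 * (2 ^ k * m) := by rw [hzm]; ring
    obtain ⟨a, ha⟩ := odd_sq_eq (x := x) (by omega)
    have hz2 : (z : ℤ) ^ 2 = 16 * (2 ^ k * m) ^ 2 := by rw [hz4]; push_cast; ring
    have hmod : p % 8 = q % 8 := by
      rcases Nat.mod_two_eq_zero_or_one y with hy | hy
      · obtain ⟨b, hb⟩ := even_sq_eq (x := y) (by omega)
        have : (p : ℤ) = 2 * (2 * (q * b) + 8 * (r * (2 ^ k * m) ^ 2) - 4 * (p * a)) := by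
          linear_combination hz - p * ha + q * hb + r * hz2
        omega
      · obtain ⟨b, hb⟩ := odd_sq_eq (x := y) (by omega)
        have : (p : ℤ) = q + 8 * (q * b + 2 * (r * (2 ^ k * m) ^ 2) - p * a) := by
          linear_combination hz - p * ha + q * hb + r * hz2
        omega
    rw [Nat.mul_mod, hmod]
    have : q % 8 = 1 ∨ q % 8 = 5 := by omega
    rcases this with h8 | h8 <;> rw [h8]

/-- All three primes are `1` modulo `4`: the symbol of the unit is minus the quartic product. -/
lemma jacobi_unit_eq_quartSym_of_odd {p q r : ℕ} (hp : p.Prime) (hq : q.Prime) (hr : r.Prime)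
    (hpq : p ≠ q) (hqr : q ≠ r) (hrp : r ≠ p)
    (hp4 : p % 4 = 1) (hq4 : q % 4 = 1) (hr4 : r % 4 = 1) (hJpq : J(p | q) = -1)
    (hJpr : J(p | r) = -1) {x y z T U : ℕ} (hz0 : z ≠ 0) (hxy : x.Coprime y) (hyz : y.Coprime z)
    (hzx : z.Coprime x) (h : p * x ^ 2 = q * y ^ 2 + r * z ^ 2)
    (hTU : T ^ 2 + 1 = p * q * U ^ 2) {w : ℤ} (hw : (r : ℤ) ∣ w * y - p * x) :
    J(T + U * w | r) = -(quartSym ((p * q : ℕ) : ℤ) r * quartSym ((q * r : ℕ) : ℤ) p *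
      quartSym ((r * p : ℕ) : ℤ) q) := by
  obtain ⟨⟨hpy, hpz⟩, ⟨hqx, hqz⟩, hrx, hry⟩ := not_dvd_of_ternary hp hq hr hpq hqr hrp hxy hyz hzx h
  have hz : (p : ℤ) * x ^ 2 = q * y ^ 2 + r * z ^ 2 := by exact_mod_cast h
  have hTUz : (T : ℤ) ^ 2 + 1 = p * q * U ^ 2 := by exact_mod_cast hTU
  have nd : ∀ {l a : ℕ}, ¬ l ∣ a → ¬ (l : ℤ) ∣ a := fun hn hd => hn (Int.natCast_dvd_natCast.1 hd)
  have ndp : ∀ {l a : ℕ}, l.Prime → a.Prime → l ≠ a → ¬ l ∣ a := fun hl ha hla hd =>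
    hla ((Nat.prime_dvd_prime_iff_eq hl ha).1 hd)
  have ndm : ∀ {l : ℕ} {a b : ℤ}, l.Prime → ¬ (l : ℤ) ∣ a → ¬ (l : ℤ) ∣ b → ¬ (l : ℤ) ∣ a * b :=
    fun hl ha hb hd => ((Nat.prime_iff_prime_int.1 hl).dvd_or_dvd hd).elim ha hb
  have hpT : ¬ (p : ℤ) ∣ T := fun hd => (Nat.prime_iff_prime_int.1 hp).not_isUnit <|
    isUnit_of_dvd_one <| (dvd_add_right (Dvd.dvd.pow hd two_ne_zero)).1
      (show (p : ℤ) ∣ T ^ 2 + 1 from ⟨q * U ^ 2, by rw [hTUz]; ring⟩)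
  have quart₁ : quartSym ((p * q : ℕ) : ℤ) r = J(p * x * y | r) :=
    quartSym_eq_jacobi hr hr4 (ndm hr (nd (ndp hr hp hrp)) (nd hrx))
      ⟨p * z ^ 2, by push_cast; linear_combination p * hz⟩
  have quart₂ : quartSym ((q * r : ℕ) : ℤ) p = J(q * y * T * z | p) :=
    quartSym_eq_jacobi hp hp4 (ndm hp (ndm hp (nd (ndp hp hq hpq)) (nd hpy)) hpT)
      ⟨q ^ 3 * y ^ 2 * U ^ 2 - q * x ^ 2, by
        push_cast; linear_combination q ^ 2 * y ^ 2 * hTUz + q * hz⟩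
  have quart₃ : quartSym ((r * p : ℕ) : ℤ) q = J(p * x * z | q) :=
    quartSym_eq_jacobi hq hq4 (ndm hq (nd (ndp hq hp hpq.symm)) (nd hqx))
      ⟨p * y ^ 2, by push_cast; linear_combination p * hz⟩
  have hJqp : J(q | p) = -1 := by
    rw [jacobiSym.quadratic_reciprocity_one_mod_four hq4 (Nat.odd_iff.2 (by omega)), hJpq]
  have hpq4 : p * q % 4 = 1 := by simp [Nat.mul_mod, hp4, hq4]
  have hUT : U % 2 = 1 ∧ T % 2 = 0 := by
    have := parity_of_sq_add_one (by exact_mod_cast hpq4) hTUz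
    omega
  have hx : x % 2 = 1 ∧ (y % 2 = 0 ∧ z % 2 = 1 ∨ y % 2 = 1 ∧ z % 2 = 0) := by
    have sq_mod : ∀ {a n : ℕ}, a % 4 = 1 → a * n ^ 2 % 4 = n % 2 := fun {a n} ha => by
      have : n % 4 = 0 ∨ n % 4 = 1 ∨ n % 4 = 2 ∨ n % 4 = 3 := by omega
      have h2 : n % 2 = n % 4 % 2 := by omega
      rcases this with h4 | h4 | h4 | h4 <;> simp [Nat.mul_mod, Nat.pow_mod, ha, h2, h4]
    have h1 := sq_mod (n := x) hp4
    have h2 := sq_mod (n := y) hq4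
    have h3 := sq_mod (n := z) hr4
    have h4 : ¬ (y % 2 = 0 ∧ z % 2 = 0) := fun h4 => by
      have := Nat.eq_one_of_dvd_coprimes hyz (Nat.dvd_of_mod_eq_zero h4.1)
        (Nat.dvd_of_mod_eq_zero h4.2)
      omega
    omega
  have hU4 : U % 4 = 1 := mod_four_eq_one_of_dvd_sq_add_one hUT.1 (T := T)
    ⟨p * q * U, by rw [hTUz]; ring⟩
  have hUpx : U * (p * x) % 4 = x % 4 := by simp [Nat.mul_mod, hU4, hp4]
  have hodd : (T * y + U * (p * x)) % 2 = 1 := by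
    have : T * y % 2 = 0 := by simp [Nat.mul_mod, hUT.2]
    omega
  have hneg : J(-1 | T * y + U * (p * x)) = J(-1 | x) * (J(z | p) * J(z | q)) := by
    rw [jacobi_ternary_right hp hp4 hq4 hx.1 hz0 hzx h hpz, jacobi_two_mul_jacobi_two hpq4,
      jacobiSym.at_neg_one (Nat.odd_iff.2 hodd), jacobiSym.at_neg_one (Nat.odd_iff.2 hx.1),
      ZMod.χ₄_nat_eq_if_mod_four, ZMod.χ₄_nat_eq_if_mod_four]
    obtain ⟨t, rfl⟩ : ∃ t, T = 2 * t := ⟨T / 2, by omega⟩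
    obtain ⟨j, hj⟩ := odd_sq_eq (x := U) (by omega)
    have hm : (p * q : ℤ) + 8 * (p * q * j) = 4 * t ^ 2 + 1 := by
      push_cast at hTUz
      linear_combination -hTUz - p * q * hj
    have hm8 : p * q % 8 = 1 ↔ t % 2 = 0 := by
      rcases Nat.mod_two_eq_zero_or_one t with ht | ht
      · obtain ⟨k, hk⟩ := even_sq_eq (x := t) (by omega)
        rw [hk] at hm
        norm_cast at hm ⊢
        omega
      · obtain ⟨k, hk⟩ := odd_sq_eq (x := t) (by omega)
        rw [hk] at hm
        norm_cast at hm ⊢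
        omega
    have hty : 2 * t * y % 4 = 2 * ((t % 2) * (y % 2)) := by
      rcases Nat.mod_two_eq_zero_or_one t with ht | ht <;>
        rcases Nat.mod_two_eq_zero_or_one y with hy | hy <;>
        have := Nat.mul_mod t y 2 <;> rw [ht, hy] at this <;> rw [ht, hy, mul_assoc] <;> omega
    rcases hx.2 with ⟨hy, hz2⟩ | ⟨hy, hz2⟩ <;>
      rcases Nat.mod_two_eq_zero_or_one t with ht | ht <;>
      rw [hy, ht] at hty <;> simp only [hm8, hz2, ht] <;> split_ifs <;>
      first | rfl | contradiction | omega
  have hmain := jacobi_unit_eq hp hr hr4 hxy hyz h hpy hry hTU hodd hw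
  have hleft := jacobi_ternary_left hq hq4 hr4 hx.1 hxy h hqx
  have hrec : J(p | T * y + U * (p * x)) = J(T | p) * J(y | p) := by
    rw [jacobiSym.quadratic_reciprocity_one_mod_four hp4 (Nat.odd_iff.2 hodd), ← jacobiSym.mul_left]
    exact jacobi_eq_of_dvd_sub ⟨U * x, by push_cast; ring⟩
  rw [hmain, neg_eq_neg_one_mul (p : ℤ), jacobiSym.mul_left, hrec, hneg, ← hleft, quart₁, quart₂,
    quart₃]
  simp only [jacobiSym.mul_left, hJpr, hJpq, hJqp]
  ring

/-- `p = 2`: the symbol of the unit is minus the quartic product. -/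
lemma jacobi_unit_eq_quartSym_of_two {q r : ℕ} (hq : q.Prime) (hr : r.Prime) (hqr : q ≠ r)
    (hq4 : q % 4 = 1) (hr4 : r % 4 = 1) (hJq : J(2 | q) = -1) (hJr : J(2 | r) = -1)
    {x y z T U : ℕ} (hxy : x.Coprime y) (hyz : y.Coprime z)
    (hzx : z.Coprime x) (h : 2 * x ^ 2 = q * y ^ 2 + r * z ^ 2)
    (hTU : T ^ 2 + 1 = 2 * q * U ^ 2) {w : ℤ} (hw : (r : ℤ) ∣ w * y - 2 * x) :
    J(T + U * w | r) = -(quartSym ((2 * q : ℕ) : ℤ) r * quartSym ((q * r : ℕ) : ℤ) 2 *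
      quartSym ((r * 2 : ℕ) : ℤ) q) := by
  have hq2 : q ≠ 2 := by omega
  have hr2 : r ≠ 2 := by omega
  obtain ⟨⟨hpy, hpz⟩, ⟨hqx, hqz⟩, hrx, hry⟩ :=
    not_dvd_of_ternary Nat.prime_two hq hr hq2.symm hqr hr2 hxy hyz hzx h
  have hz : (2 : ℤ) * x ^ 2 = q * y ^ 2 + r * z ^ 2 := by exact_mod_cast h
  have hTUz : (T : ℤ) ^ 2 + 1 = 2 * q * U ^ 2 := by exact_mod_cast hTU
  have mod8 : ∀ {l : ℕ}, l % 4 = 1 → J(2 | l) = -1 → l % 8 = 5 := fun {l} hl hJ => by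
    rw [jacobiSym.at_two (Nat.odd_iff.2 (by omega)), ZMod.χ₈_nat_eq_if_mod_eight] at hJ
    split_ifs at hJ
    omega
  have hq8 := mod8 hq4 hJq
  have hr8 := mod8 hr4 hJr
  have nd : ∀ {l a : ℕ}, l.Prime → l ≠ 2 → ¬ l ∣ a → ¬ (l : ℤ) ∣ 2 * a := fun hl hl2 ha hd => by
    rcases (Nat.prime_iff_prime_int.1 hl).dvd_or_dvd hd with h1 | h1
    · exact hl2 ((Nat.prime_dvd_prime_iff_eq hl Nat.prime_two).1 (by exact_mod_cast h1))
    · exact ha (Int.natCast_dvd_natCast.1 h1)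
  have quart₁ : quartSym ((2 * q : ℕ) : ℤ) r = J(2 * x * y | r) :=
    quartSym_eq_jacobi hr hr4 (nd hr hr2 hrx) ⟨2 * z ^ 2, by push_cast; linear_combination 2 * hz⟩
  have quart₃ : quartSym ((r * 2 : ℕ) : ℤ) q = J(2 * x * z | q) :=
    quartSym_eq_jacobi hq hq4 (nd hq hq2 hqx) ⟨2 * y ^ 2, by push_cast; linear_combination 2 * hz⟩
  have hy : y % 2 = 1 := by omega
  have hz1 : z % 2 = 1 := by omega
  obtain ⟨b, hb⟩ := odd_sq_eq (x := y) (by omega)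
  obtain ⟨c, hc⟩ := odd_sq_eq (x := z) (by omega)
  have hx : x % 2 = 1 := by
    by_contra hne
    obtain ⟨a, ha⟩ := even_sq_eq (x := x) (by omega)
    have : (q + r : ℤ) + 8 * (q * b + r * c) = 8 * a := by
      linear_combination -hz + 2 * ha - q * hb - r * hc
    omega
  obtain ⟨a, ha⟩ := odd_sq_eq (x := x) (by omega)
  have hU : U % 2 = 1 := by
    by_contra hne
    obtain ⟨j, hj⟩ := even_sq_eq (x := U) (by omega)
    have hT1 : (T : ℤ) ^ 2 + 1 = 8 * (q * j) := by linear_combination hTUz + 2 * q * hj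
    rcases Nat.mod_two_eq_zero_or_one T with ht | ht
    · obtain ⟨k, hk⟩ := even_sq_eq (x := T) (by omega)
      omega
    · obtain ⟨k, hk⟩ := odd_sq_eq (x := T) (by omega)
      omega
  have hU4 : U % 4 = 1 := mod_four_eq_one_of_dvd_sq_add_one hU (T := T)
    ⟨2 * q * U, by rw [hTUz]; ring⟩
  have sq_mod : ∀ {n : ℕ}, n % 2 = 1 → n ^ 2 % 16 = if n % 8 = 1 ∨ n % 8 = 7 then 1 else 9 := by
    intro n hn
    have h16 : n % 16 = 1 ∨ n % 16 = 3 ∨ n % 16 = 5 ∨ n % 16 = 7 ∨ n % 16 = 9 ∨ n % 16 = 11 ∨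
      n % 16 = 13 ∨ n % 16 = 15 := by omega
    have h8 : n % 8 = n % 16 % 8 := by omega
    rcases h16 with h1 | h1 | h1 | h1 | h1 | h1 | h1 | h1 <;> simp [Nat.pow_mod, h8, h1]
  have hT : T % 8 = 3 ∨ T % 8 = 5 := by
    obtain ⟨j, hj⟩ := odd_sq_eq (x := U) (by omega)
    have hT1 : (T : ℤ) ^ 2 + 1 = 2 * q + 16 * (q * j) := by
      linear_combination hTUz + 2 * q * hj
    have hT2 : T % 2 = 1 := by
      by_contra hne
      obtain ⟨k, hk⟩ := even_sq_eq (x := T) (by omega)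
      omega
    have hT3 := sq_mod hT2
    zify at hT3
    split_ifs at hT3 <;> omega
  have hodd : (T * y + U * (2 * x)) % 2 = 1 := by
    have : T * y % 2 = 1 := by rw [Nat.mul_mod, hy]; omega
    have : U * (2 * x) = 2 * (U * x) := by ring
    omega
  have quart₂ : quartSym ((q * r : ℕ) : ℤ) 2 = J(2 | y) * J(2 | z) := by
    have two_eq : ∀ {n : ℕ}, n % 2 = 1 → J(2 | n) = if n ^ 2 % 16 = 1 then 1 else -1 := by
      intro n hn
      rw [sq_mod hn, jacobiSym.at_two (Nat.odd_iff.2 hn), ZMod.χ₈_nat_eq_if_mod_eight]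
      split_ifs <;> omega
    have h2 : ∀ {n : ℕ}, n % 2 = 1 → n ^ 2 % 16 = 1 ∨ n ^ 2 % 16 = 9 := fun hn => by
      rw [sq_mod hn]
      split_ifs <;> simp
    have hsum : (q % 16 * (y ^ 2 % 16) + r % 16 * (z ^ 2 % 16)) % 16 = 2 := by
      rw [Nat.add_mod, ← Nat.mul_mod, ← Nat.mul_mod, ← Nat.add_mod, ← h]
      zify
      omega
    have hprod := Nat.mul_mod q r 16
    have hq16 : q % 16 = 5 ∨ q % 16 = 13 := by omega
    have hr16 : r % 16 = 5 ∨ r % 16 = 13 := by omega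
    rw [two_eq hy, two_eq hz1]
    simp only [quartSym, if_true]
    norm_cast
    rcases hq16 with hq16 | hq16 <;> rcases hr16 with hr16 | hr16 <;>
      rcases h2 hy with hy2 | hy2 <;> rcases h2 hz1 with hz2 | hz2 <;>
      rw [hq16, hr16, hy2, hz2] at hsum <;> rw [hq16, hr16] at hprod <;>
      simp [hprod, hy2, hz2] at hsum ⊢
  have hyr : J(y | r) = J(2 | y) := by
    rw [← jacobiSym.quadratic_reciprocity_one_mod_four hr4 (Nat.odd_iff.2 hy)]
    have : J(2 * r | y) = 1 := by
      refine jacobi_eq_one_of_dvd_sq_sub (X := r * z) (Y := x) ?_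
        ⟨-(r * q * y), by linear_combination -r * hz⟩
      exact (Nat.isCoprime_iff_coprime.2 (hr.coprime_iff_not_dvd.2 hry)).mul_left
        (Nat.isCoprime_iff_coprime.2 hyz.symm)
    rw [jacobiSym.mul_left] at this
    exact (Int.eq_of_mul_eq_one this).symm
  have hzq : J(z | q) = J(2 | z) := by
    rw [← jacobiSym.quadratic_reciprocity_one_mod_four hq4 (Nat.odd_iff.2 hz1)]
    have : J(2 * q | z) = 1 := by
      refine jacobi_eq_one_of_dvd_sq_sub (X := q * y) (Y := x) ?_
        ⟨-(r * q * z), by linear_combination -q * hz⟩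
      exact (Nat.isCoprime_iff_coprime.2 (hq.coprime_iff_not_dvd.2 hqz)).mul_left
        (Nat.isCoprime_iff_coprime.2 hyz)
    rw [jacobiSym.mul_left] at this
    exact (Int.eq_of_mul_eq_one this).symm
  have two_sq : ∀ {n : ℕ}, n % 2 = 1 → J(2 | n) * J(2 | n) = 1 := fun {n} hn => by
    rw [← jacobiSym.mul_left, ← sq]
    exact jacobiSym.sq_one' ((Nat.coprime_two_left.2 (Nat.odd_iff.2 hn)))
  have hneg : J(-2 | T * y + U * (2 * x)) * J(2 | y) = -J(-1 | x) := by
    rw [jacobiSym.at_neg_one (Nat.odd_iff.2 hx), jacobiSym.at_neg_two (Nat.odd_iff.2 hodd),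
      jacobiSym.at_two (Nat.odd_iff.2 hy), ZMod.χ₈_nat_mod_eight, ← ZMod.natCast_mod (_ + _) 8,
      ZMod.χ₄_nat_mod_four]
    have hL : (T * y + U * (2 * x)) % 8 = (T % 8 * (y % 8) + 2 * (x % 4)) % 8 := by
      have h1 : U * (2 * x) % 8 = 2 * (x % 4) := by
        obtain ⟨u, rfl⟩ : ∃ u, U = 4 * u + 1 := ⟨U / 4, by omega⟩
        have : (4 * u + 1) * (2 * x) = 8 * (u * x) + 2 * x := by ring
        omega
      rw [Nat.add_mod, Nat.mul_mod, h1]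
      omega
    rw [hL]
    have hy8 : y % 8 = 1 ∨ y % 8 = 3 ∨ y % 8 = 5 ∨ y % 8 = 7 := by omega
    have hx4 : x % 4 = 1 ∨ x % 4 = 3 := by omega
    rcases hT with h1 | h1 <;> rcases hy8 with h2 | h2 | h2 | h2 <;> rcases hx4 with h3 | h3 <;>
      rw [h1, h2, h3] <;> decide
  have hmain := jacobi_unit_eq Nat.prime_two hr hr4 hxy hyz h hpy hry hTU hodd hw
  have hleft := jacobi_ternary_left hq hq4 hr4 hx hxy h hqx
  rw [hmain, hyr, Nat.cast_ofNat, hneg, quart₁, quart₂, quart₃, ← hleft]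
  simp only [jacobiSym.mul_left, hJq, hJr, hyr, hzq]
  linear_combination J(x | q) * J(x | r) * two_sq hy +
    J(x | q) * J(x | r) * J(2 | y) * J(2 | y) * two_sq hz1

lemma eq_of_add_mul_sqrt_eq {m : ℕ} (hm : Irrational √(m : ℝ)) {a b c d : ℚ}
    (h : (a + b * √(m : ℝ) : ℝ) = c + d * √(m : ℝ)) : a = c ∧ b = d := by
  have hbd : b = d := by
    by_contra hne
    have h1 : ((b - d : ℚ) : ℝ) ≠ 0 := by exact_mod_cast sub_ne_zero.2 hne
    refine hm ⟨(c - a) / (b - d), ?_⟩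
    push_cast at h1 ⊢
    rw [div_eq_iff h1]
    linear_combination -h
  refine ⟨?_, hbd⟩
  rw [hbd] at h
  exact_mod_cast add_right_cancel h

lemma exists_pow_eq_add_mul_sqrt (m : ℕ) (a b : ℚ) (k : ℕ) :
    ∃ c d : ℚ, (a + b * √(m : ℝ) : ℝ) ^ k = c + d * √(m : ℝ) ∧
      c ^ 2 - m * d ^ 2 = (a ^ 2 - m * b ^ 2) ^ k := by
  have hs : √(m : ℝ) ^ 2 = m := Real.sq_sqrt (Nat.cast_nonneg m)
  induction k with
  | zero => exact ⟨1, 0, by simp, by simp⟩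
  | succ k ih =>
    obtain ⟨c, d, h, hn⟩ := ih
    refine ⟨c * a + m * (d * b), c * b + d * a, ?_, ?_⟩
    · rw [pow_succ, h]
      push_cast
      linear_combination (d * b : ℝ) * hs
    · rw [pow_succ (a ^ 2 - m * b ^ 2 : ℚ) k, ← hn]
      ring

lemma isIntegral_add_mul_sqrt (m : ℕ) (T U : ℤ) : IsIntegral ℤ (T + U * √(m : ℝ)) := by
  have hs : IsIntegral ℤ √(m : ℝ) := by
    refine IsIntegral.of_pow two_pos ?_
    rw [Real.sq_sqrt (Nat.cast_nonneg m)]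
    exact isIntegral_algebraMap (R := ℤ) (x := m)
  exact (isIntegral_algebraMap (R := ℤ) (x := T)).add
    ((isIntegral_algebraMap (R := ℤ) (x := U)).mul hs)

/-- A solution of the negative Pell equation forces the fundamental unit to have norm `-1`, and is
an odd power of it. -/
lemma IsFundUnit.normNegOne_of_neg_pell {m : ℕ} {ε : ℝ} (hε : IsFundUnit m ε)
    (hm : Irrational √(m : ℝ)) {T U : ℤ} (hU : 0 < U) (h : T ^ 2 + 1 = m * U ^ 2) :
    NormNegOne m ε ∧ ∃ k : ℤ, T + U * √(m : ℝ) = ε ^ (2 * k + 1) := by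
  have hs : √(m : ℝ) ^ 2 = m := Real.sq_sqrt (Nat.cast_nonneg m)
  have hs0 : 0 < √(m : ℝ) := lt_of_le_of_ne (Real.sqrt_nonneg _) hm.ne_zero.symm
  have hR : (T : ℝ) ^ 2 + 1 = m * U ^ 2 := by exact_mod_cast h
  have hEpos : 0 < T + U * √(m : ℝ) :=
    add_mul_pos_of_sq_add_one (Int.cast_pos.2 hU) hs0 (by rw [hs, hR, mul_comm])
  have hinv : (T + U * √(m : ℝ))⁻¹ = ((-T : ℤ) : ℝ) + U * √(m : ℝ) := by
    refine inv_eq_of_mul_eq_one_right ?_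
    push_cast
    linear_combination -hR + (U : ℝ) ^ 2 * hs
  have hInO : ∀ S : ℤ, InO m (S + U * √(m : ℝ)) := fun S =>
    ⟨⟨S, U, by push_cast; rfl⟩, isIntegral_add_mul_sqrt m S U⟩
  obtain ⟨⟨⟨a, b, hab⟩, -⟩, -, hε1, hgen⟩ := hε
  obtain ⟨n, hn⟩ := hgen _ (hInO T) (by rw [hinv]; exact hInO (-T))
  have hεpos : 0 < ε := one_pos.trans hε1
  replace hn : T + U * √(m : ℝ) = ε ^ n :=
    hn.resolve_right fun h1 => by linarith [zpow_pos hεpos n]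
  have key : ∀ (S : ℤ) (k : ℕ), S ^ 2 = T ^ 2 → S + U * √(m : ℝ) = ε ^ k →
      Odd k ∧ a ^ 2 - m * b ^ 2 = -1 := by
    intro S k hS hk
    obtain ⟨c, d, hcd, hnorm⟩ := exists_pow_eq_add_mul_sqrt m a b k
    rw [← hab, ← hk] at hcd
    obtain ⟨h1, h2⟩ := eq_of_add_mul_sqrt_eq hm (a := S) (b := U) (by push_cast; exact hcd)
    rw [← h1, ← h2] at hnorm
    have hnorm' : (a ^ 2 - m * b ^ 2) ^ k = -1 := by
      rw [← hnorm]
      have : (S : ℚ) ^ 2 + 1 = m * U ^ 2 := by exact_mod_cast hS ▸ h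
      linear_combination this
    have hodd : Odd k := by
      by_contra heven
      have := (Nat.not_odd_iff_even.1 heven).pow_nonneg (a ^ 2 - m * b ^ 2)
      linarith
    refine ⟨hodd, hodd.strictMono_pow.injective ?_⟩
    simp only [hnorm', hodd.neg_one_pow]
  have hconc : a ^ 2 - m * b ^ 2 = -1 ∧ Odd n := by
    obtain ⟨k, rfl | rfl⟩ := n.eq_nat_or_neg
    · obtain ⟨h1, h2⟩ := key T k rfl (by rw [hn, zpow_natCast])
      exact ⟨h2, by exact_mod_cast h1⟩
    · obtain ⟨h1, h2⟩ := key (-T) k (by ring) (by rw [← hinv, hn, zpow_neg, zpow_natCast, inv_inv])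
      exact ⟨h2, Odd.neg (by exact_mod_cast h1)⟩
  obtain ⟨k, hk⟩ := hconc.2
  exact ⟨⟨a, b, hab, hconc.1⟩, k, by rw [hn, hk]⟩

lemma exists_sq_eq_odd_zpow_iff {K : IntermediateField ℚ ℝ} {a b c : ℝ} (ha : a ∈ K) (hb : b ∈ K)
    (hc : c ∈ K) (ha0 : a ≠ 0) (hb0 : b ≠ 0) (hc0 : c ≠ 0) (i j k : ℤ) :
    (∃ β ∈ K, β ^ 2 = a ^ (2 * i + 1) * b ^ (2 * j + 1) * c ^ (2 * k + 1)) ↔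
      ∃ β ∈ K, β ^ 2 = a * b * c := by
  have hmem : a ^ i * b ^ j * c ^ k ∈ K :=
    mul_mem (mul_mem (zpow_mem ha i) (zpow_mem hb j)) (zpow_mem hc k)
  have h0 : a ^ i * b ^ j * c ^ k ≠ 0 :=
    mul_ne_zero (mul_ne_zero (zpow_ne_zero i ha0) (zpow_ne_zero j hb0)) (zpow_ne_zero k hc0)
  have hsplit : a ^ (2 * i + 1) * b ^ (2 * j + 1) * c ^ (2 * k + 1) =
      (a ^ i * b ^ j * c ^ k) ^ 2 * (a * b * c) := by
    rw [zpow_add₀ ha0, zpow_add₀ hb0, zpow_add₀ hc0]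
    simp only [two_mul, zpow_add₀ ha0, zpow_add₀ hb0, zpow_add₀ hc0, zpow_one]
    ring
  rw [hsplit]
  constructor
  · rintro ⟨β, hβ, h⟩
    exact ⟨β / _, div_mem hβ hmem, by rw [div_pow, h, mul_div_cancel_left₀ _ (pow_ne_zero 2 h0)]⟩
  · rintro ⟨β, hβ, h⟩
    exact ⟨_, mul_mem hmem hβ, by rw [mul_pow, h]⟩

lemma irrational_sqrt_mul {p q : ℕ} (hp : p.Prime) (hq : q.Prime) (hpq : p ≠ q) :
    Irrational √((p * q : ℕ) : ℝ) := by
  rw [irrational_sqrt_natCast_iff]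
  rintro ⟨a, ha⟩
  have h1 : p ∣ a := (or_self_iff.1 (hp.dvd_mul.1 (ha ▸ Dvd.intro _ rfl)))
  have h2 : p * p ∣ p * q := ha ▸ mul_dvd_mul h1 h1
  exact hpq ((Nat.prime_dvd_prime_iff_eq hp hq).1 (Nat.dvd_of_mul_dvd_mul_left hp.pos h2))

lemma exists_dvd_mul_sq_sub {l : ℕ} (hl : l.Prime) {a b : ℤ} (ha : J(a | l) = -1)
    (hb : J(b | l) = -1) : ∃ x : ℤ, (l : ℤ) ∣ a * x ^ 2 - b := by
  have := Fact.mk hl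
  have ha0 : (a : ZMod l) ≠ 0 := fun h0 => by
    have hd := (ZMod.intCast_zmod_eq_zero_iff_dvd a l).1 h0
    have h1 : J(a | l) = J(0 | l) := jacobi_eq_of_dvd_sub (by simpa using hd)
    rw [ha, jacobiSym.zero_left hl.one_lt] at h1
    omega
  obtain ⟨c, hc⟩ := ZMod.isSquare_of_jacobiSym_eq_one (a := a * b) (p := l)
    (by rw [jacobiSym.mul_left, ha, hb]; rfl)
  obtain ⟨x, hx⟩ := ZMod.intCast_surjective (c / (a : ZMod l))
  refine ⟨x, (ZMod.intCast_zmod_eq_zero_iff_dvd _ l).1 ?_⟩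
  push_cast at hc ⊢
  rw [hx]
  field_simp
  linear_combination -hc

lemma sqrt_mul_mem_adjoin {p q r : ℕ} (hp : p ≠ 0) :
    √((q * r : ℕ) : ℝ) ∈ IntermediateField.adjoin ℚ {√((p * q : ℕ) : ℝ), √((p * r : ℕ) : ℝ)} := by
  have h1 : √((p * q : ℕ) : ℝ) * √((p * r : ℕ) : ℝ) = p * √((q * r : ℕ) : ℝ) := by
    rw [← Real.sqrt_mul (Nat.cast_nonneg _), ← Real.sqrt_sq (Nat.cast_nonneg p),
      ← Real.sqrt_mul (sq_nonneg _)]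
    push_cast
    ring_nf
  have h2 : √((q * r : ℕ) : ℝ) = √((p * q : ℕ) : ℝ) * √((p * r : ℕ) : ℝ) / p := by
    rw [h1, mul_div_cancel_left₀ _ (Nat.cast_ne_zero.2 hp)]
  rw [h2]
  exact div_mem (mul_mem (IntermediateField.subset_adjoin _ _ (by simp))
    (IntermediateField.subset_adjoin _ _ (by simp))) (natCast_mem _ p)

lemma adjoin_sqrt_rotate {p q r : ℕ} (hp : p ≠ 0) (hq : q ≠ 0) :
    IntermediateField.adjoin ℚ {√((q * r : ℕ) : ℝ), √((q * p : ℕ) : ℝ)} =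
      IntermediateField.adjoin ℚ {√((p * q : ℕ) : ℝ), √((p * r : ℕ) : ℝ)} := by
  refine le_antisymm (IntermediateField.adjoin_le_iff.2 ?_) (IntermediateField.adjoin_le_iff.2 ?_)
  · rintro x (rfl | rfl)
    · exact sqrt_mul_mem_adjoin hp
    · exact IntermediateField.subset_adjoin _ _ (by simp [mul_comm])
  · rintro x (rfl | rfl)
    · exact IntermediateField.subset_adjoin _ _ (by simp [mul_comm])
    · rw [Set.pair_comm]
      exact sqrt_mul_mem_adjoin hq

lemma exists_ternary_of_jacobi {p q r : ℕ} (hp : p.Prime) (hq : q.Prime) (hr : r.Prime)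
    (hpq : p ≠ q) (hqr : q ≠ r) (hrp : r ≠ p)
    (hp4 : p = 2 ∨ p % 4 = 1) (hq4 : q % 4 = 1) (hr4 : r % 4 = 1) (hJpq : J(p | q) = -1)
    (hJqr : J(q | r) = -1) (hJpr : J(p | r) = -1) :
    ∃ x y z : ℕ, 0 < x ∧ 0 < y ∧ 0 < z ∧ x.Coprime y ∧ y.Coprime z ∧ z.Coprime x ∧
      p * x ^ 2 = q * y ^ 2 + r * z ^ 2 := by
  have hJrq : J(r | q) = -1 := by
    rw [jacobiSym.quadratic_reciprocity_one_mod_four hr4 (Nat.odd_iff.2 (by omega)), hJqr]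
  obtain ⟨β, hβ⟩ := exists_dvd_mul_sq_sub hq hJpq hJrq
  obtain ⟨γ, hγ⟩ := exists_dvd_mul_sq_sub hr hJpr hJqr
  obtain ⟨α, hα⟩ : ∃ α : ℤ, (p : ℤ) ∣ q * α ^ 2 + r := by
    rcases hp4 with rfl | hp4
    · exact ⟨1, by push_cast; omega⟩
    · have hpodd : Odd p := Nat.odd_iff.2 (by omega)
      obtain ⟨α, hα⟩ := exists_dvd_mul_sq_sub hp (a := q) (b := -r)
        (by rw [jacobiSym.quadratic_reciprocity_one_mod_four hq4 hpodd, hJpq])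
        (by rw [jacobiSym.neg _ hpodd, ZMod.χ₄_nat_one_mod_four hp4,
          jacobiSym.quadratic_reciprocity_one_mod_four hr4 hpodd, hJpr]; rfl)
      exact ⟨α, by rwa [sub_neg_eq_add] at hα⟩
  exact exists_coprime_ternary hp hq hr hpq hqr hrp hα hβ hγ

lemma prod_isSquare_iff_of_jacobi {p q r : ℕ} (hp : p.Prime) (hq : q.Prime) (hr : r.Prime)
    (hpq : p ≠ q) (hqr : q ≠ r) (hrp : r ≠ p)
    (hp4 : p = 2 ∨ p % 4 = 1) (hq4 : q % 4 = 1) (hr4 : r % 4 = 1) (hJpq : J(p | q) = -1)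
    (hJqr : J(q | r) = -1) (hJpr : J(p | r) = -1) {ε₁ ε₂ ε₃ : ℝ}
    (hε₁ : IsFundUnit (p * q) ε₁) (hε₂ : IsFundUnit (q * r) ε₂) (hε₃ : IsFundUnit (r * p) ε₃) :
    NormNegOne (p * q) ε₁ ∧ NormNegOne (q * r) ε₂ ∧ NormNegOne (r * p) ε₃ ∧
    ((∃ β : ℝ, β ∈ IntermediateField.adjoin ℚ
        {√((p * q : ℕ) : ℝ), √((p * r : ℕ) : ℝ)} ∧ β ^ 2 = ε₁ * ε₂ * ε₃) ↔
      quartSym ((p * q : ℕ) : ℤ) r * quartSym ((q * r : ℕ) : ℤ) p *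
        quartSym ((r * p : ℕ) : ℤ) q = -1) := by
  have hp3 : p % 4 ≠ 3 := by omega
  have hp0 : p % 4 ≠ 0 := by omega
  obtain ⟨T₁, U₁, hT₁, hU₁, h₁⟩ := exists_neg_pell hp hq hpq hp3 hp0 hq4 hJpq
  obtain ⟨T₂, U₂, -, hU₂, h₂⟩ := exists_neg_pell hq hr hqr (by omega) (by omega) hr4 hJqr
  obtain ⟨T₃, U₃, -, hU₃, h₃⟩ := exists_neg_pell hp hr hrp.symm hp3 hp0 hr4 hJpr
  rw [mul_comm (p : ℤ) r] at h₃
  obtain ⟨x, y, z, -, -, hz0, hxy, hyz, hzx, h⟩ :=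
    exists_ternary_of_jacobi hp hq hr hpq hqr hrp hp4 hq4 hr4 hJpq hJqr hJpr
  have hry := (not_dvd_of_ternary hp hq hr hpq hqr hrp hxy hyz hzx h).2.2.2
  obtain ⟨w, hw⟩ : ∃ w : ℤ, (r : ℤ) ∣ w * y - p * x := by
    obtain ⟨a, b, hab⟩ := Nat.isCoprime_iff_coprime.2 ((hr.coprime_iff_not_dvd.2 hry).symm)
    exact ⟨a * (p * x), -(b * (p * x)), by linear_combination (p * x : ℤ) * hab⟩
  have hw' : (r : ℤ) ∣ w ^ 2 - p * q := by
    have hrz : Prime (r : ℤ) := Nat.prime_iff_prime_int.1 hr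
    have hmul : (r : ℤ) ∣ (y : ℤ) ^ 2 * (w ^ 2 - p * q) := by
      have hz : (p : ℤ) * x ^ 2 = q * y ^ 2 + r * z ^ 2 := by exact_mod_cast h
      obtain ⟨c, hc⟩ := hw
      exact ⟨c * (w * y + p * x) + p * z ^ 2,
        by linear_combination (w * y + p * x : ℤ) * hc + (p : ℤ) * hz⟩
    exact (hrz.dvd_or_dvd hmul).resolve_left fun hd =>
      hry (Int.natCast_dvd_natCast.1 (hrz.dvd_of_dvd_pow hd))
  obtain ⟨S₁, S₃, hS₁, hS₃, hnd, hJ⟩ := exists_sign_jacobi_unitResolvent hr hr4 h₁ h₂ h₃ hw'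
  have hquart : J(T₁ + U₁ * w | r) = -(quartSym ((p * q : ℕ) : ℤ) r *
      quartSym ((q * r : ℕ) : ℤ) p * quartSym ((r * p : ℕ) : ℤ) q) := by
    lift T₁ to ℕ using hT₁.le
    lift U₁ to ℕ using hU₁.le
    have hTU : T₁ ^ 2 + 1 = p * q * U₁ ^ 2 := by exact_mod_cast h₁
    rcases hp4 with rfl | hp4
    · exact jacobi_unit_eq_quartSym_of_two hq hr hqr hq4 hr4 hJpq hJpr hxy hyz hzx h hTU hw
    · exact jacobi_unit_eq_quartSym_of_odd hp hq hr hpq hqr hrp hp4 hq4 hr4 hJpq hJpr hz0.ne' hxy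
        hyz hzx h hTU hw
  rw [← hS₁] at h₁
  rw [← hS₃] at h₃
  set K := IntermediateField.adjoin ℚ {√((p * q : ℕ) : ℝ), √((p * r : ℕ) : ℝ)} with hK
  have hK₁ : √((p * q : ℕ) : ℝ) ∈ K := IntermediateField.subset_adjoin _ _ (by simp)
  have hK₂ : √((q * r : ℕ) : ℝ) ∈ K := sqrt_mul_mem_adjoin hp.ne_zero
  have hK₃ : √((r * p : ℕ) : ℝ) ∈ K :=
    IntermediateField.subset_adjoin _ _ (by simp [mul_comm])
  have sqrt_pos : ∀ {a b : ℕ}, a.Prime → b.Prime → 0 < √((a * b : ℕ) : ℝ) := fun ha hb =>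
    Real.sqrt_pos.2 (Nat.cast_pos.2 (Nat.mul_pos ha.pos hb.pos))
  have sqrt_sq : ∀ a b : ℕ, √((a * b : ℕ) : ℝ) ^ 2 = a * b := fun a b => by
    rw [Real.sq_sqrt (Nat.cast_nonneg _), Nat.cast_mul]
  have hmem : ∀ {m : ℕ} {ε : ℝ}, IsFundUnit m ε → √(m : ℝ) ∈ K → ε ∈ K := by
    rintro m ε ⟨⟨⟨a, b, rfl⟩, -⟩, -⟩ hm
    exact add_mem (SubfieldClass.ratCast_mem K a) (mul_mem (SubfieldClass.ratCast_mem K b) hm)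
  have hne : ∀ {m : ℕ} {ε : ℝ}, IsFundUnit m ε → ε ≠ 0 := fun hε =>
    (one_pos.trans hε.2.2.1).ne'
  obtain ⟨n₁, i, hi⟩ := hε₁.normNegOne_of_neg_pell (irrational_sqrt_mul hp hq hpq) hU₁
    (by push_cast; exact h₁)
  obtain ⟨n₂, j, hj⟩ := hε₂.normNegOne_of_neg_pell (irrational_sqrt_mul hq hr hqr) hU₂
    (by push_cast; exact h₂)
  obtain ⟨n₃, k, hk⟩ := hε₃.normNegOne_of_neg_pell (irrational_sqrt_mul hr hp hrp) hU₃
    (by push_cast; exact h₃)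
  refine ⟨n₁, n₂, n₃, ?_⟩
  rw [← exists_sq_eq_odd_zpow_iff (hmem hε₁ hK₁) (hmem hε₂ hK₂) (hmem hε₃ hK₃) (hne hε₁)
    (hne hε₂) (hne hε₃) i j k, ← hi, ← hj, ← hk,
    exists_sq_eq_prod_iff_jacobi hp hq hr hpq hp4 hq4 hr4 hJpr hJqr h₁ h₂ h₃ hU₁ hU₂ hU₃ hnd
      (sqrt_pos hp hq) (sqrt_pos hq hr) (sqrt_pos hr hp) (sqrt_sq p q) (sqrt_sq q r) (sqrt_sq r p)
      hK₁ hK₂ hK₃ (fun x hx => not_sq_in_biquadratic hp hq hr hpq hqr hrp (Or.inl rfl) hx)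
      (fun x hx => not_sq_in_biquadratic hp hq hr hpq hqr hrp (Or.inr rfl) hx),
    hJ, hquart, neg_eq_iff_eq_neg]

lemma mod_four_eq_one_of_prime {p : ℕ} (hp : p.Prime) (hp4 : p % 4 ≠ 3) (hp2 : p ≠ 2) :
    p % 4 = 1 := by
  have := hp.eq_two_or_odd
  omega

lemma jacobi_of_legSym {p q : ℕ} (hq : q.Prime) (hq2 : q ≠ 2) (h : legSym p q = -1) :
    J(p | q) = -1 := by
  have := Fact.mk hq
  rw [legSym, if_neg hq2] at h
  have hns : ¬ ∃ x : ℤ, (q : ℤ) ∣ x ^ 2 - p := fun hx => by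
    rw [if_pos hx] at h
    omega
  rw [← jacobiSym.legendreSym.to_jacobiSym, legendreSym.eq_neg_one_iff]
  rintro ⟨c, hc⟩
  obtain ⟨x, rfl⟩ := ZMod.intCast_surjective c
  refine hns ⟨x, (ZMod.intCast_zmod_eq_zero_iff_dvd _ q).1 ?_⟩
  push_cast at hc ⊢
  linear_combination -hc

lemma jacobi_swap_of_legSym {p q : ℕ} (hp : p.Prime) (hq : q.Prime) (hp4 : p % 4 ≠ 3)
    (hp2 : p ≠ 2) (h : legSym p q = -1) : J(q | p) = -1 := by
  have hp1 := mod_four_eq_one_of_prime hp hp4 hp2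
  have hpodd : Odd p := Nat.odd_iff.2 (by omega)
  by_cases hq2 : q = 2
  · subst hq2
    have h8 : ¬ ((p : ℤ) % 8 = 1 ∨ (p : ℤ) % 8 = 7) := fun h8 => by
      rw [legSym, if_pos rfl, if_pos h8] at h
      omega
    rw [Nat.cast_two, jacobiSym.at_two hpodd, ZMod.χ₈_nat_eq_if_mod_eight]
    split_ifs <;> omega
  · rw [← jacobiSym.quadratic_reciprocity_one_mod_four hp1
      (Nat.odd_iff.2 (hq.eq_two_or_odd.resolve_left hq2)), jacobi_of_legSym hq hq2 h]

lemma prod_isSquare_iff_of_legSym {p q r : ℕ} (hp : p.Prime) (hq : q.Prime) (hr : r.Prime)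
    (hpq : p ≠ q) (hqr : q ≠ r) (hrp : r ≠ p)
    (hp4 : p % 4 ≠ 3) (hq4 : q % 4 ≠ 3) (hr4 : r % 4 ≠ 3) (hq2 : q ≠ 2) (hr2 : r ≠ 2)
    (h1 : legSym (p : ℤ) q = -1) (h2 : legSym (q : ℤ) r = -1) (h3 : legSym (r : ℤ) p = -1)
    {ε₁ ε₂ ε₃ : ℝ}
    (hε₁ : IsFundUnit (p * q) ε₁) (hε₂ : IsFundUnit (q * r) ε₂) (hε₃ : IsFundUnit (r * p) ε₃) :
    NormNegOne (p * q) ε₁ ∧ NormNegOne (q * r) ε₂ ∧ NormNegOne (r * p) ε₃ ∧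
    ((∃ β : ℝ, β ∈ IntermediateField.adjoin ℚ
        {√((p * q : ℕ) : ℝ), √((p * r : ℕ) : ℝ)} ∧ β ^ 2 = ε₁ * ε₂ * ε₃) ↔
      quartSym ((p * q : ℕ) : ℤ) r * quartSym ((q * r : ℕ) : ℤ) p *
        quartSym ((r * p : ℕ) : ℤ) q = -1) :=
  prod_isSquare_iff_of_jacobi hp hq hr hpq hqr hrp
    ((eq_or_ne p 2).imp_right (mod_four_eq_one_of_prime hp hp4))
    (mod_four_eq_one_of_prime hq hq4 hq2) (mod_four_eq_one_of_prime hr hr4 hr2)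
    (jacobi_of_legSym hq hq2 h1) (jacobi_of_legSym hr hr2 h2)
    (jacobi_swap_of_legSym hr hp hr4 hr2 h3) hε₁ hε₂ hε₃

theorem stmt_10 (p q r : ℕ)
    (hp : p.Prime) (hq : q.Prime) (hr : r.Prime)
    (hpq : p ≠ q) (hqr : q ≠ r) (hrp : r ≠ p)
    (hp4 : p % 4 ≠ 3) (hq4 : q % 4 ≠ 3) (hr4 : r % 4 ≠ 3)
    (h1 : legSym (p : ℤ) q = -1) (h2 : legSym (q : ℤ) r = -1) (h3 : legSym (r : ℤ) p = -1)
    (ε₁ ε₂ ε₃ : ℝ)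
    (hε₁ : IsFundUnit (p * q) ε₁) (hε₂ : IsFundUnit (q * r) ε₂) (hε₃ : IsFundUnit (r * p) ε₃) :
    NormNegOne (p * q) ε₁ ∧ NormNegOne (q * r) ε₂ ∧ NormNegOne (r * p) ε₃ ∧
    ((∃ β : ℝ, β ∈ IntermediateField.adjoin ℚ
        {Real.sqrt ((p * q : ℕ) : ℝ), Real.sqrt ((p * r : ℕ) : ℝ)} ∧ β ^ 2 = ε₁ * ε₂ * ε₃) ↔
      quartSym ((p * q : ℕ) : ℤ) r * quartSym ((q * r : ℕ) : ℤ) p *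
        quartSym ((r * p : ℕ) : ℤ) q = -1) := by
  by_cases hq2 : q = 2
  · obtain ⟨n₂, n₃, n₁, h⟩ := prod_isSquare_iff_of_legSym hq hr hp hqr hrp hpq hq4 hr4 hp4
      (fun h => hqr (hq2.trans h.symm)) (fun h => hpq (h.trans hq2.symm)) h2 h3 h1 hε₂ hε₃ hε₁
    rw [adjoin_sqrt_rotate hp.ne_zero hq.ne_zero,
      show ε₂ * ε₃ * ε₁ = ε₁ * ε₂ * ε₃ by ring] at h
    refine ⟨n₁, n₂, n₃, h.trans ?_⟩
    rw [← mul_rotate]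
  by_cases hr2 : r = 2
  · obtain ⟨n₃, n₁, n₂, h⟩ := prod_isSquare_iff_of_legSym hr hp hq hrp hpq hqr hr4 hp4 hq4
      (fun h => hrp (hr2.trans h.symm)) hq2 h3 h1 h2 hε₃ hε₁ hε₂
    rw [adjoin_sqrt_rotate hq.ne_zero hr.ne_zero, adjoin_sqrt_rotate hp.ne_zero hq.ne_zero,
      show ε₃ * ε₁ * ε₂ = ε₁ * ε₂ * ε₃ by ring] at h
    refine ⟨n₁, n₂, n₃, h.trans ?_⟩
    rw [mul_rotate]
  exact prod_isSquare_iff_of_legSym hp hq hr hpq hqr hrp hp4 hq4 hr4 hq2 hr2 h1 h2 h3 hε₁ hε₂ hε₃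
end
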